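/- (Kulkarni) Let p and q be odd positive integers. There is no discrete subgroup Γ of O(p+1,q) whose action by matrix-vector multiplication on the quadric X = {x ∈ ℝ^{p+1+q} : x₁² + ⋯ + x_{p+1}² − x_{p+2}² − ⋯ − x_{p+1+q}² = 1} is free, properly discontinuous and cocompact. Equivalently, the pseudo-Riemannian space form O(p,q)\O(p+1,q) has no compact Clifford–Klein form when p and q are odd. -/

import Mathlib

open Matrix

/-- The symmetric form matrix `η` of signature `(a, b)` on `ℝ^{a+b}`:
`a` entries `+1` followed by `b` entries `−1`. -/
def pseudoForm (a b : ℕ) : Matrix (Fin (a + b)) (Fin (a + b)) ℝ :=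
  Matrix.diagonal (fun i => if (i : ℕ) < a then (1 : ℝ) else -1)

/-- The quadric `{x ∈ ℝ^{a+b} : x₁² + ⋯ + x_a² − x_{a+1}² − ⋯ − x_{a+b}² = 1}`. -/
def pseudoSphere (a b : ℕ) : Set (Fin (a + b) → ℝ) :=
  {x | ∑ i : Fin (a + b), (if (i : ℕ) < a then (1 : ℝ) else -1) * x i ^ 2 = 1}

section
open Matrix

namespace Kulk

section Sqrt
open scoped MatrixOrder

lemma exists_posDef_sqrt {n : ℕ} {Y : Matrix (Fin n) (Fin n) ℝ} (hY : Y.PosDef) :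
    ∃ S : Matrix (Fin n) (Fin n) ℝ, S.PosDef ∧ S * S = Y := by
  refine ⟨CFC.sqrt Y, ?_, CFC.sqrt_mul_sqrt_self Y hY.posSemidef.nonneg⟩
  have h := CFC.sqrt_mul_sqrt_self Y hY.posSemidef.nonneg
  have hps : (CFC.sqrt Y).PosSemidef := (CFC.sqrt_nonneg Y).posSemidef
  refine (Matrix.PosSemidef.posDef_iff_isUnit hps).2 ?_
  have : IsUnit (CFC.sqrt Y * CFC.sqrt Y) := by rw [h]; exact hY.isUnit
  exact isUnit_of_mul_isUnit_left this

lemma posDef_sqrt_unique {n : ℕ} {S S' : Matrix (Fin n) (Fin n) ℝ} (hS : S.PosDef)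
    (hS' : S'.PosDef) (h : S * S = S' * S') : S = S' := by
  have h1 := CFC.sqrt_unique (a := S' * S') (b := S) h hS.posSemidef.nonneg
  have h2 := CFC.sqrt_unique (a := S' * S') (b := S') rfl hS'.posSemidef.nonneg
  exact h1.symm.trans h2

open Classical in
/-- the positive definite square root -/
noncomputable def msqrt {n : ℕ} (Y : Matrix (Fin n) (Fin n) ℝ) : Matrix (Fin n) (Fin n) ℝ :=
  if h : ∃ S : Matrix (Fin n) (Fin n) ℝ, S.PosDef ∧ S * S = Y then h.choose else 0

lemma msqrt_posDef {n : ℕ} {Y : Matrix (Fin n) (Fin n) ℝ} (hY : Y.PosDef) : (msqrt Y).PosDef := by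
  have h := exists_posDef_sqrt hY
  unfold msqrt; rw [dif_pos h]; exact h.choose_spec.1

lemma msqrt_mul {n : ℕ} {Y : Matrix (Fin n) (Fin n) ℝ} (hY : Y.PosDef) :
    msqrt Y * msqrt Y = Y := by
  have h := exists_posDef_sqrt hY
  unfold msqrt; rw [dif_pos h]; exact h.choose_spec.2

lemma lyap_inj {n : ℕ} {S X : Matrix (Fin n) (Fin n) ℝ} (hS : S.PosDef)
    (h : S * X + X * S = 0) : X = 0 := by
  have h1 : (Xᴴ * S * X).PosSemidef := hS.posSemidef.conjTranspose_mul_mul_same X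
  have h2 : (X * S * Xᴴ).PosSemidef := hS.posSemidef.mul_mul_conjTranspose_same X
  have t1 := h1.trace_nonneg
  have t2 := h2.trace_nonneg
  have e : (Xᴴ * S * X).trace + (X * S * Xᴴ).trace = 0 := by
    rw [Matrix.trace_mul_comm (X * S), Matrix.mul_assoc, ← Matrix.trace_add, ← Matrix.mul_add, h]
    simp
  have e1 : (Xᴴ * S * X).trace = 0 := le_antisymm (by linarith) t1
  have e2 : Xᴴ * S * X = 0 := h1.trace_eq_zero_iff.1 e1
  ext i j
  have key : ∀ v : Fin n → ℝ, X *ᵥ v = 0 := by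
    intro v
    by_contra hne
    have := hS.dotProduct_mulVec_pos hne
    have e3 : star (X *ᵥ v) ⬝ᵥ (S *ᵥ (X *ᵥ v)) = star v ⬝ᵥ ((Xᴴ * S * X) *ᵥ v) := by
      rw [Matrix.star_mulVec, ← Matrix.mulVec_mulVec, ← Matrix.mulVec_mulVec,
        ← Matrix.dotProduct_mulVec]
    rw [e3, e2] at this
    simp at this
  have := congrFun (key (Pi.single j 1)) i
  simpa using this

end Sqrt

section SqrtSmooth

attribute [local instance] Matrix.linftyOpNormedAddCommGroup Matrix.linftyOpNormedSpace
  Matrix.linftyOpNormedRing Matrix.linftyOpNormedAlgebra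

lemma contDiffAt_matrix_iff {n : ℕ} {E : Type*} [NormedAddCommGroup E] [NormedSpace ℝ E]
    {M : E → Matrix (Fin n) (Fin n) ℝ} {x : E} :
    ContDiffAt ℝ 1 M x ↔ ∀ i j, ContDiffAt ℝ 1 (fun y => M y i j) x := by
  let L : Matrix (Fin n) (Fin n) ℝ ≃L[ℝ] (Fin n → Fin n → ℝ) :=
    (LinearEquiv.refl ℝ (Fin n → Fin n → ℝ) :
      Matrix (Fin n) (Fin n) ℝ ≃ₗ[ℝ] (Fin n → Fin n → ℝ)).toContinuousLinearEquiv
  rw [← L.comp_contDiffAt_iff]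
  rw [contDiffAt_pi]
  simp_rw [contDiffAt_pi]
  rfl

lemma eventually_posDef {n : ℕ} {S : Matrix (Fin n) (Fin n) ℝ} (hS : S.PosDef) :
    ∀ᶠ A in nhds S, Aᵀ = A → A.PosDef := by
  have hc : IsCompact (Metric.sphere (0 : Fin n → ℝ) 1) := isCompact_sphere 0 1
  have hcont : Continuous fun z : Matrix (Fin n) (Fin n) ℝ × (Fin n → ℝ) =>
      z.2 ⬝ᵥ (z.1 *ᵥ z.2) :=
    continuous_snd.dotProduct (continuous_fst.matrix_mulVec continuous_snd)
  have hev : ∀ᶠ A in nhds S, ∀ v ∈ Metric.sphere (0 : Fin n → ℝ) 1, 0 < v ⬝ᵥ (A *ᵥ v) := by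
    refine hc.eventually_forall_of_forall_eventually ?_
    intro v hv
    have hv0 : v ≠ 0 := by
      rintro rfl
      simp at hv
    have hpos : 0 < v ⬝ᵥ (S *ᵥ v) := by simpa using hS.dotProduct_mulVec_pos hv0
    exact hcont.continuousAt.eventually (lt_mem_nhds (a := (0 : ℝ)) (by simpa using hpos))
  filter_upwards [hev] with A hA hsym
  refine Matrix.PosDef.of_dotProduct_mulVec_pos (by simpa [Matrix.IsHermitian] using hsym) ?_
  intro v hv
  have hn : ‖v‖ ≠ 0 := norm_ne_zero_iff.2 hv
  have h := hA (‖v‖⁻¹ • v) (by simp [norm_smul, hn])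
  rw [Matrix.mulVec_smul, smul_dotProduct, dotProduct_smul, smul_eq_mul, smul_eq_mul] at h
  have h1 : 0 < ‖v‖⁻¹ := inv_pos.2 (norm_pos_iff.2 hv)
  have h2 := (mul_pos_iff_of_pos_left h1).1 h
  simpa using (mul_pos_iff_of_pos_left h1).1 h2

lemma contDiffAt_msqrt {n : ℕ} {E : Type*} [NormedAddCommGroup E] [NormedSpace ℝ E]
    {Y : E → Matrix (Fin n) (Fin n) ℝ} {x : E} (hY : ∀ i j, ContDiffAt ℝ 1 (fun y => Y y i j) x)
    (hpos : ∀ᶠ y in nhds x, (Y y).PosDef) :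
    ∀ i j, ContDiffAt ℝ 1 (fun y => msqrt (Y y) i j) x := by
  rw [← contDiffAt_matrix_iff] at hY ⊢
  have hx : (Y x).PosDef := hpos.self_of_nhds
  set S := msqrt (Y x) with hSdef
  have hS : S.PosDef := msqrt_posDef hx
  have hSS : S * S = Y x := msqrt_mul hx
  let f : Matrix (Fin n) (Fin n) ℝ → Matrix (Fin n) (Fin n) ℝ := fun X => X * X
  have hf : ContDiffAt ℝ 1 f S := contDiffAt_id.mul contDiffAt_id
  let D : Matrix (Fin n) (Fin n) ℝ →ₗ[ℝ] Matrix (Fin n) (Fin n) ℝ :=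
    LinearMap.mulLeft ℝ S + LinearMap.mulRight ℝ S
  have hD : Function.Injective D := by
    rw [injective_iff_map_eq_zero]
    intro X hX
    exact lyap_inj hS (by simpa [D] using hX)
  let De : Matrix (Fin n) (Fin n) ℝ ≃L[ℝ] Matrix (Fin n) (Fin n) ℝ :=
    (LinearEquiv.ofInjectiveEndo D hD).toContinuousLinearEquiv
  have hder : HasFDerivAt f (De : Matrix (Fin n) (Fin n) ℝ →L[ℝ] Matrix (Fin n) (Fin n) ℝ) S := by
    have h := (hasFDerivAt_id (𝕜 := ℝ) S).mul' (hasFDerivAt_id (𝕜 := ℝ) S)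
    have he : (De : Matrix (Fin n) (Fin n) ℝ →L[ℝ] Matrix (Fin n) (Fin n) ℝ) =
        (id S • ContinuousLinearMap.id ℝ (Matrix (Fin n) (Fin n) ℝ) +
        MulOpposite.op (id S) • ContinuousLinearMap.id ℝ (Matrix (Fin n) (Fin n) ℝ)) := by
      apply ContinuousLinearMap.ext
      intro X
      simp [De, D]
    rw [he]
    exact h
  let g := hf.localInverse hder one_ne_zero
  have hg : ContDiffAt ℝ 1 g (f S) := hf.to_localInverse hder one_ne_zero
  have hgS : g (f S) = S := hf.localInverse_apply_image hder one_ne_zero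
  have hstrict := hf.hasStrictFDerivAt' hder one_ne_zero
  have hright : ∀ᶠ y in nhds (f S), f (g y) = y := hstrict.eventually_right_inverse
  have hleft : ∀ᶠ y in nhds S, g (f y) = y := hstrict.eventually_left_inverse
  have hfS : f S = Y x := hSS
  rw [hfS] at hg hgS hright
  have hYc : Filter.Tendsto Y (nhds x) (nhds (Y x)) := hY.continuousAt
  have hgc : Filter.Tendsto (fun y => g (Y y)) (nhds x) (nhds S) := by
    have := hg.continuousAt.tendsto
    rw [hgS] at this
    exact this.comp hYc
  have htr : Filter.Tendsto (fun y => (g (Y y))ᵀ) (nhds x) (nhds S) := by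
    have hc : Continuous (fun A : Matrix (Fin n) (Fin n) ℝ => Aᵀ) := continuous_id.matrix_transpose
    have := (hc.tendsto S).comp hgc
    have hsym : Sᵀ = S := by simpa using hS.isHermitian.eq
    simpa [Function.comp_def, hsym] using this
  -- eventually positive definite
  have hsymev : ∀ᶠ y in nhds x, (g (Y y))ᵀ = g (Y y) := by
    filter_upwards [hgc.eventually hleft, htr.eventually hleft, hYc.eventually hright, hpos]
      with y h1 h2 h3 h4
    rw [← h2, ← h1]
    congr 1
    rw [h1]
    show (g (Y y))ᵀ * (g (Y y))ᵀ = g (Y y) * g (Y y)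
    rw [← Matrix.transpose_mul]
    have : g (Y y) * g (Y y) = Y y := h3
    rw [this]
    simpa using h4.isHermitian.eq
  have hpd : ∀ᶠ A in nhds S, Aᵀ = A → A.PosDef := eventually_posDef hS
  have hev : (fun y => msqrt (Y y)) =ᶠ[nhds x] fun y => g (Y y) := by
    filter_upwards [hgc.eventually hpd, hsymev, hYc.eventually hright, hpos] with y h1 h2 h3 h4
    exact posDef_sqrt_unique (msqrt_posDef h4) (h1 h2) ((msqrt_mul h4).trans h3.symm)
  exact (hg.comp x hY).congr_of_eventuallyEq hev

lemma contDiffAt_matrix_mul {n : ℕ} {E : Type*} [NormedAddCommGroup E] [NormedSpace ℝ E]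
    {M N : E → Matrix (Fin n) (Fin n) ℝ} {x : E} (hM : ∀ i j, ContDiffAt ℝ 1 (fun y => M y i j) x)
    (hN : ∀ i j, ContDiffAt ℝ 1 (fun y => N y i j) x) :
    ∀ i j, ContDiffAt ℝ 1 (fun y => (M y * N y) i j) x := by
  intro i j
  simp only [Matrix.mul_apply]
  exact ContDiffAt.sum fun k _ => (hM i k).mul (hN k j)

lemma contDiffAt_matrix_inv {n : ℕ} {E : Type*} [NormedAddCommGroup E] [NormedSpace ℝ E]
    {M : E → Matrix (Fin n) (Fin n) ℝ} {x : E} (hM : ∀ i j, ContDiffAt ℝ 1 (fun y => M y i j) x)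
    (hu : IsUnit (M x)) :
    ∀ i j, ContDiffAt ℝ 1 (fun y => (M y)⁻¹ i j) x := by
  rw [← contDiffAt_matrix_iff] at hM ⊢
  simp_rw [Matrix.nonsing_inv_eq_ringInverse]
  obtain ⟨w, hw⟩ := hu
  have h := contDiffAt_ringInverse ℝ (n := 1) w
  rw [hw] at h
  exact h.comp x hM

end SqrtSmooth

section GMean

variable {n : ℕ}

/-- geometric mean of `g` and `η g⁻¹ η` -/
noncomputable def gmean (η g : Matrix (Fin n) (Fin n) ℝ) : Matrix (Fin n) (Fin n) ℝ :=
  msqrt g * msqrt ((msqrt g)⁻¹ * (η * g⁻¹ * η) * (msqrt g)⁻¹) * msqrt g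

lemma conj_posDef {A S : Matrix (Fin n) (Fin n) ℝ} (hA : A.PosDef) (hS : Sᵀ = S)
    (hu : IsUnit S) : (S * A * S).PosDef := by
  have := (Matrix.IsUnit.posDef_star_right_conjugate_iff hu (x := A)).2 hA
  simpa [Matrix.star_eq_conjTranspose, hS] using this

lemma gmean_aux {η g : Matrix (Fin n) (Fin n) ℝ} (hη : ηᵀ = η) (hηη : η * η = 1)
    (hg : g.PosDef) :
    ((msqrt g)⁻¹ * (η * g⁻¹ * η) * (msqrt g)⁻¹).PosDef := by
  have hS := msqrt_posDef hg
  refine conj_posDef (conj_posDef hg.inv hη (IsUnit.of_mul_eq_one η hηη)) ?_ hS.inv.isUnit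
  simpa using hS.inv.isHermitian.eq

lemma gmean_posDef {η g : Matrix (Fin n) (Fin n) ℝ} (hη : ηᵀ = η) (hηη : η * η = 1)
    (hg : g.PosDef) : (gmean η g).PosDef := by
  have hS := msqrt_posDef hg
  exact conj_posDef (msqrt_posDef (gmean_aux hη hηη hg)) (by simpa using hS.isHermitian.eq)
    hS.isUnit

lemma inv_of_sqrt {S g : Matrix (Fin n) (Fin n) ℝ} (h : S * S = g) : g⁻¹ = S⁻¹ * S⁻¹ := by
  rw [← h, Matrix.mul_inv_rev]

lemma gmean_eq {η g : Matrix (Fin n) (Fin n) ℝ} (hη : ηᵀ = η) (hηη : η * η = 1)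
    (hg : g.PosDef) : gmean η g * g⁻¹ * gmean η g = η * g⁻¹ * η := by
  have hS := msqrt_posDef hg
  have h1 := msqrt_mul (gmean_aux hη hηη hg)
  have hd : IsUnit (msqrt g).det := (Matrix.isUnit_iff_isUnit_det _).1 hS.isUnit
  unfold gmean
  set k := η * g⁻¹ * η
  rw [inv_of_sqrt (msqrt_mul hg)]
  set S := msqrt g
  set R := msqrt (S⁻¹ * k * S⁻¹)
  calc S * R * S * (S⁻¹ * S⁻¹) * (S * R * S) = S * R * (S * S⁻¹) * (S⁻¹ * S) * R * S := by
        simp only [Matrix.mul_assoc]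
    _ = S * (R * R) * S := by
        rw [Matrix.mul_nonsing_inv _ hd, Matrix.nonsing_inv_mul _ hd]
        simp only [Matrix.mul_assoc, Matrix.mul_one, Matrix.one_mul]
    _ = (S * S⁻¹) * k * (S⁻¹ * S) := by
        rw [h1]; simp only [Matrix.mul_assoc]
    _ = k := by
        rw [Matrix.mul_nonsing_inv _ hd, Matrix.nonsing_inv_mul _ hd, Matrix.mul_one,
          Matrix.one_mul]

lemma riccati_unique {g X X' : Matrix (Fin n) (Fin n) ℝ} (hg : g.PosDef) (hX : X.PosDef)
    (hX' : X'.PosDef) (h : X * g⁻¹ * X = X' * g⁻¹ * X') : X = X' := by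
  have hS := msqrt_posDef hg
  have hd : IsUnit (msqrt g).det := (Matrix.isUnit_iff_isUnit_det _).1 hS.isUnit
  rw [inv_of_sqrt (msqrt_mul hg)] at h
  set S := msqrt g
  have hSi : (S⁻¹)ᵀ = S⁻¹ := by simpa using hS.inv.isHermitian.eq
  have key := posDef_sqrt_unique (conj_posDef hX hSi hS.inv.isUnit)
    (conj_posDef hX' hSi hS.inv.isUnit) (by
      calc S⁻¹ * X * S⁻¹ * (S⁻¹ * X * S⁻¹) = S⁻¹ * (X * (S⁻¹ * S⁻¹) * X) * S⁻¹ := by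
            simp only [Matrix.mul_assoc]
        _ = S⁻¹ * X' * S⁻¹ * (S⁻¹ * X' * S⁻¹) := by
            rw [h]; simp only [Matrix.mul_assoc])
  have e : ∀ Z : Matrix (Fin n) (Fin n) ℝ, S * (S⁻¹ * Z * S⁻¹) * S = Z := by
    intro Z
    calc S * (S⁻¹ * Z * S⁻¹) * S = (S * S⁻¹) * Z * (S⁻¹ * S) := by simp only [Matrix.mul_assoc]
      _ = Z := by
        rw [Matrix.mul_nonsing_inv _ hd, Matrix.nonsing_inv_mul _ hd, Matrix.mul_one,
          Matrix.one_mul]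
  rw [← e X, key, e X']

lemma gmean_conj {η g δ : Matrix (Fin n) (Fin n) ℝ} (hη : ηᵀ = η) (hηη : η * η = 1)
    (hg : g.PosDef) (hδ : δᵀ * η * δ = η) (hu : IsUnit δ) :
    gmean η (δᵀ * g * δ) = δᵀ * gmean η g * δ := by
  have hd : IsUnit δ.det := (Matrix.isUnit_iff_isUnit_det _).1 hu
  have hdt : IsUnit (δᵀ).det := by rwa [Matrix.det_transpose]
  have pd : ∀ {A : Matrix (Fin n) (Fin n) ℝ}, A.PosDef → (δᵀ * A * δ).PosDef := by
    intro A hA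
    have := (Matrix.IsUnit.posDef_star_left_conjugate_iff hu (x := A)).2 hA
    simpa [Matrix.star_eq_conjTranspose] using this
  refine riccati_unique (pd hg) (gmean_posDef hη hηη (pd hg)) (pd (gmean_posDef hη hηη hg)) ?_
  rw [gmean_eq hη hηη (pd hg)]
  have hinv : (δᵀ * g * δ)⁻¹ = δ⁻¹ * g⁻¹ * (δᵀ)⁻¹ := by
    rw [Matrix.mul_inv_rev, Matrix.mul_inv_rev, Matrix.mul_assoc]
  have c1 : η * δ⁻¹ = δᵀ * η := by
    calc η * δ⁻¹ = δᵀ * η * δ * δ⁻¹ := by rw [hδ]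
      _ = δᵀ * η * (δ * δ⁻¹) := by simp only [Matrix.mul_assoc]
      _ = _ := by rw [Matrix.mul_nonsing_inv _ hd, Matrix.mul_one]
  have c2 : (δᵀ)⁻¹ * η = η * δ := by
    calc (δᵀ)⁻¹ * η = (δᵀ)⁻¹ * (δᵀ * η * δ) := by rw [hδ]
      _ = ((δᵀ)⁻¹ * δᵀ) * η * δ := by simp only [Matrix.mul_assoc]
      _ = _ := by rw [Matrix.nonsing_inv_mul _ hdt, Matrix.one_mul]
  rw [hinv]
  calc η * (δ⁻¹ * g⁻¹ * (δᵀ)⁻¹) * η = (η * δ⁻¹) * g⁻¹ * ((δᵀ)⁻¹ * η) := by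
        simp only [Matrix.mul_assoc]
    _ = δᵀ * (η * g⁻¹ * η) * δ := by rw [c1, c2]; simp only [Matrix.mul_assoc]
    _ = δᵀ * (gmean η g * g⁻¹ * gmean η g) * δ := by rw [gmean_eq hη hηη hg]
    _ = δᵀ * gmean η g * (δ * δ⁻¹) * g⁻¹ * ((δᵀ)⁻¹ * δᵀ) * gmean η g * δ := by
        rw [Matrix.mul_nonsing_inv _ hd, Matrix.nonsing_inv_mul _ hdt]
        simp only [Matrix.mul_assoc, Matrix.one_mul]
    _ = _ := by simp only [Matrix.mul_assoc]

lemma gmean_invol {η g : Matrix (Fin n) (Fin n) ℝ} (hη : ηᵀ = η) (hηη : η * η = 1)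
    (hg : g.PosDef) : (η * gmean η g) * (η * gmean η g) = 1 := by
  have hp := gmean_posDef hη hηη hg
  have hu : IsUnit η := IsUnit.of_mul_eq_one η hηη
  have hd : IsUnit (gmean η g).det := (Matrix.isUnit_iff_isUnit_det _).1 hp.isUnit
  have key : η * (gmean η g)⁻¹ * η = gmean η g := by
    refine riccati_unique hg (conj_posDef hp.inv hη hu) hp ?_
    rw [gmean_eq hη hηη hg]
    have h := gmean_eq hη hηη hg
    calc η * (gmean η g)⁻¹ * η * g⁻¹ * (η * (gmean η g)⁻¹ * η)
        = η * (gmean η g)⁻¹ * (η * g⁻¹ * η) * (gmean η g)⁻¹ * η := by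
          simp only [Matrix.mul_assoc]
      _ = η * ((gmean η g)⁻¹ * gmean η g) * g⁻¹ * (gmean η g * (gmean η g)⁻¹) * η := by
          rw [← h]; simp only [Matrix.mul_assoc]
      _ = _ := by
          rw [Matrix.mul_nonsing_inv _ hd, Matrix.nonsing_inv_mul _ hd, Matrix.mul_one,
            Matrix.mul_one]
  have h2 : η * gmean η g = (gmean η g)⁻¹ * η := by
    calc η * gmean η g = η * (η * (gmean η g)⁻¹ * η) := by rw [key]
      _ = (η * η) * (gmean η g)⁻¹ * η := by simp only [Matrix.mul_assoc]
      _ = _ := by rw [hηη, Matrix.one_mul]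
  calc (η * gmean η g) * (η * gmean η g) = (gmean η g)⁻¹ * η * (η * gmean η g) := by
        conv_lhs => rw [h2]
        rw [← h2]
    _ = (gmean η g)⁻¹ * (η * η) * gmean η g := by simp only [Matrix.mul_assoc]
    _ = 1 := by rw [hηη, Matrix.mul_one, Matrix.nonsing_inv_mul _ hd]

lemma contDiffAt_gmean {E : Type*} [NormedAddCommGroup E] [NormedSpace ℝ E]
    {η : Matrix (Fin n) (Fin n) ℝ} (hη : ηᵀ = η) (hηη : η * η = 1)
    {g : E → Matrix (Fin n) (Fin n) ℝ} {x : E} (hg : ∀ i j, ContDiffAt ℝ 1 (fun y => g y i j) x)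
    (hpos : ∀ᶠ y in nhds x, (g y).PosDef) :
    ∀ i j, ContDiffAt ℝ 1 (fun y => gmean η (g y) i j) x := by
  have hS := contDiffAt_msqrt hg hpos
  have hSi := contDiffAt_matrix_inv hS (msqrt_posDef hpos.self_of_nhds).isUnit
  have hgi := contDiffAt_matrix_inv hg hpos.self_of_nhds.isUnit
  have hc : ∀ i j, ContDiffAt ℝ 1 (fun _ : E => η i j) x := fun i j => contDiffAt_const
  have hR := contDiffAt_msqrt (contDiffAt_matrix_mul (contDiffAt_matrix_mul hSi
    (contDiffAt_matrix_mul (contDiffAt_matrix_mul hc hgi) hc)) hSi)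
    (hpos.mono fun y hy => gmean_aux hη hηη hy)
  exact contDiffAt_matrix_mul (contDiffAt_matrix_mul hS hR) hS

end GMean
end Kulk
end

section
open Matrix Filter Topology MeasureTheory

namespace Kulk

/-- The data of a free, properly discontinuous, cocompact linear action on the unit quadric. -/
structure Setup (n : ℕ) where
  η : Matrix (Fin n) (Fin n) ℝ
  Γ : Subgroup (Matrix.GeneralLinearGroup (Fin n) ℝ)
  hη : ηᵀ = η
  hηη : η * η = 1
  hΓ : ∀ γ ∈ Γ, (γ : Matrix (Fin n) (Fin n) ℝ)ᵀ * η * γ = η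
  free : ∀ γ : Γ, ∀ x : Fin n → ℝ, x ⬝ᵥ (η *ᵥ x) = 1 →
    ((γ : Matrix.GeneralLinearGroup (Fin n) ℝ) : Matrix (Fin n) (Fin n) ℝ) *ᵥ x = x → γ = 1
  proper : ∀ K L : Set (Fin n → ℝ), (∀ x ∈ K, x ⬝ᵥ (η *ᵥ x) = 1) →
    (∀ x ∈ L, x ⬝ᵥ (η *ᵥ x) = 1) → IsCompact K → IsCompact L →
    {γ : Γ | ∃ x ∈ K,
      ((γ : Matrix.GeneralLinearGroup (Fin n) ℝ) : Matrix (Fin n) (Fin n) ℝ) *ᵥ x ∈ L}.Finite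
  K : Set (Fin n → ℝ)
  hK1 : ∀ x ∈ K, x ⬝ᵥ (η *ᵥ x) = 1
  hKc : IsCompact K
  hKcov : ∀ x : Fin n → ℝ, x ⬝ᵥ (η *ᵥ x) = 1 → ∃ γ : Γ, ∃ y ∈ K,
      ((γ : Matrix.GeneralLinearGroup (Fin n) ℝ) : Matrix (Fin n) (Fin n) ℝ) *ᵥ y = x
  x₀ : Fin n → ℝ
  hx₀ : x₀ ⬝ᵥ (η *ᵥ x₀) = 1

namespace Setup

variable {n : ℕ} (S : Setup n)

/-- the quadratic form -/
def Q (x : Fin n → ℝ) : ℝ := x ⬝ᵥ (S.η *ᵥ x)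

/-- the cone where the form is positive -/
def C : Set (Fin n → ℝ) := {x | 0 < S.Q x}

/-- matrix of a group element -/
def m (γ : S.Γ) : Matrix (Fin n) (Fin n) ℝ :=
  ((γ : Matrix.GeneralLinearGroup (Fin n) ℝ) : Matrix (Fin n) (Fin n) ℝ)

lemma m_mul (γ δ : S.Γ) : S.m (γ * δ) = S.m γ * S.m δ := by simp [m]
lemma m_one : S.m 1 = 1 := by simp [m]
lemma m_inv_mul (γ : S.Γ) : S.m γ⁻¹ * S.m γ = 1 := by rw [← m_mul]; simp [m]
lemma m_mul_inv (γ : S.Γ) : S.m γ * S.m γ⁻¹ = 1 := by rw [← m_mul]; simp [m]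
lemma m_isUnit (γ : S.Γ) : IsUnit (S.m γ) := ⟨γ.1, rfl⟩
lemma m_form (γ : S.Γ) : (S.m γ)ᵀ * S.η * S.m γ = S.η := S.hΓ γ.1 γ.2

lemma B_symm (x y : Fin n → ℝ) : x ⬝ᵥ (S.η *ᵥ y) = y ⬝ᵥ (S.η *ᵥ x) := by
  rw [dotProduct_comm, ← S.hη, mulVec_transpose, dotProduct_mulVec, S.hη]

lemma B_m (γ : S.Γ) (x y : Fin n → ℝ) :
    (S.m γ *ᵥ x) ⬝ᵥ (S.η *ᵥ (S.m γ *ᵥ y)) = x ⬝ᵥ (S.η *ᵥ y) := by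
  conv_rhs => rw [← S.m_form γ]
  rw [← mulVec_mulVec, ← mulVec_mulVec, dotProduct_mulVec x, vecMul_transpose]

lemma Q_m (γ : S.Γ) (x : Fin n → ℝ) : S.Q (S.m γ *ᵥ x) = S.Q x := S.B_m γ x x

lemma Q_smul (c : ℝ) (x : Fin n → ℝ) : S.Q (c • x) = c ^ 2 * S.Q x := by
  simp [Q, mulVec_smul]; ring

lemma Q_add (x y : Fin n → ℝ) : S.Q (x + y) = S.Q x + 2 * (x ⬝ᵥ (S.η *ᵥ y)) + S.Q y := by
  simp only [Q, mulVec_add, dotProduct_add, add_dotProduct]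
  rw [S.B_symm y x]; ring

lemma Q_continuous : Continuous S.Q := by
  unfold Q
  exact Continuous.dotProduct continuous_id (continuous_const.matrix_mulVec continuous_id)

lemma Q_contDiff {k : WithTop ℕ∞} : ContDiff ℝ k S.Q := by
  unfold Q
  simp only [dotProduct, mulVec]
  fun_prop

lemma C_open : IsOpen S.C := isOpen_lt continuous_const S.Q_continuous

lemma smul_mem_C {c : ℝ} (hc : 0 < c) {x : Fin n → ℝ} (hx : x ∈ S.C) : c • x ∈ S.C := by
  show 0 < S.Q _
  rw [Q_smul]; have : 0 < S.Q x := hx; positivity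

lemma m_mem_C (γ : S.Γ) {x : Fin n → ℝ} (hx : x ∈ S.C) : S.m γ *ᵥ x ∈ S.C := by
  show 0 < S.Q _
  rw [Q_m]; exact hx

lemma abs_det_m (γ : S.Γ) : |(S.m γ).det| = 1 := by
  have h := congrArg Matrix.det (S.m_form γ)
  have h2 := congrArg Matrix.det S.hηη
  simp only [det_mul, det_transpose, det_one] at h h2
  have hne : S.η.det ≠ 0 := by intro h0; simp [h0] at h2
  have h3 : (S.m γ).det * (S.m γ).det = 1 := by
    apply mul_left_cancel₀ hne; linarith
  have : |(S.m γ).det| * |(S.m γ).det| = 1 := by rw [← abs_mul, h3, abs_one]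
  nlinarith [abs_nonneg (S.m γ).det]

/-- normalised point -/
noncomputable def nrm (x : Fin n → ℝ) : Fin n → ℝ := (Real.sqrt (S.Q x))⁻¹ • x

lemma Q_nrm {x : Fin n → ℝ} (hx : x ∈ S.C) : S.Q (S.nrm x) = 1 := by
  have : 0 < S.Q x := hx
  rw [nrm, Q_smul, inv_pow, Real.sq_sqrt this.le, inv_mul_cancel₀ this.ne']

lemma nrm_m (γ : S.Γ) (x : Fin n → ℝ) : S.nrm (S.m γ *ᵥ x) = S.m γ *ᵥ S.nrm x := by
  simp [nrm, Q_m, mulVec_smul]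

lemma nrm_smul {c : ℝ} (hc : 0 < c) (x : Fin n → ℝ) : S.nrm (c • x) = S.nrm x := by
  simp only [nrm, Q_smul]
  rw [Real.sqrt_mul (sq_nonneg c), Real.sqrt_sq hc.le, smul_smul]
  congr 1
  field_simp

lemma nrm_eq_self {x : Fin n → ℝ} (hx : S.Q x = 1) : S.nrm x = x := by simp [nrm, hx]

lemma smul_nrm {x : Fin n → ℝ} (hx : x ∈ S.C) : Real.sqrt (S.Q x) • S.nrm x = x := by
  have : 0 < S.Q x := hx
  rw [nrm, smul_smul, mul_inv_cancel₀ (Real.sqrt_pos.2 this).ne', one_smul]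

lemma contDiffAt_sqrtQ {x : Fin n → ℝ} (hx : x ∈ S.C) :
    ContDiffAt ℝ 1 (fun y => Real.sqrt (S.Q y)) x := by
  have : 0 < S.Q x := hx
  exact S.Q_contDiff.contDiffAt.sqrt this.ne'

lemma contDiffAt_nrm {x : Fin n → ℝ} (hx : x ∈ S.C) : ContDiffAt ℝ 1 S.nrm x := by
  have h : 0 < S.Q x := hx
  unfold nrm
  exact ((S.contDiffAt_sqrtQ hx).inv (Real.sqrt_pos.2 h).ne').smul contDiffAt_id

/-- the unit quadric -/
def X : Set (Fin n → ℝ) := {x | S.Q x = 1}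

lemma X_closed : IsClosed S.X := isClosed_eq S.Q_continuous continuous_const

lemma X_subset_C : S.X ⊆ S.C := fun x (hx : S.Q x = 1) => by show 0 < S.Q x; rw [hx]; exact one_pos

lemma nrm_mem_X {x : Fin n → ℝ} (hx : x ∈ S.C) : S.nrm x ∈ S.X := S.Q_nrm hx

lemma proper' {K L : Set (Fin n → ℝ)} (hK : IsCompact K) (hL : IsCompact L) (hKX : K ⊆ S.X)
    (hLX : L ⊆ S.X) : {γ : S.Γ | ∃ x ∈ K, S.m γ *ᵥ x ∈ L}.Finite :=
  S.proper K L hKX hLX hK hL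

lemma properC {K L : Set (Fin n → ℝ)} (hK : IsCompact K) (hL : IsCompact L) (hKX : K ⊆ S.C)
    (hLX : L ⊆ S.C) : {γ : S.Γ | ∃ x ∈ K, ∃ c : ℝ, 0 < c ∧ c • (S.m γ *ᵥ x) ∈ L}.Finite := by
  have hc : ContinuousOn S.nrm S.C := fun x hx => (S.contDiffAt_nrm hx).continuousAt.continuousWithinAt
  refine (S.proper' (hK.image_of_continuousOn (hc.mono hKX)) (hL.image_of_continuousOn (hc.mono hLX))
    ?_ ?_).subset ?_
  · rintro _ ⟨x, hx, rfl⟩; exact S.nrm_mem_X (hKX hx)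
  · rintro _ ⟨x, hx, rfl⟩; exact S.nrm_mem_X (hLX hx)
  · rintro γ ⟨x, hx, c, hc, h⟩
    refine ⟨S.nrm x, ⟨x, hx, rfl⟩, _, h, ?_⟩
    rw [S.nrm_smul hc, S.nrm_m]

lemma countableΓ : Countable S.Γ := by
  have h : ∀ k : ℕ, {γ : S.Γ | ∃ x ∈ ({S.x₀} : Set (Fin n → ℝ)),
      S.m γ *ᵥ x ∈ S.X ∩ Metric.closedBall 0 k}.Finite := fun k =>
    S.proper' isCompact_singleton ((isCompact_closedBall _ _).inter_left S.X_closed)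
      (by simpa [X, Q] using S.hx₀) Set.inter_subset_left
  rw [← Set.countable_univ_iff]
  refine (Set.countable_iUnion fun k => (h k).countable).mono ?_
  intro γ _
  obtain ⟨k, hk⟩ := exists_nat_ge ‖S.m γ *ᵥ S.x₀‖
  refine Set.mem_iUnion.2 ⟨k, S.x₀, rfl, ?_, by simpa using hk⟩
  show S.Q _ = 1
  rw [Q_m]; exact S.hx₀

lemma coverC {x : Fin n → ℝ} (hx : x ∈ S.C) : ∃ γ : S.Γ, ∃ y ∈ S.K,
    x = Real.sqrt (S.Q x) • (S.m γ *ᵥ y) := by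
  obtain ⟨γ, y, hy, h⟩ := S.hKcov (S.nrm x) (S.Q_nrm hx)
  refine ⟨γ, y, hy, ?_⟩
  have : S.m γ *ᵥ y = S.nrm x := h
  rw [this, S.smul_nrm hx]

lemma K_subset_X : S.K ⊆ S.X := S.hK1

end Setup
end Kulk
end

section
open Matrix Filter Topology MeasureTheory

namespace Kulk
namespace Setup
variable {n : ℕ} (S : Setup n)

lemma exists_small_ball {x : Fin n → ℝ} (hx : x ∈ S.X) : ∃ r : ℝ, 0 < r ∧
    ∀ γ : S.Γ, ∀ y ∈ S.X ∩ Metric.ball x r, S.m γ *ᵥ y ∈ Metric.ball x r → γ = 1 := by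
  have hfin : {γ : S.Γ | ∃ y ∈ S.X ∩ Metric.closedBall x 1,
      S.m γ *ᵥ y ∈ S.X ∩ Metric.closedBall x 1}.Finite :=
    S.proper' ((isCompact_closedBall _ _).inter_left S.X_closed)
      ((isCompact_closedBall _ _).inter_left S.X_closed) Set.inter_subset_left Set.inter_subset_left
  have hev : ∀ᶠ p : (Fin n → ℝ) × (Fin n → ℝ) in 𝓝 (x, x), ∀ γ ∈ {γ : S.Γ |
      ∃ y ∈ S.X ∩ Metric.closedBall x 1,
      S.m γ *ᵥ y ∈ S.X ∩ Metric.closedBall x 1}, γ ≠ 1 → S.m γ *ᵥ p.1 ≠ p.2 := by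
    rw [Filter.eventually_all_finite hfin]
    intro γ _
    by_cases hγ : γ = 1
    · exact Eventually.of_forall fun p h => absurd hγ h
    · have hne : S.m γ *ᵥ x ≠ x := fun h => hγ (S.free γ x hx h)
      have hc : Continuous fun p : (Fin n → ℝ) × (Fin n → ℝ) => S.m γ *ᵥ p.1 :=
        continuous_const.matrix_mulVec continuous_fst
      have h2 : IsOpen {p : (Fin n → ℝ) × (Fin n → ℝ) | S.m γ *ᵥ p.1 ≠ p.2} :=
        isOpen_ne_fun hc continuous_snd
      filter_upwards [h2.mem_nhds hne] with p hp _ using hp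
  rw [Metric.eventually_nhds_iff_ball] at hev
  obtain ⟨r, hr, h⟩ := hev
  refine ⟨min r 1, by positivity, ?_⟩
  intro γ y hy hyb
  by_contra hγ
  refine h (y, S.m γ *ᵥ y) ?_ γ ⟨y, ⟨hy.1, ?_⟩, ?_, ?_⟩ hγ rfl
  · rw [← ball_prod_same]
    exact ⟨Metric.ball_subset_ball (min_le_left _ _) hy.2,
      Metric.ball_subset_ball (min_le_left _ _) hyb⟩
  · exact Metric.ball_subset_closedBall (Metric.ball_subset_ball (min_le_right _ _) hy.2)
  · show S.Q _ = 1
    rw [Q_m]; exact hy.1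
  · exact Metric.ball_subset_closedBall (Metric.ball_subset_ball (min_le_right _ _) hyb)

/-- a family of bump functions adapted to the action -/
structure Bumps (S : Setup n) where
  ι : Type
  fin : Fintype ι
  φ : ι → (Fin n → ℝ) → ℝ
  smooth : ∀ j, ∀ x ∈ S.C, ContDiffAt ℝ 1 (φ j) x
  nonneg : ∀ j x, 0 ≤ φ j x
  hom : ∀ j, ∀ c : ℝ, 0 < c → ∀ x, φ j (c • x) = φ j x
  iso : ∀ j, ∀ x ∈ S.C, ∀ γ γ' : S.Γ, φ j (S.m γ *ᵥ x) ≠ 0 → φ j (S.m γ' *ᵥ x) ≠ 0 → γ = γ'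
  cov : ∀ x ∈ S.C, ∃ j, ∃ γ : S.Γ, φ j (S.m γ *ᵥ x) = 1
  L : Set (Fin n → ℝ)
  hL : IsCompact L
  hLX : L ⊆ S.X
  supp : ∀ j, ∀ x ∈ S.C, φ j x ≠ 0 → S.nrm x ∈ L

lemma exists_bumps : Nonempty (Bumps S) := by
  classical
  have h1 := fun x : S.X => S.exists_small_ball x.2
  choose r hr hball using h1
  let b : ∀ x : S.X, ContDiffBump (x : Fin n → ℝ) := fun x =>
    ⟨r x / 2, r x, half_pos (hr x), half_lt_self (hr x)⟩
  obtain ⟨t, ht⟩ := S.hKc.elim_finite_subcover (fun x : S.X => Metric.ball (x : Fin n → ℝ) (r x / 2))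
    (fun x => Metric.isOpen_ball) (fun x hx => Set.mem_iUnion.2 ⟨⟨x, S.K_subset_X hx⟩,
      Metric.mem_ball_self (half_pos (hr _))⟩)
  let e : Fin t.card ≃ t := t.equivFin.symm
  refine ⟨⟨Fin t.card, inferInstance, fun j x => b (e j) (S.nrm x), ?_, ?_, ?_, ?_, ?_,
    S.X ∩ ⋃ j : Fin t.card, Metric.closedBall ((e j : S.X) : Fin n → ℝ) (r (e j)), ?_,
    Set.inter_subset_left, ?_⟩⟩
  · intro j x hx
    exact (b (e j)).contDiffAt.comp x (S.contDiffAt_nrm hx)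
  · intro j x; exact (b (e j)).nonneg
  · intro j c hc x
    simp only [S.nrm_smul hc]
  · intro j x hx γ γ' h h'
    have hb : ∀ γ : S.Γ, b (e j) (S.nrm (S.m γ *ᵥ x)) ≠ 0 →
        S.m γ *ᵥ S.nrm x ∈ Metric.ball ((e j : S.X) : Fin n → ℝ) (r (e j)) := by
      intro γ h
      have : S.nrm (S.m γ *ᵥ x) ∈ Function.support (b (e j)) := h
      rw [(b (e j)).support_eq, S.nrm_m] at this
      exact this
    have h1 := hb γ h
    have h2 := hb γ' h'
    have := hball (e j) (γ' * γ⁻¹) (S.m γ *ᵥ S.nrm x) ⟨?_, h1⟩ ?_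
    · exact (mul_inv_eq_one.1 this).symm
    · show S.Q _ = 1
      rw [Q_m, S.Q_nrm hx]
    · rw [mulVec_mulVec, ← m_mul, inv_mul_cancel_right]; exact h2
  · intro x hx
    obtain ⟨γ, y, hy, h⟩ := S.hKcov (S.nrm x) (S.Q_nrm hx)
    obtain ⟨z, hz, hyz⟩ : ∃ z ∈ t, y ∈ Metric.ball (z : Fin n → ℝ) (r z / 2) := by
      simpa using ht hy
    obtain ⟨j, hj⟩ := e.surjective ⟨z, hz⟩
    obtain rfl : z = ((e j : t) : S.X) := by rw [hj]
    refine ⟨j, γ⁻¹, ?_⟩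
    have : S.nrm (S.m γ⁻¹ *ᵥ x) = y := by
      rw [nrm_m, ← h]
      show S.m γ⁻¹ *ᵥ S.m γ *ᵥ y = y
      rw [mulVec_mulVec, m_inv_mul, one_mulVec]
    simp only [this]
    exact (b _).one_of_mem_closedBall (Metric.ball_subset_closedBall hyz)
  · exact (isCompact_iUnion fun j => isCompact_closedBall _ _).inter_left S.X_closed
  · intro j x hx h
    refine ⟨S.nrm_mem_X hx, Set.mem_iUnion.2 ⟨j, ?_⟩⟩
    have : S.nrm x ∈ Function.support (b (e j)) := h
    rw [(b (e j)).support_eq] at this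
    exact Metric.ball_subset_closedBall this

namespace Bumps
variable {S} (P : Bumps S)

instance : Fintype P.ι := P.fin

lemma locfin {L : Set (Fin n → ℝ)} (hL : IsCompact L) (hLC : L ⊆ S.C) :
    {γ : S.Γ | ∃ j, ∃ x ∈ L, P.φ j (S.m γ *ᵥ x) ≠ 0}.Finite := by
  refine (S.properC hL P.hL hLC (P.hLX.trans S.X_subset_C)).subset ?_
  rintro γ ⟨j, x, hx, h⟩
  have hx' : 0 < S.Q x := hLC hx
  have := P.supp j _ (S.m_mem_C γ (hLC hx)) h
  refine ⟨x, hx, _, inv_pos.2 (Real.sqrt_pos.2 hx'), ?_⟩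
  rwa [nrm, Q_m] at this

/-- sum over the group of `φ_j (γ x) c_j(γ)`. -/
noncomputable def gsum (c : P.ι → S.Γ → ℝ) (x : Fin n → ℝ) : ℝ :=
  ∑ j, ∑ᶠ γ : S.Γ, P.φ j (S.m γ *ᵥ x) * c j γ

lemma gsum_eq (c : P.ι → S.Γ → ℝ) {x : Fin n → ℝ} {T : Finset S.Γ}
    (h : ∀ j γ, P.φ j (S.m γ *ᵥ x) ≠ 0 → γ ∈ T) :
    P.gsum c x = ∑ j, ∑ γ ∈ T, P.φ j (S.m γ *ᵥ x) * c j γ := by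
  unfold gsum
  refine Finset.sum_congr rfl fun j _ => ?_
  refine finsum_eq_sum_of_support_subset _ ?_
  intro γ hγ
  exact h j γ (left_ne_zero_of_mul hγ)

lemma exists_finset (x : Fin n → ℝ) (hx : x ∈ S.C) : ∃ T : Finset S.Γ, ∀ᶠ y in 𝓝 x,
    ∀ j γ, P.φ j (S.m γ *ᵥ y) ≠ 0 → γ ∈ T := by
  obtain ⟨L, hL, hxL, hLC⟩ := exists_compact_subset S.C_open hx
  refine ⟨(P.locfin hL hLC).toFinset, ?_⟩
  filter_upwards [mem_interior_iff_mem_nhds.1 hxL] with y hy j γ h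
  simp only [Set.Finite.mem_toFinset, Set.mem_ofPred_eq]
  exact ⟨j, y, hy, h⟩

lemma exists_finset' (x : Fin n → ℝ) (hx : x ∈ S.C) : ∃ T : Finset S.Γ,
    ∀ j γ, P.φ j (S.m γ *ᵥ x) ≠ 0 → γ ∈ T := by
  obtain ⟨T, hT⟩ := P.exists_finset x hx
  exact ⟨T, hT.self_of_nhds⟩

lemma gsum_contDiffAt (c : P.ι → S.Γ → ℝ) {x : Fin n → ℝ} (hx : x ∈ S.C) :
    ContDiffAt ℝ 1 (P.gsum c) x := by
  obtain ⟨T, hT⟩ := P.exists_finset x hx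
  have : P.gsum c =ᶠ[𝓝 x] fun y => ∑ j, ∑ γ ∈ T, P.φ j (S.m γ *ᵥ y) * c j γ := by
    filter_upwards [hT] with y hy using P.gsum_eq c hy
  refine ContDiffAt.congr_of_eventuallyEq ?_ this
  refine ContDiffAt.sum fun j _ => ContDiffAt.sum fun γ _ => ContDiffAt.mul ?_ contDiffAt_const
  refine (P.smooth j _ (S.m_mem_C γ hx)).comp x (f := fun y => S.m γ *ᵥ y) ?_
  exact (Matrix.mulVecLin (S.m γ)).toContinuousLinearMap.contDiff.contDiffAt

lemma gsum_smul (c : P.ι → S.Γ → ℝ) (x : Fin n → ℝ) {r : ℝ} (hr : 0 < r) :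
    P.gsum c (r • x) = P.gsum c x := by
  simp [gsum, mulVec_smul, P.hom _ _ hr]

lemma gsum_m (c : P.ι → S.Γ → ℝ) (x : Fin n → ℝ) (δ : S.Γ) :
    P.gsum c (S.m δ *ᵥ x) = P.gsum (fun j γ => c j (γ * δ⁻¹)) x := by
  unfold gsum
  refine Finset.sum_congr rfl fun j _ => ?_
  rw [← finsum_comp_equiv (Equiv.mulRight δ⁻¹)]
  refine finsum_congr fun γ => ?_
  simp only [Equiv.coe_mulRight, mulVec_mulVec, ← m_mul, inv_mul_cancel_right]

lemma gsum_sum_mul {κ : Type*} [Fintype κ] (c : κ → P.ι → S.Γ → ℝ) (a : κ → ℝ)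
    {x : Fin n → ℝ} (hx : x ∈ S.C) :
    P.gsum (fun j γ => ∑ k, a k * c k j γ) x = ∑ k, a k * P.gsum (c k) x := by
  obtain ⟨T, hT⟩ := P.exists_finset' x hx
  rw [P.gsum_eq _ hT]
  simp_rw [P.gsum_eq _ hT, Finset.mul_sum]
  rw [Finset.sum_comm]
  conv_rhs => rw [Finset.sum_comm]
  rw [Finset.sum_comm]
  refine Finset.sum_congr rfl fun j _ => ?_
  rw [Finset.sum_comm]
  refine Finset.sum_congr rfl fun k _ => ?_
  refine Finset.sum_congr rfl fun γ _ => ?_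
  ring

end Bumps
end Setup
end Kulk
end

section
open Matrix Filter Topology MeasureTheory

namespace Kulk
namespace Setup
variable {n : ℕ} (S : Setup n)

/-- the linear form `B(x,·)/Q(x)` -/
noncomputable def ell (x : Fin n → ℝ) : Fin n → ℝ := (S.Q x)⁻¹ • (S.η *ᵥ x)

/-- projection to the tangent space -/
noncomputable def Pr (x : Fin n → ℝ) : Matrix (Fin n) (Fin n) ℝ := 1 - vecMulVec x (S.ell x)

lemma ell_dot {x : Fin n → ℝ} (hx : x ∈ S.C) : S.ell x ⬝ᵥ x = 1 := by
  have : 0 < S.Q x := hx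
  rw [ell, smul_dotProduct, dotProduct_comm]
  show (S.Q x)⁻¹ * S.Q x = 1
  exact inv_mul_cancel₀ this.ne'

lemma ell_m (δ : S.Γ) (x : Fin n → ℝ) : S.ell (S.m δ *ᵥ x) ᵥ* S.m δ = S.ell x := by
  rw [ell, ell, Q_m, smul_vecMul, ← mulVec_transpose, mulVec_mulVec, mulVec_mulVec,
    m_form]

lemma ell_smul {c : ℝ} (hc : 0 < c) (x : Fin n → ℝ) : S.ell (c • x) = c⁻¹ • S.ell x := by
  rw [ell, ell, Q_smul, mulVec_smul, smul_smul, smul_smul]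
  congr 1
  rw [mul_inv]
  field_simp

lemma Pr_mulVec (x v : Fin n → ℝ) : S.Pr x *ᵥ v = v - (S.ell x ⬝ᵥ v) • x := by
  rw [Pr, sub_mulVec, one_mulVec, vecMulVec_mulVec]
  simp

lemma Pr_m (δ : S.Γ) (x : Fin n → ℝ) : S.Pr (S.m δ *ᵥ x) * S.m δ = S.m δ * S.Pr x := by
  rw [Pr, Pr, sub_mul, mul_sub, one_mul, mul_one, vecMulVec_mul, ell_m, mul_vecMulVec]

lemma Pr_smul {c : ℝ} (hc : 0 < c) (x : Fin n → ℝ) : S.Pr (c • x) = S.Pr x := by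
  rw [Pr, Pr, ell_smul _ hc, smul_vecMulVec, vecMulVec_smul, smul_smul, mul_inv_cancel₀ hc.ne',
    one_smul]

lemma Pr_self {x : Fin n → ℝ} (hx : x ∈ S.C) : S.Pr x *ᵥ x = 0 := by
  rw [Pr_mulVec, ell_dot _ hx]; simp

lemma contDiffAt_ell {x : Fin n → ℝ} (hx : x ∈ S.C) (i : Fin n) :
    ContDiffAt ℝ 1 (fun y => S.ell y i) x := by
  have h : 0 < S.Q x := hx
  simp only [ell, Pi.smul_apply, smul_eq_mul, mulVec, dotProduct]
  refine (S.Q_contDiff.contDiffAt.inv h.ne').mul ?_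
  fun_prop

lemma contDiffAt_Pr {x : Fin n → ℝ} (hx : x ∈ S.C) (i j : Fin n) :
    ContDiffAt ℝ 1 (fun y => S.Pr y i j) x := by
  simp only [Pr, Matrix.sub_apply, vecMulVec_apply]
  refine contDiffAt_const.sub (ContDiffAt.mul ?_ (S.contDiffAt_ell hx j))
  fun_prop

namespace Bumps
variable {S} (P : Bumps S)

/-- matrix valued group sums -/
noncomputable def msum (c : P.ι → S.Γ → Matrix (Fin n) (Fin n) ℝ) (x : Fin n → ℝ) :
    Matrix (Fin n) (Fin n) ℝ := Matrix.of fun i l => P.gsum (fun j γ => c j γ i l) x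

lemma msum_eq (c : P.ι → S.Γ → Matrix (Fin n) (Fin n) ℝ) {x : Fin n → ℝ} {T : Finset S.Γ}
    (h : ∀ j γ, P.φ j (S.m γ *ᵥ x) ≠ 0 → γ ∈ T) :
    P.msum c x = ∑ j, ∑ γ ∈ T, P.φ j (S.m γ *ᵥ x) • c j γ := by
  ext i l
  simp only [msum, of_apply, P.gsum_eq _ h, Matrix.sum_apply, Matrix.smul_apply, smul_eq_mul]

lemma msum_m (c : P.ι → S.Γ → Matrix (Fin n) (Fin n) ℝ) (x : Fin n → ℝ) (δ : S.Γ) :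
    P.msum c (S.m δ *ᵥ x) = P.msum (fun j γ => c j (γ * δ⁻¹)) x := by
  ext i l
  simp only [msum, of_apply, P.gsum_m]

lemma msum_smul (c : P.ι → S.Γ → Matrix (Fin n) (Fin n) ℝ) (x : Fin n → ℝ) {r : ℝ} (hr : 0 < r) :
    P.msum c (r • x) = P.msum c x := by
  ext i l
  simp only [msum, of_apply, P.gsum_smul _ _ hr]

lemma msum_contDiffAt (c : P.ι → S.Γ → Matrix (Fin n) (Fin n) ℝ) {x : Fin n → ℝ} (hx : x ∈ S.C)
    (i l : Fin n) : ContDiffAt ℝ 1 (fun y => P.msum c y i l) x :=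
  P.gsum_contDiffAt _ hx

lemma msum_mul (c : P.ι → S.Γ → Matrix (Fin n) (Fin n) ℝ) {x : Fin n → ℝ} (hx : x ∈ S.C)
    (A B : Matrix (Fin n) (Fin n) ℝ) :
    A * P.msum c x * B = P.msum (fun j γ => A * c j γ * B) x := by
  obtain ⟨T, hT⟩ := P.exists_finset' x hx
  rw [P.msum_eq _ hT, P.msum_eq _ hT]
  simp only [Finset.mul_sum, Finset.sum_mul, Matrix.mul_smul, Matrix.smul_mul]

/-- invariant metric -/
noncomputable def h (x : Fin n → ℝ) : Matrix (Fin n) (Fin n) ℝ :=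
  P.msum (fun _ γ => (S.m γ)ᵀ * S.m γ) x

lemma h_m (δ : S.Γ) {x : Fin n → ℝ} (hx : x ∈ S.C) :
    (S.m δ)ᵀ * P.h (S.m δ *ᵥ x) * S.m δ = P.h x := by
  rw [h, msum_m, P.msum_mul _ hx, h]
  congr 1
  funext j γ
  have : S.m (γ * δ⁻¹) * S.m δ = S.m γ := by rw [← m_mul]; simp
  rw [mul_assoc, mul_assoc, this, ← mul_assoc, ← transpose_mul, this]

lemma h_posDef {x : Fin n → ℝ} (hx : x ∈ S.C) : (P.h x).PosDef := by
  obtain ⟨T, hT⟩ := P.exists_finset' x hx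
  rw [h, P.msum_eq _ hT]
  refine Matrix.PosDef.of_dotProduct_mulVec_pos ?_ ?_
  · show _ᴴ = _
    rw [conjTranspose_eq_transpose_of_trivial]
    simp only [transpose_sum, transpose_smul, transpose_mul, transpose_transpose]
  · intro v hv
    have e : star v ⬝ᵥ ((∑ j, ∑ γ ∈ T, P.φ j (S.m γ *ᵥ x) • ((S.m γ)ᵀ * S.m γ)) *ᵥ v) =
        ∑ j, ∑ γ ∈ T, P.φ j (S.m γ *ᵥ x) * ((S.m γ *ᵥ v) ⬝ᵥ (S.m γ *ᵥ v)) := by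
      simp only [sum_mulVec, dotProduct_sum, smul_mulVec, dotProduct_smul, smul_eq_mul]
      refine Finset.sum_congr rfl fun j _ => Finset.sum_congr rfl fun γ _ => ?_
      rw [← mulVec_mulVec, dotProduct_mulVec, vecMul_transpose]; simp
    rw [e]
    obtain ⟨j, γ, hγ⟩ := P.cov x hx
    have hnn : ∀ j, ∀ γ ∈ T, 0 ≤ P.φ j (S.m γ *ᵥ x) * ((S.m γ *ᵥ v) ⬝ᵥ (S.m γ *ᵥ v)) :=
      fun j γ _ => mul_nonneg (P.nonneg _ _) (by simpa using dotProduct_star_self_nonneg (S.m γ *ᵥ v))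
    refine Finset.sum_pos' (fun j _ => Finset.sum_nonneg (hnn j)) ⟨j, Finset.mem_univ _, ?_⟩
    refine Finset.sum_pos' (hnn j) ⟨γ, hT j γ (by rw [hγ]; exact one_ne_zero), ?_⟩
    rw [hγ, one_mul]
    have hne : S.m γ *ᵥ v ≠ 0 := by
      intro h0
      apply hv
      have := congrArg (fun w => S.m γ⁻¹ *ᵥ w) h0
      simpa [mulVec_mulVec, m_inv_mul] using this
    refine lt_of_le_of_ne (by simpa using dotProduct_star_self_nonneg (S.m γ *ᵥ v)) ?_
    intro h0
    exact hne (dotProduct_self_eq_zero.1 h0.symm)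

/-- invariant metric adapted to the radial direction -/
noncomputable def g (x : Fin n → ℝ) : Matrix (Fin n) (Fin n) ℝ :=
  (S.Pr x)ᵀ * P.h x * S.Pr x + S.Q x • vecMulVec (S.ell x) (S.ell x)

lemma g_m (δ : S.Γ) {x : Fin n → ℝ} (hx : x ∈ S.C) :
    (S.m δ)ᵀ * P.g (S.m δ *ᵥ x) * S.m δ = P.g x := by
  rw [g, g, mul_add, add_mul]
  congr 1
  · have e1 : (S.m δ)ᵀ * (S.Pr (S.m δ *ᵥ x))ᵀ = (S.Pr x)ᵀ * (S.m δ)ᵀ := by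
      rw [← transpose_mul, S.Pr_m, transpose_mul]
    calc _ = ((S.m δ)ᵀ * (S.Pr (S.m δ *ᵥ x))ᵀ) * P.h (S.m δ *ᵥ x) *
          (S.Pr (S.m δ *ᵥ x) * S.m δ) := by simp only [mul_assoc]
      _ = (S.Pr x)ᵀ * ((S.m δ)ᵀ * P.h (S.m δ *ᵥ x) * S.m δ) * S.Pr x := by
          rw [e1, S.Pr_m]; simp only [mul_assoc]
      _ = _ := by rw [P.h_m δ hx]
  · rw [Q_m, Matrix.mul_smul, Matrix.smul_mul, mul_vecMulVec, vecMulVec_mul, mulVec_transpose, ell_m]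

lemma h_smul {c : ℝ} (hc : 0 < c) (x : Fin n → ℝ) : P.h (c • x) = P.h x := P.msum_smul _ _ hc

lemma g_smul {c : ℝ} (hc : 0 < c) (x : Fin n → ℝ) : P.g (c • x) = P.g x := by
  rw [g, g, S.Pr_smul hc, P.h_smul hc, S.ell_smul hc, S.Q_smul, smul_vecMulVec, vecMulVec_smul,
    smul_smul, smul_smul]
  congr 2
  field_simp

lemma g_posDef {x : Fin n → ℝ} (hx : x ∈ S.C) : (P.g x).PosDef := by
  have hQ : 0 < S.Q x := hx
  have hh := P.h_posDef hx
  refine Matrix.PosDef.of_dotProduct_mulVec_pos ?_ ?_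
  · show _ᴴ = _
    have := hh.isHermitian.eq
    rw [conjTranspose_eq_transpose_of_trivial] at this ⊢
    rw [g, transpose_add, transpose_mul, transpose_mul, this, transpose_transpose, transpose_smul,
      transpose_vecMulVec, mul_assoc]
  · intro v hv
    have e : star v ⬝ᵥ (P.g x *ᵥ v) = (S.Pr x *ᵥ v) ⬝ᵥ (P.h x *ᵥ (S.Pr x *ᵥ v)) +
        S.Q x * (S.ell x ⬝ᵥ v) ^ 2 := by
      rw [g, add_mulVec, dotProduct_add, ← mulVec_mulVec, ← mulVec_mulVec, dotProduct_mulVec,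
        star_trivial, vecMul_transpose, smul_mulVec, vecMulVec_mulVec]
      simp only [dotProduct_smul, smul_eq_mul, MulOpposite.smul_eq_mul_unop, MulOpposite.unop_op]
      rw [dotProduct_comm v]
      ring
    rw [e]
    by_cases h0 : S.Pr x *ᵥ v = 0
    · have h1 : S.ell x ⬝ᵥ v ≠ 0 := by
        intro h1
        rw [S.Pr_mulVec, h1] at h0
        apply hv
        simpa using h0
      rw [h0]
      simp only [mulVec_zero, dotProduct_zero, zero_add]
      positivity
    · have := hh.dotProduct_mulVec_pos h0
      rw [star_trivial] at this
      positivity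

lemma contDiffAt_g {x : Fin n → ℝ} (hx : x ∈ S.C) (i j : Fin n) :
    ContDiffAt ℝ 1 (fun y => P.g y i j) x := by
  simp only [g, Matrix.add_apply, Matrix.smul_apply, vecMulVec_apply, smul_eq_mul]
  refine ContDiffAt.add ?_ (S.Q_contDiff.contDiffAt.mul
    ((S.contDiffAt_ell hx i).mul (S.contDiffAt_ell hx j)))
  exact contDiffAt_matrix_mul (fun i j => contDiffAt_matrix_mul (fun i j => S.contDiffAt_Pr hx j i)
    (P.msum_contDiffAt _ hx) i j) (S.contDiffAt_Pr hx) i j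

/-- the positive definite compatible metric -/
noncomputable def gm (x : Fin n → ℝ) : Matrix (Fin n) (Fin n) ℝ := gmean S.η (P.g x)

/-- the involution -/
noncomputable def σ (x : Fin n → ℝ) : Matrix (Fin n) (Fin n) ℝ := S.η * P.gm x

lemma gm_posDef {x : Fin n → ℝ} (hx : x ∈ S.C) : (P.gm x).PosDef :=
  gmean_posDef S.hη S.hηη (P.g_posDef hx)

lemma eta_sigma (x : Fin n → ℝ) : S.η * P.σ x = P.gm x := by
  rw [σ, ← mul_assoc, S.hηη, one_mul]

lemma sigma_sq {x : Fin n → ℝ} (hx : x ∈ S.C) : P.σ x * P.σ x = 1 :=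
  gmean_invol S.hη S.hηη (P.g_posDef hx)

lemma gm_m (δ : S.Γ) {x : Fin n → ℝ} (hx : x ∈ S.C) :
    (S.m δ)ᵀ * P.gm (S.m δ *ᵥ x) * S.m δ = P.gm x := by
  rw [gm, ← gmean_conj S.hη S.hηη (P.g_posDef (S.m_mem_C δ hx)) (S.m_form δ) (S.m_isUnit δ),
    P.g_m δ hx, gm]

lemma _root_.Kulk.Setup.m_eta (S : Setup n) (δ : S.Γ) : S.m δ * S.η * (S.m δ)ᵀ = S.η := by
  have h := S.m_form δ
  have h1 : (S.η * (S.m δ)ᵀ * S.η) * S.m δ = 1 := by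
    rw [mul_assoc, mul_assoc, ← mul_assoc (S.m δ)ᵀ, h, S.hηη]
  have h2 := mul_eq_one_comm.1 h1
  have h3 := congrArg (· * S.η) h2
  simp only [one_mul] at h3
  rw [mul_assoc, mul_assoc _ S.η S.η, S.hηη, mul_one, ← mul_assoc] at h3
  exact h3

lemma sigma_m (δ : S.Γ) {x : Fin n → ℝ} (hx : x ∈ S.C) :
    P.σ (S.m δ *ᵥ x) * S.m δ = S.m δ * P.σ x := by
  rw [σ, σ, ← P.gm_m δ hx, mul_assoc (S.m δ)ᵀ, ← mul_assoc (S.m δ), ← mul_assoc (S.m δ * S.η),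
    S.m_eta, mul_assoc]

lemma sigma_smul {c : ℝ} (hc : 0 < c) (x : Fin n → ℝ) : P.σ (c • x) = P.σ x := by
  rw [σ, σ, gm, gm, P.g_smul hc]

lemma contDiffAt_gm {x : Fin n → ℝ} (hx : x ∈ S.C) (i j : Fin n) :
    ContDiffAt ℝ 1 (fun y => P.gm y i j) x := by
  refine contDiffAt_gmean S.hη S.hηη (P.contDiffAt_g hx) ?_ i j
  filter_upwards [S.C_open.mem_nhds hx] with y hy using P.g_posDef hy

lemma contDiffAt_sigma {x : Fin n → ℝ} (hx : x ∈ S.C) (i j : Fin n) :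
    ContDiffAt ℝ 1 (fun y => P.σ y i j) x :=
  contDiffAt_matrix_mul (M := fun _ => S.η) (fun _ _ => contDiffAt_const) (P.contDiffAt_gm hx) i j

lemma sigma_self {x : Fin n → ℝ} (hx : x ∈ S.C) : P.σ x *ᵥ x = x := by
  have hQ : 0 < S.Q x := hx
  have hd := S.ell_dot hx
  set ρ : Matrix (Fin n) (Fin n) ℝ := 1 - (2 : ℝ) • vecMulVec x (S.ell x) with hρ
  have hρx : ∀ v, ρ *ᵥ v = v - (2 * (S.ell x ⬝ᵥ v)) • x := by
    intro v
    rw [hρ, sub_mulVec, one_mulVec, smul_mulVec, vecMulVec_mulVec]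
    simp [smul_smul]
  have hlρ : S.ell x ᵥ* ρ = - S.ell x := by
    rw [hρ, vecMul_sub, vecMul_one, vecMul_smul, vecMul_vecMulVec, hd]
    ext i; simp; ring
  have hρρ : ρ * ρ = 1 := by
    have : vecMulVec x (S.ell x) * ρ = - vecMulVec x (S.ell x) := by
      rw [vecMulVec_mul, hlρ, vecMulVec_neg]
    nth_rewrite 1 [hρ]
    rw [sub_mul, one_mul, Matrix.smul_mul, this, hρ]
    ext i j; simp
  have hxl : S.η * vecMulVec x (S.ell x) = S.Q x • vecMulVec (S.ell x) (S.ell x) := by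
    rw [mul_vecMulVec]
    have : S.η *ᵥ x = S.Q x • S.ell x := by
      rw [ell, smul_smul, mul_inv_cancel₀ hQ.ne', one_smul]
    rw [this, smul_vecMulVec]
  have hηρ : ρᵀ * S.η = S.η * ρ := by
    have h2 : S.η * ρ = S.η - (2 : ℝ) • S.Q x • vecMulVec (S.ell x) (S.ell x) := by
      rw [hρ, mul_sub, mul_one, Matrix.mul_smul, hxl]
    have h3 : (S.η * ρ)ᵀ = S.η * ρ := by
      rw [h2]; simp [transpose_vecMulVec, S.hη]
    rw [← h3, transpose_mul, S.hη]
  have hform : ρᵀ * S.η * ρ = S.η := by rw [hηρ, mul_assoc, hρρ, mul_one]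
  have hPr : S.Pr x * ρ = S.Pr x := by
    rw [hρ, mul_sub, mul_one, Matrix.mul_smul, mul_vecMulVec, S.Pr_self hx]; simp
  have hg : ρᵀ * P.g x * ρ = P.g x := by
    rw [g, mul_add, add_mul]
    congr 1
    · have : ρᵀ * (S.Pr x)ᵀ = (S.Pr x)ᵀ := by rw [← transpose_mul, hPr]
      rw [← mul_assoc, ← mul_assoc, this, mul_assoc, hPr]
    · rw [Matrix.mul_smul, Matrix.smul_mul, mul_vecMulVec, vecMulVec_mul, mulVec_transpose, hlρ]
      simp [neg_vecMulVec, vecMulVec_neg]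
  have hgm : ρᵀ * P.gm x * ρ = P.gm x := by
    rw [gm, ← gmean_conj S.hη S.hηη (P.g_posDef hx) hform
      ⟨⟨ρ, ρ, hρρ, hρρ⟩, rfl⟩, hg]
  have hσ : P.σ x = ρ * P.σ x * ρ := by
    have : S.η * ρᵀ = ρ * S.η := by
      have : S.η * (ρᵀ * S.η) * S.η = S.η * (S.η * ρ) * S.η := by rw [hηρ]
      rw [← mul_assoc S.η S.η, S.hηη, one_mul, ← mul_assoc, mul_assoc _ S.η S.η, S.hηη, mul_one] at this
      exact this
    rw [σ]
    conv_lhs => rw [← hgm]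
    rw [← mul_assoc, ← mul_assoc, this]
    simp only [mul_assoc]
  set y := P.σ x *ᵥ x with hy
  have hρxx : ρ *ᵥ x = -x := by rw [hρx, hd]; ext i; simp; ring
  have h1 : y = - (ρ *ᵥ y) := by
    conv_lhs => rw [hy, hσ, ← mulVec_mulVec, ← mulVec_mulVec, hρxx]
    simp [mulVec_neg, hy]
  set l := S.ell x ⬝ᵥ y with hl
  have h2 : y = l • x := by
    rw [hρx, ← hl] at h1
    have h3 : (2 : ℝ) • y = (2 : ℝ) • (l • x) := by
      rw [smul_smul, two_smul]
      nth_rewrite 1 [h1]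
      abel
    exact smul_right_injective _ two_ne_zero h3
  have hxne : x ≠ 0 := by rintro rfl; simp [Q] at hQ
  have hlpos : 0 < l := by
    have hp := (P.gm_posDef hx).dotProduct_mulVec_pos hxne
    have e : l = (S.Q x)⁻¹ * (star x ⬝ᵥ (P.gm x *ᵥ x)) := by
      rw [hl, ell, smul_dotProduct, smul_eq_mul, ← P.eta_sigma, ← mulVec_mulVec, ← hy,
        star_trivial, dotProduct_comm, ← S.B_symm x y, dotProduct_mulVec, dotProduct_comm,
        ← mulVec_transpose, S.hη, S.B_symm, dotProduct_comm, dotProduct_comm]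
    rw [e]; positivity
  have h3 : P.σ x *ᵥ y = x := by rw [hy, mulVec_mulVec, P.sigma_sq hx, one_mulVec]
  have h4 : (l * l) • x = (1 : ℝ) • x := by
    rw [one_smul, ← smul_smul, ← h2]
    rw [h2, mulVec_smul, ← hy] at h3
    exact h3
  have h5 : l * l = 1 := smul_left_injective ℝ hxne h4
  have h6 : l = 1 := by nlinarith
  rw [h2, h6, one_smul]

end Bumps
end Setup
end Kulk
end

section
open Matrix Filter Topology MeasureTheory

namespace Kulk

/-- Jacobian matrix -/
noncomputable def jac {n : ℕ} (s : (Fin n → ℝ) → (Fin n → ℝ)) (x : Fin n → ℝ) :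
    Matrix (Fin n) (Fin n) ℝ :=
  Matrix.of fun i j => fderiv ℝ (fun y => s y i) x (Pi.single j 1)

/-- a matrix as a continuous linear map -/
noncomputable def mclm {n : ℕ} (A : Matrix (Fin n) (Fin n) ℝ) : (Fin n → ℝ) →L[ℝ] (Fin n → ℝ) :=
  (Matrix.mulVecLin A).toContinuousLinearMap

@[simp] lemma mclm_apply {n : ℕ} (A : Matrix (Fin n) (Fin n) ℝ) (v : Fin n → ℝ) :
    mclm A v = A *ᵥ v := rfl

lemma mclm_det {n : ℕ} (A : Matrix (Fin n) (Fin n) ℝ) : (mclm A).det = A.det := by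
  rw [ContinuousLinearMap.det]
  show LinearMap.det (Matrix.mulVecLin A) = _
  rw [← Matrix.toLin'_apply', LinearMap.det_toLin']

lemma clm_apply_eq_sum {n : ℕ} (L : (Fin n → ℝ) →L[ℝ] ℝ) (v : Fin n → ℝ) :
    L v = ∑ j, L (Pi.single j 1) * v j := by
  have h := LinearMap.pi_apply_eq_sum_univ (L : (Fin n → ℝ) →ₗ[ℝ] ℝ) v
  rw [ContinuousLinearMap.coe_coe] at h
  rw [h]
  refine Finset.sum_congr rfl fun j _ => ?_
  rw [smul_eq_mul, mul_comm]
  congr 2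
  ext i
  simp [Pi.single_apply, eq_comm]

lemma hasFDerivAt_jac {n : ℕ} {s : (Fin n → ℝ) → (Fin n → ℝ)} {x : Fin n → ℝ}
    (hs : ContDiffAt ℝ 1 s x) : HasFDerivAt s (mclm (jac s x)) x := by
  have hd : DifferentiableAt ℝ s x := hs.differentiableAt one_ne_zero
  rw [hasFDerivAt_pi']
  intro i
  have h1 : HasFDerivAt (fun y => s y i) (fderiv ℝ (fun y => s y i) x) x :=
    (differentiableAt_pi.1 hd i).hasFDerivAt
  have e : (ContinuousLinearMap.proj i).comp (mclm (jac s x)) = fderiv ℝ (fun y => s y i) x := by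
    refine ContinuousLinearMap.ext fun v => ?_
    rw [clm_apply_eq_sum (fderiv ℝ (fun y => s y i) x) v]
    rfl
  rw [e]
  exact h1

lemma jac_eq_of_hasFDerivAt {n : ℕ} {s : (Fin n → ℝ) → (Fin n → ℝ)} {x : Fin n → ℝ}
    {A : Matrix (Fin n) (Fin n) ℝ} (h : HasFDerivAt s (mclm A) x) : jac s x = A := by
  ext i j
  have := (hasFDerivAt_pi'.1 h i).fderiv
  simp [jac, this]

lemma jac_lin {n : ℕ} {s₁ s₂ : (Fin n → ℝ) → (Fin n → ℝ)} {x : Fin n → ℝ}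
    (h₁ : ContDiffAt ℝ 1 s₁ x) (h₂ : ContDiffAt ℝ 1 s₂ x) (t τ : ℝ) :
    jac (fun y => t • s₁ y + τ • s₂ y) x = t • jac s₁ x + τ • jac s₂ x := by
  apply jac_eq_of_hasFDerivAt
  have e : mclm (t • jac s₁ x + τ • jac s₂ x) = t • mclm (jac s₁ x) + τ • mclm (jac s₂ x) := by
    refine ContinuousLinearMap.ext fun v => ?_
    simp [add_mulVec, smul_mulVec]
  rw [e]
  exact ((hasFDerivAt_jac h₁).const_smul t).add ((hasFDerivAt_jac h₂).const_smul τ)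

lemma continuousAt_jac {n : ℕ} {s : (Fin n → ℝ) → (Fin n → ℝ)} {x : Fin n → ℝ}
    (hs : ContDiffAt ℝ 1 s x) (i j : Fin n) : ContinuousAt (fun y => jac s y i j) x := by
  have h1 : ContDiffAt ℝ 1 (fun y => s y i) x := contDiffAt_pi.1 hs i
  have := h1.continuousAt_fderiv one_ne_zero
  simp only [jac, of_apply]
  fun_prop

lemma hasDerivAt_dot {n : ℕ} {f g : ℝ → (Fin n → ℝ)} {f' g' : Fin n → ℝ} {t : ℝ}
    (hf : HasDerivAt f f' t) (hg : HasDerivAt g g' t) :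
    HasDerivAt (fun c => f c ⬝ᵥ g c) (f' ⬝ᵥ g t + f t ⬝ᵥ g') t := by
  simp only [dotProduct, ← Finset.sum_add_distrib]
  rw [hasDerivAt_pi] at hf hg
  exact HasDerivAt.fun_sum fun i _ => (hf i).mul (hg i)

namespace Setup
variable {n : ℕ} (S : Setup n)

/-- invariant homogeneous tangential vector fields -/
structure IsField (s : (Fin n → ℝ) → (Fin n → ℝ)) : Prop where
  smooth : ∀ x ∈ S.C, ContDiffAt ℝ 1 s x
  equi : ∀ γ : S.Γ, ∀ x ∈ S.C, s (S.m γ *ᵥ x) = S.m γ *ᵥ s x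
  hom : ∀ c : ℝ, 0 < c → ∀ x ∈ S.C, s (c • x) = c • s x
  tan : ∀ x ∈ S.C, x ⬝ᵥ (S.η *ᵥ s x) = 0

variable {S}

lemma IsField.lin {s₁ s₂ : (Fin n → ℝ) → (Fin n → ℝ)} (h₁ : S.IsField s₁) (h₂ : S.IsField s₂)
    (t τ : ℝ) : S.IsField (fun x => t • s₁ x + τ • s₂ x) where
  smooth x hx := ((h₁.smooth x hx).const_smul t).add ((h₂.smooth x hx).const_smul τ)
  equi γ x hx := by simp [h₁.equi γ x hx, h₂.equi γ x hx, mulVec_add, mulVec_smul]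
  hom c hc x hx := by
    simp only [h₁.hom c hc x hx, h₂.hom c hc x hx, smul_add, smul_smul, mul_comm]
  tan x hx := by simp [mulVec_add, mulVec_smul, h₁.tan x hx, h₂.tan x hx]

lemma hasDerivAt_line {s : (Fin n → ℝ) → (Fin n → ℝ)} {x : Fin n → ℝ}
    (hs : ContDiffAt ℝ 1 s x) (v : Fin n → ℝ) :
    HasDerivAt (fun c : ℝ => s (x + c • v)) (jac s x *ᵥ v) 0 := by
  have h1 : HasDerivAt (fun c : ℝ => x + c • v) v 0 := by
    simpa using ((hasDerivAt_id (0 : ℝ)).smul_const v).const_add x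
  have h2 : HasFDerivAt s (mclm (jac s x)) (x + (0 : ℝ) • v) := by
    simpa using hasFDerivAt_jac hs
  exact h2.comp_hasDerivAt 0 h1

lemma IsField.euler {s : (Fin n → ℝ) → (Fin n → ℝ)} (h : S.IsField s) {x : Fin n → ℝ}
    (hx : x ∈ S.C) : jac s x *ᵥ x = s x := by
  have h1 := hasDerivAt_line (h.smooth x hx) x
  have h2 : HasDerivAt (fun c : ℝ => (1 + c) • s x) (s x) 0 := by
    simpa using ((hasDerivAt_id (0 : ℝ)).const_add 1).smul_const (s x)
  have h3 : (fun c : ℝ => s (x + c • x)) =ᶠ[𝓝 0] fun c : ℝ => (1 + c) • s x := by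
    have : ∀ᶠ c : ℝ in 𝓝 0, -1 < c := lt_mem_nhds (by norm_num)
    filter_upwards [this] with c hc
    rw [← h.hom (1 + c) (by linarith) x hx, add_smul, one_smul]
  exact (h1.congr_of_eventuallyEq h3.symm).unique h2

lemma IsField.tan_deriv {s : (Fin n → ℝ) → (Fin n → ℝ)} (h : S.IsField s) {x : Fin n → ℝ}
    (hx : x ∈ S.C) : S.ell x ᵥ* jac s x = - (S.Q x)⁻¹ • (S.η *ᵥ s x) := by
  have key : ∀ v, (S.η *ᵥ x) ⬝ᵥ (jac s x *ᵥ v) = - ((S.η *ᵥ s x) ⬝ᵥ v) := by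
    intro v
    have h0 : HasDerivAt (fun c : ℝ => x + c • v) v 0 := by
      simpa using ((hasDerivAt_id (0 : ℝ)).smul_const v).const_add x
    have h1 := hasDerivAt_line (h.smooth x hx) v
    have h2 : HasDerivAt (fun c : ℝ => S.η *ᵥ s (x + c • v)) (S.η *ᵥ (jac s x *ᵥ v)) 0 :=
      (mclm S.η).hasFDerivAt.comp_hasDerivAt 0 h1
    have h3 := hasDerivAt_dot h0 h2
    have h4 : (fun c : ℝ => (x + c • v) ⬝ᵥ (S.η *ᵥ s (x + c • v))) =ᶠ[𝓝 0] fun _ => (0 : ℝ) := by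
      have hc : ContinuousAt (fun c : ℝ => x + c • v) 0 := by fun_prop
      have : ∀ᶠ c : ℝ in 𝓝 0, x + c • v ∈ S.C := hc.eventually (by
        simpa using S.C_open.mem_nhds hx)
      filter_upwards [this] with c hc using h.tan _ hc
    have h5 := (h3.congr_of_eventuallyEq h4.symm).unique (hasDerivAt_const (0 : ℝ) (0 : ℝ))
    simp only [zero_smul, add_zero] at h5
    rw [dotProduct_comm v] at h5
    rw [dotProduct_comm (S.η *ᵥ x), S.B_symm (jac s x *ᵥ v) x]
    linarith
  rw [ell, smul_vecMul, neg_smul, ← smul_neg]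
  congr 1
  ext j
  have := key (Pi.single j 1)
  rw [dotProduct_mulVec] at this
  simpa using this

namespace Bumps
variable (P : Bumps S)

lemma sigma_field {s : (Fin n → ℝ) → (Fin n → ℝ)} (h : S.IsField s) :
    S.IsField (fun x => P.σ x *ᵥ s x) where
  smooth x hx := by
    rw [contDiffAt_pi]
    intro i
    simp only [mulVec, dotProduct]
    exact ContDiffAt.sum fun k _ => (P.contDiffAt_sigma hx i k).mul (contDiffAt_pi.1 (h.smooth x hx) k)
  equi γ x hx := by
    simp only [h.equi γ x hx]
    rw [mulVec_mulVec, P.sigma_m γ hx, mulVec_mulVec]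
  hom c hc x hx := by
    simp only [h.hom c hc x hx]
    rw [P.sigma_smul hc, mulVec_smul]
  tan x hx := by
    have h1 : (P.gm x)ᵀ = P.gm x := by
      have := (P.gm_posDef hx).isHermitian.eq
      rwa [conjTranspose_eq_transpose_of_trivial] at this
    rw [mulVec_mulVec, P.eta_sigma, dotProduct_mulVec, ← mulVec_transpose, h1, ← P.eta_sigma,
      ← mulVec_mulVec, P.sigma_self hx, dotProduct_comm, S.B_symm, h.tan x hx]

lemma jac_sigma {s : (Fin n → ℝ) → (Fin n → ℝ)} {x : Fin n → ℝ} (hx : x ∈ S.C)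
    (hs : ContDiffAt ℝ 1 s x) (i l : Fin n) :
    jac (fun x => P.σ x *ᵥ s x) x i l = (P.σ x * jac s x) i l +
      ∑ k, fderiv ℝ (fun y => P.σ y i k) x (Pi.single l 1) * s x k := by
  have hd : ∀ k, DifferentiableAt ℝ (fun y => P.σ y i k) x := fun k =>
    (P.contDiffAt_sigma hx i k).differentiableAt one_ne_zero
  have hd2 : ∀ k, DifferentiableAt ℝ (fun y => s y k) x := fun k =>
    (contDiffAt_pi.1 hs k).differentiableAt one_ne_zero
  have h1 : HasFDerivAt (fun y => (P.σ y *ᵥ s y) i)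
      (∑ k, (P.σ x i k • fderiv ℝ (fun y => s y k) x + s x k • fderiv ℝ (fun y => P.σ y i k) x)) x := by
    simp only [mulVec, dotProduct]
    exact HasFDerivAt.fun_sum fun k _ => (hd k).hasFDerivAt.mul (hd2 k).hasFDerivAt
  simp only [jac, of_apply, h1.fderiv, mul_apply, _root_.sum_apply,
    _root_.add_apply, _root_.smul_apply, smul_eq_mul,
    ← Finset.sum_add_distrib]
  refine Finset.sum_congr rfl fun k _ => ?_
  ring

open Classical in
/-- equivariant matrix functions -/
noncomputable def M (k : P.ι) (x : Fin n → ℝ) : Matrix (Fin n) (Fin n) ℝ :=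
  P.msum (fun j γ => if j = k then S.m γ⁻¹ else 0) x

lemma M_m (k : P.ι) (δ : S.Γ) {x : Fin n → ℝ} (hx : x ∈ S.C) :
    P.M k (S.m δ *ᵥ x) = S.m δ * P.M k x := by
  rw [M, M, P.msum_m, ← mul_one (S.m δ * _), P.msum_mul _ hx]
  congr 1
  funext j γ
  split_ifs
  · rw [mul_one, ← m_mul]; simp
  · simp

lemma M_eq {k : P.ι} {x : Fin n → ℝ} (hx : x ∈ S.C) {γ : S.Γ} (h : P.φ k (S.m γ *ᵥ x) = 1) :
    P.M k x = S.m γ⁻¹ := by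
  classical
  obtain ⟨T, hT⟩ := P.exists_finset' x hx
  have hγT : γ ∈ T := hT k γ (by rw [h]; exact one_ne_zero)
  rw [M, P.msum_eq _ hT, Finset.sum_eq_single k, Finset.sum_eq_single γ]
  · simp [h]
  · intro δ _ hδ
    have : P.φ k (S.m δ *ᵥ x) = 0 := by
      by_contra hne
      exact hδ (P.iso k x hx δ γ hne (by rw [h]; exact one_ne_zero))
    rw [this, zero_smul]
  · intro h'; exact absurd hγT h'
  · intro j _ hj
    simp [hj]
  · intro hne; exact absurd (Finset.mem_univ _) hne

/-- the fields -/
noncomputable def u (a : P.ι → Fin n → ℝ) (x : Fin n → ℝ) : Fin n → ℝ :=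
  Real.sqrt (S.Q x) • (S.Pr x *ᵥ ∑ k, P.M k x *ᵥ a k)

lemma u_field (a : P.ι → Fin n → ℝ) : S.IsField (P.u a) where
  smooth x hx := by
    unfold u
    refine (S.contDiffAt_sqrtQ hx).smul ?_
    rw [contDiffAt_pi]
    intro i
    simp only [mulVec, dotProduct, Finset.sum_apply]
    refine ContDiffAt.sum fun l _ => (S.contDiffAt_Pr hx i l).mul (ContDiffAt.sum fun k _ =>
      ContDiffAt.sum fun l' _ => ContDiffAt.mul ?_ contDiffAt_const)
    exact P.msum_contDiffAt _ hx l l'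
  equi γ x hx := by
    simp only [u, P.M_m _ γ hx, Q_m, mulVec_smul]
    congr 1
    rw [mulVec_mulVec (v := ∑ k, P.M k x *ᵥ a k), ← S.Pr_m]
    simp only [mulVec_sum, mulVec_mulVec, Matrix.mul_assoc]
  hom c hc x hx := by
    have : ∀ k, P.M k (c • x) = P.M k x := fun k => P.msum_smul _ _ hc
    simp only [u, this, S.Pr_smul hc, Q_smul]
    rw [Real.sqrt_mul (sq_nonneg c), Real.sqrt_sq hc.le, smul_smul]
  tan x hx := by
    have hQ : 0 < S.Q x := hx
    set w := ∑ k, P.M k x *ᵥ a k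
    have h1 : S.ell x ⬝ᵥ (S.Pr x *ᵥ w) = 0 := by
      rw [S.Pr_mulVec, dotProduct_sub, dotProduct_smul, S.ell_dot hx]; simp
    have h2 : x ⬝ᵥ (S.η *ᵥ (S.Pr x *ᵥ w)) = S.Q x * (S.ell x ⬝ᵥ (S.Pr x *ᵥ w)) := by
      rw [ell, smul_dotProduct, smul_eq_mul, mul_inv_cancel_left₀ hQ.ne', S.B_symm, dotProduct_comm]
    rw [u, mulVec_smul, dotProduct_smul, h2, h1]
    simp

end Bumps
end Setup
end Kulk
end

section
open Matrix Filter Topology MeasureTheory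

namespace Kulk

lemma norm_mulVec_le_entries {n : ℕ} {A : Matrix (Fin n) (Fin n) ℝ} {ε : ℝ} (hε : 0 ≤ ε)
    (h : ∀ i j, |A i j| ≤ ε) (v : Fin n → ℝ) : ‖A *ᵥ v‖ ≤ n * ε * ‖v‖ := by
  rw [pi_norm_le_iff_of_nonneg (by positivity)]
  intro i
  rw [mulVec, dotProduct]
  refine (norm_sum_le _ _).trans ?_
  calc _ ≤ ∑ _j : Fin n, ε * ‖v‖ := Finset.sum_le_sum fun j _ => by
        rw [norm_mul]
        exact mul_le_mul (h i j) (norm_le_pi_norm v j) (norm_nonneg _) hε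
    _ = _ := by simp; ring

namespace Setup
variable {n : ℕ} (S : Setup n)

lemma field_small_bij : ∃ ε > 0, ∃ K' : Set (Fin n → ℝ), IsCompact K' ∧ K' ⊆ S.C ∧
    ∀ s, S.IsField s → (∀ x ∈ K', ‖s x‖ ≤ ε ∧ ∀ i j, |jac s x i j| ≤ ε) →
      Set.InjOn (fun x => x + s x) S.C ∧ (fun x => x + s x) '' S.C = S.C := by
  obtain ⟨r, hr, hrC⟩ := S.hKc.exists_cthickening_subset_open S.C_open
    (S.K_subset_X.trans S.X_subset_C)
  set K' := Metric.cthickening r S.K with hK'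
  have hK'c : IsCompact K' := S.hKc.cthickening
  have hball : ∀ x ∈ S.K, Metric.closedBall x r ⊆ K' := fun x hx =>
    Metric.closedBall_subset_cthickening hx r
  have hfin := S.properC hK'c hK'c hrC hrC
  set G0 := {γ : S.Γ | ∃ x ∈ K', ∃ c : ℝ, 0 < c ∧ c • (S.m γ *ᵥ x) ∈ K'}
  obtain ⟨B, hB⟩ : ∃ B : ℝ, ∀ γ ∈ G0, ‖mclm (S.m γ)‖ ≤ B := by
    obtain ⟨B, hB⟩ := (hfin.image fun γ => ‖mclm (S.m γ)‖).bddAbove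
    exact ⟨B, fun γ hγ => hB ⟨γ, hγ, rfl⟩⟩
  obtain ⟨q0, hq0, hq0'⟩ : ∃ q0 > 0, ∀ x ∈ K', q0 ≤ S.Q x := by
    rcases K'.eq_empty_or_nonempty with h | h
    · exact ⟨1, one_pos, by simp [h]⟩
    · obtain ⟨x, hx, hmin⟩ := hK'c.exists_isMinOn h S.Q_continuous.continuousOn
      exact ⟨S.Q x, hrC hx, fun y hy => hmin hy⟩
  obtain ⟨q1, hq1⟩ : ∃ q1, ∀ x ∈ K', S.Q x ≤ q1 := by
    obtain ⟨q1, h⟩ := (hK'c.image_of_continuousOn S.Q_continuous.continuousOn).bddAbove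
    exact ⟨q1, fun x hx => h ⟨x, hx, rfl⟩⟩
  obtain ⟨D, hD0, hD⟩ : ∃ D : ℝ, 0 ≤ D ∧ ∀ c : ℝ, 0 < c → c ^ 2 * q0 ≤ q1 → c ≤ D := by
    refine ⟨Real.sqrt (q1 / q0), Real.sqrt_nonneg _, fun c hc h => ?_⟩
    apply Real.le_sqrt_of_sq_le
    rw [le_div_iff₀ hq0]; exact h
  set BB := D * max B 0 with hBB
  have hBB0 : 0 ≤ BB := by positivity
  refine ⟨min (r / (1 + BB)) (1 / (2 * (n + 1))), by positivity, K', hK'c, hrC, ?_⟩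
  set ε := min (r / (1 + BB)) (1 / (2 * ((n : ℝ) + 1))) with hε
  have hε0 : 0 < ε := by positivity
  have hε1 : ε * (1 + BB) ≤ r := by
    rw [← le_div_iff₀ (by positivity)]; exact min_le_left _ _
  have hεr : ε ≤ r := by nlinarith
  have hε2 : n * ε ≤ 1 / 2 := by
    have h1 : ε ≤ 1 / (2 * ((n : ℝ) + 1)) := min_le_right _ _
    have : (n : ℝ) * (1 / (2 * ((n : ℝ) + 1))) ≤ 1 / 2 := by
      rw [mul_one_div, div_le_div_iff₀ (by positivity) (by positivity)]; nlinarith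
    exact (mul_le_mul_of_nonneg_left h1 (by positivity)).trans this
  intro s hs hsm
  set H : (Fin n → ℝ) → (Fin n → ℝ) := fun x => x + s x with hH
  have hKK' : S.K ⊆ K' := Metric.self_subset_cthickening _
  have Hequi : ∀ γ : S.Γ, ∀ c : ℝ, 0 < c → ∀ x ∈ S.C, H (c • (S.m γ *ᵥ x)) = c • (S.m γ *ᵥ H x) := by
    intro γ c hc x hx
    simp only [hH]
    rw [hs.hom c hc _ (S.m_mem_C γ hx), hs.equi γ x hx, mulVec_add, smul_add]
  have HK : ∀ x ∈ S.K, H x ∈ K' := by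
    intro x hx
    apply hball x hx
    rw [mem_closedBall_iff_norm]
    simp only [hH, add_sub_cancel_left]
    exact ((hsm x (hKK' hx)).1).trans hεr
  have lip : ∀ z ∈ S.K, ∀ x ∈ Metric.closedBall z r, ∀ y ∈ Metric.closedBall z r,
      ‖s x - s y‖ ≤ 1 / 2 * ‖x - y‖ := by
    intro z hz x hx y hy
    refine (convex_closedBall z r).norm_image_sub_le_of_norm_hasFDerivWithin_le
      (f' := fun x => mclm (jac s x)) (fun w hw => ?_) (fun w hw => ?_) hy hx
    · exact (hasFDerivAt_jac (hs.smooth w (hrC (hball z hz hw)))).hasFDerivWithinAt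
    · refine ContinuousLinearMap.opNorm_le_bound _ (by norm_num) fun v => ?_
      refine (norm_mulVec_le_entries hε0.le (hsm w (hball z hz hw)).2 v).trans ?_
      exact mul_le_mul_of_nonneg_right hε2 (norm_nonneg _)
  have HC : ∀ x ∈ S.C, H x ∈ S.C := by
    intro x hx
    obtain ⟨γ, y, hy, e⟩ := S.coverC hx
    have hc : 0 < Real.sqrt (S.Q x) := Real.sqrt_pos.2 hx
    rw [e, Hequi γ _ hc y (hrC (hKK' hy))]
    exact S.smul_mem_C hc (S.m_mem_C γ (hrC (HK y hy)))
  have minv : ∀ (γ : S.Γ) (v : Fin n → ℝ), S.m γ⁻¹ *ᵥ (S.m γ *ᵥ v) = v := fun γ v => by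
    rw [mulVec_mulVec, m_inv_mul, one_mulVec]
  have minv' : ∀ (γ : S.Γ) (v : Fin n → ℝ), S.m γ *ᵥ (S.m γ⁻¹ *ᵥ v) = v := fun γ v => by
    rw [mulVec_mulVec, m_mul_inv, one_mulVec]
  -- injectivity from base points in K
  have key : ∀ x ∈ S.K, ∀ y ∈ S.C, H x = H y → x = y := by
    intro x hx y hy hxy
    obtain ⟨γ, y', hy', e⟩ := S.coverC hy
    have hc : 0 < Real.sqrt (S.Q y) := Real.sqrt_pos.2 hy
    set c := Real.sqrt (S.Q y)
    have hy'C := hrC (hKK' hy')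
    have e2 : H x = c • (S.m γ *ᵥ H y') := by rw [hxy, e, Hequi γ c hc y' hy'C]
    have hγ : γ ∈ G0 := ⟨H y', HK y' hy', c, hc, by rw [← e2]; exact HK x hx⟩
    have hcD : c ≤ D := by
      apply hD c hc
      have : S.Q (H x) = c ^ 2 * S.Q (H y') := by rw [e2, Q_smul, Q_m]
      have h1 := hq1 _ (HK x hx)
      have h2 := hq0' _ (HK y' hy')
      rw [this] at h1
      nlinarith [sq_nonneg c]
    have hyx : ‖y - x‖ ≤ r := by
      have e3 : y - x = s x - s y := by
        have : x + s x = y + s y := hxy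
        rw [sub_eq_sub_iff_add_eq_add, ← this, add_comm]
      have e4 : s y = c • (S.m γ *ᵥ s y') := by
        conv_lhs => rw [e]
        rw [hs.hom c hc _ (S.m_mem_C γ hy'C), hs.equi γ y' hy'C]
      have b1 : ‖s x‖ ≤ ε := (hsm x (hKK' hx)).1
      have b2 : ‖s y‖ ≤ BB * ε := by
        rw [e4, norm_smul, Real.norm_of_nonneg hc.le]
        have h1 : ‖S.m γ *ᵥ s y'‖ ≤ max B 0 * ε := by
          refine ((mclm (S.m γ)).le_opNorm (s y')).trans ?_
          exact mul_le_mul ((hB γ hγ).trans (le_max_left _ _)) (hsm y' (hKK' hy')).1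
            (norm_nonneg _) (le_max_right _ _)
        rw [hBB, mul_assoc]
        exact mul_le_mul hcD h1 (norm_nonneg _) hD0
      rw [e3]
      refine (norm_sub_le _ _).trans ?_
      linarith
    have hl := lip x hx x (Metric.mem_closedBall_self hr.le) y (by
      rwa [mem_closedBall_iff_norm])
    have e3 : x - y = -(s x - s y) := by
      have : x + s x = y + s y := hxy
      rw [neg_sub, sub_eq_sub_iff_add_eq_add, this, add_comm]
    rw [← norm_neg (s x - s y), ← e3] at hl
    have : ‖x - y‖ = 0 := le_antisymm (by linarith [norm_nonneg (x - y)]) (norm_nonneg _)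
    exact sub_eq_zero.1 (norm_eq_zero.1 this)
  have cinv : ∀ (c : ℝ), 0 < c → ∀ (γ : S.Γ) (v : Fin n → ℝ),
      c⁻¹ • (S.m γ⁻¹ *ᵥ (c • (S.m γ *ᵥ v))) = v := fun c hc γ v => by
    rw [mulVec_smul, minv, smul_smul, inv_mul_cancel₀ hc.ne', one_smul]
  constructor
  · intro x hx y hy hxy
    have hxy : H x = H y := hxy
    obtain ⟨γ, x', hx', e⟩ := S.coverC hx
    have hc : 0 < Real.sqrt (S.Q x) := Real.sqrt_pos.2 hx
    set c := Real.sqrt (S.Q x)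
    have hx'C := hrC (hKK' hx')
    set y' := c⁻¹ • (S.m γ⁻¹ *ᵥ y)
    have hy' : y' ∈ S.C := S.smul_mem_C (inv_pos.2 hc) (S.m_mem_C _ hy)
    have h1 := key x' hx' y' hy' (by
      rw [Hequi γ⁻¹ _ (inv_pos.2 hc) y hy, ← hxy, e, Hequi γ c hc x' hx'C, cinv c hc])
    rw [e, h1]
    simp only [y']
    rw [mulVec_smul, minv', smul_smul, mul_inv_cancel₀ hc.ne', one_smul]
  · apply Set.Subset.antisymm
    · rintro _ ⟨x, hx, rfl⟩; exact HC x hx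
    · intro z hz
      obtain ⟨γ, z', hz', e⟩ := S.coverC hz
      have hc : 0 < Real.sqrt (S.Q z) := Real.sqrt_pos.2 hz
      set c := Real.sqrt (S.Q z)
      have hmaps : Set.MapsTo (fun x => z' - s x) (Metric.closedBall z' r) (Metric.closedBall z' r) := by
        intro x hx
        rw [mem_closedBall_iff_norm]
        simp only [sub_sub_cancel_left, norm_neg]
        exact ((hsm x (hball z' hz' hx)).1).trans hεr
      have hcontr : ContractingWith (1 / 2) (hmaps.restrict (fun x => z' - s x) _ _) := by
        refine ⟨by norm_num, LipschitzWith.of_dist_le_mul fun x y => ?_⟩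
        rw [Subtype.dist_eq, Subtype.dist_eq, dist_eq_norm, dist_eq_norm]
        simp only [Set.MapsTo.val_restrict_apply, sub_sub_sub_cancel_left]
        rw [norm_sub_rev]
        simpa using lip z' hz' x x.2 y y.2
      obtain ⟨x, hx, hfix, -⟩ := hcontr.exists_fixedPoint'
        Metric.isClosed_closedBall.isComplete hmaps (x := z') (Metric.mem_closedBall_self hr.le)
        (edist_ne_top _ _)
      have hxz : H x = z' := by
        have : z' - s x = x := hfix
        simp only [hH]
        nth_rewrite 1 [← this]
        abel
      have hxC : x ∈ S.C := hrC (hball z' hz' hx)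
      refine ⟨c • (S.m γ *ᵥ x), S.smul_mem_C hc (S.m_mem_C γ hxC), ?_⟩
      show H _ = z
      rw [Hequi γ c hc x hxC, hxz, ← e]

end Setup
end Kulk
end

section
open Matrix Filter Topology MeasureTheory

namespace Kulk
namespace Setup
variable {n : ℕ} (S : Setup n)

/-- the action of `Γ × ℤ` -/
noncomputable def act (g : S.Γ × ℤ) : Matrix (Fin n) (Fin n) ℝ := (2 : ℝ) ^ g.2 • S.m g.1

lemma act_mulVec (g : S.Γ × ℤ) (x : Fin n → ℝ) :
    S.act g *ᵥ x = (2 : ℝ) ^ g.2 • (S.m g.1 *ᵥ x) := by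
  simp [act, smul_mulVec]

/-- inverse element -/
def ginv (g : S.Γ × ℤ) : S.Γ × ℤ := (g.1⁻¹, -g.2)

lemma ginv_ginv (g : S.Γ × ℤ) : S.ginv (S.ginv g) = g := by simp [ginv]

lemma act_inv (g : S.Γ × ℤ) : S.act (S.ginv g) * S.act g = 1 := by
  have : ((2 : ℝ) ^ g.2) ≠ 0 := by positivity
  simp [act, ginv, smul_smul, S.m_inv_mul, this]

lemma act_inv' (g : S.Γ × ℤ) : S.act g * S.act (S.ginv g) = 1 := by
  have := S.act_inv (S.ginv g)
  rwa [ginv_ginv] at this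

lemma act_mem_C (g : S.Γ × ℤ) {x : Fin n → ℝ} (hx : x ∈ S.C) : S.act g *ᵥ x ∈ S.C := by
  rw [act_mulVec]
  exact S.smul_mem_C (by positivity) (S.m_mem_C _ hx)

lemma act_mem_C_iff (g : S.Γ × ℤ) {x : Fin n → ℝ} : S.act g *ᵥ x ∈ S.C ↔ x ∈ S.C := by
  refine ⟨fun h => ?_, S.act_mem_C g⟩
  have := S.act_mem_C (S.ginv g) h
  rwa [mulVec_mulVec, act_inv, one_mulVec] at this

lemma Q_act (g : S.Γ × ℤ) (x : Fin n → ℝ) : S.Q (S.act g *ᵥ x) = ((2 : ℝ) ^ g.2) ^ 2 * S.Q x := by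
  rw [act_mulVec, Q_smul, Q_m]

lemma abs_det_act (g : S.Γ × ℤ) : |(S.act g).det| = ((2 : ℝ) ^ g.2) ^ n := by
  rw [act, det_smul, abs_mul, abs_det_m, mul_one, Fintype.card_fin, abs_of_pos (by positivity)]

/-- the invariant weight -/
noncomputable def W (x : Fin n → ℝ) : ENNReal := ENNReal.ofReal ((Real.sqrt (S.Q x))⁻¹ ^ n)

lemma W_measurable : Measurable S.W := by
  unfold W
  have := S.Q_continuous.measurable
  fun_prop

lemma W_act (g : S.Γ × ℤ) (x : Fin n → ℝ) :
    ENNReal.ofReal |(S.act g).det| * S.W (S.act g *ᵥ x) = S.W x := by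
  have h2 : (0 : ℝ) < (2 : ℝ) ^ g.2 := by positivity
  rw [W, W, ← ENNReal.ofReal_mul (abs_nonneg _), abs_det_act, Q_act, Real.sqrt_mul (sq_nonneg _),
    Real.sqrt_sq h2.le, ← mul_pow, mul_inv, ← mul_assoc, mul_inv_cancel₀ h2.ne', one_mul]

lemma lintegral_act (g : S.Γ × ℤ) {Φ : (Fin n → ℝ) → ENNReal} (hΦ : Measurable Φ) :
    ∫⁻ x, Φ (S.act g *ᵥ x) * S.W x = ∫⁻ x, Φ x * S.W x := by
  have hd : (S.act g).det ≠ 0 := by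
    intro h
    have := S.abs_det_act g
    rw [h, abs_zero] at this
    have h2 : (0 : ℝ) < ((2 : ℝ) ^ g.2) ^ n := by positivity
    linarith
  have hm := Real.map_matrix_volume_pi_eq_smul_volume_pi hd
  have hmeas : Measurable (fun x => Φ x * S.W x) := hΦ.mul S.W_measurable
  have h1 : ∫⁻ x, Φ (S.act g *ᵥ x) * S.W (S.act g *ᵥ x)
      = ENNReal.ofReal |(S.act g).det⁻¹| * ∫⁻ x, Φ x * S.W x := by
    have := lintegral_map (μ := volume) hmeas
      (g := Matrix.toLin' (S.act g)) (LinearMap.continuous_of_finiteDimensional _).measurable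
    rw [hm, lintegral_smul_measure] at this
    simpa using this.symm
  have h2 : ∀ x, Φ (S.act g *ᵥ x) * S.W x
      = ENNReal.ofReal |(S.act g).det| * (Φ (S.act g *ᵥ x) * S.W (S.act g *ᵥ x)) := by
    intro x
    rw [← S.W_act g x]; ring
  simp_rw [h2]
  rw [lintegral_const_mul, h1, ← mul_assoc, ← ENNReal.ofReal_mul (abs_nonneg _), ← abs_mul,
    mul_inv_cancel₀ hd]
  · simp
  · exact hmeas.comp (by fun_prop : Measurable fun x : Fin n → ℝ => S.act g *ᵥ x)

lemma unfold_eq {F1 F2 h : (Fin n → ℝ) → ENNReal} (m1 : Measurable F1) (m2 : Measurable F2)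
    (mh : Measurable h) (z1 : ∀ x, x ∉ S.C → F1 x = 0) (z2 : ∀ x, x ∉ S.C → F2 x = 0)
    (s1 : ∀ x ∈ S.C, ∑' g, F1 (S.act g *ᵥ x) = 1) (s2 : ∀ x ∈ S.C, ∑' g, F2 (S.act g *ᵥ x) = 1)
    (hh : ∀ g, ∀ x ∈ S.C, h (S.act g *ᵥ x) = h x) :
    ∫⁻ x, F1 x * h x * S.W x = ∫⁻ x, F2 x * h x * S.W x := by
  have := S.countableΓ
  have ma : ∀ g, Measurable fun x : Fin n → ℝ => S.act g *ᵥ x := fun g => by fun_prop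
  have key : ∀ {F1 F2 : (Fin n → ℝ) → ENNReal}, Measurable F1 → Measurable F2 →
      (∀ x, x ∉ S.C → F1 x = 0) → (∀ x ∈ S.C, ∑' g, F2 (S.act g *ᵥ x) = 1) →
      ∫⁻ x, F1 x * h x * S.W x = ∑' g, ∫⁻ x, F1 x * F2 (S.act g *ᵥ x) * h x * S.W x := by
    intro F1 F2 m1 m2 z1 s2
    rw [← lintegral_tsum]
    · refine lintegral_congr fun x => ?_
      by_cases hx : x ∈ S.C
      · simp_rw [mul_assoc, ENNReal.tsum_mul_left, ENNReal.tsum_mul_right]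
        rw [s2 x hx, one_mul]
      · simp [z1 x hx]
    · intro g
      exact (((m1.mul (m2.comp (ma g))).mul mh).mul S.W_measurable).aemeasurable
  rw [key m1 m2 z1 s2, key m2 m1 z2 s1]
  let e : S.Γ × ℤ ≃ S.Γ × ℤ := ⟨S.ginv, S.ginv, S.ginv_ginv, S.ginv_ginv⟩
  rw [← e.tsum_eq (fun g => ∫⁻ x, F2 x * F1 (S.act g *ᵥ x) * h x * S.W x)]
  refine tsum_congr fun g => ?_
  show _ = ∫⁻ x, F2 x * F1 (S.act (S.ginv g) *ᵥ x) * h x * S.W x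
  rw [← S.lintegral_act g (Φ := fun x => F2 x * F1 (S.act (S.ginv g) *ᵥ x) * h x)
    ((m2.mul (m1.comp (ma _))).mul mh)]
  refine lintegral_congr fun x => ?_
  by_cases hx : x ∈ S.C
  · rw [mulVec_mulVec, act_inv, one_mulVec, hh g x hx]; ring
  · rw [mulVec_mulVec, act_inv, one_mulVec, z1 x hx]; simp

lemma measurable_indicator {β : Type*} [TopologicalSpace β] [MeasurableSpace β] [BorelSpace β]
    [Zero β] {f : (Fin n → ℝ) → β} (hf : ContinuousOn f S.C) : Measurable (S.C.indicator f) := by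
  classical
  rw [← Set.piecewise_eq_indicator]
  exact hf.measurable_piecewise continuousOn_const S.C_open.measurableSet

lemma C_iff {x : Fin n → ℝ} : x ∈ S.C ↔ 0 < S.Q x := Iff.rfl

end Setup

namespace Setup.Bumps
variable {n : ℕ} {S : Setup n} (P : Bumps S)

lemma gsum_one_pos {x : Fin n → ℝ} (hx : x ∈ S.C) : 0 < P.gsum (fun _ _ => 1) x := by
  obtain ⟨T, hT⟩ := P.exists_finset' x hx
  obtain ⟨j, γ, h⟩ := P.cov x hx
  rw [P.gsum_eq _ hT]
  simp only [mul_one]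
  refine Finset.sum_pos' (fun j _ => Finset.sum_nonneg fun γ _ => P.nonneg _ _) ⟨j, Finset.mem_univ _, ?_⟩
  refine Finset.sum_pos' (fun γ _ => P.nonneg _ _) ⟨γ, hT j γ (by simp [h]), by simp [h]⟩

/-- the unfolding function before truncation -/
noncomputable def f1 (x : Fin n → ℝ) : ℝ := (∑ j, P.φ j x) / P.gsum (fun _ _ => 1) x

lemma f1_nonneg {x : Fin n → ℝ} (hx : x ∈ S.C) : 0 ≤ P.f1 x :=
  div_nonneg (Finset.sum_nonneg fun _ _ => P.nonneg _ _) (P.gsum_one_pos hx).le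

lemma f1_tsum {x : Fin n → ℝ} (hx : x ∈ S.C) :
    ∑' γ : S.Γ, ENNReal.ofReal (P.f1 (S.m γ *ᵥ x)) = 1 := by
  obtain ⟨T, hT⟩ := P.exists_finset' x hx
  have hpos := P.gsum_one_pos hx
  have h1 : ∀ γ, P.f1 (S.m γ *ᵥ x) = (∑ j, P.φ j (S.m γ *ᵥ x)) / P.gsum (fun _ _ => 1) x := by
    intro γ; rw [f1, P.gsum_m]
  rw [tsum_eq_sum (s := T)]
  · rw [← ENNReal.ofReal_sum_of_nonneg fun γ _ => P.f1_nonneg (S.m_mem_C γ hx)]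
    simp_rw [h1]
    rw [← Finset.sum_div, Finset.sum_comm]
    have := P.gsum_eq (fun _ _ => 1) hT
    simp only [mul_one] at this
    rw [← this, div_self hpos.ne', ENNReal.ofReal_one]
  · intro γ hγ
    rw [h1, Finset.sum_eq_zero, zero_div, ENNReal.ofReal_zero]
    intro j _
    by_contra h
    exact hγ (hT j γ h)

/-- fundamental shell -/
def shell (S : Setup n) : Set (Fin n → ℝ) := {x | 1 ≤ S.Q x ∧ S.Q x < 4}

lemma shell_C : shell S ⊆ S.C := fun x hx => lt_of_lt_of_le one_pos hx.1

/-- the unfolding function -/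
noncomputable def F (x : Fin n → ℝ) : ENNReal :=
  (shell S).indicator (fun x => ENNReal.ofReal (P.f1 x)) x

lemma F_measurable : Measurable P.F := by
  have hs : MeasurableSet (shell S) :=
    (measurableSet_le measurable_const S.Q_continuous.measurable).inter
      (measurableSet_lt S.Q_continuous.measurable measurable_const)
  have : P.F = (shell S).indicator (S.C.indicator fun x => ENNReal.ofReal (P.f1 x)) := by
    rw [Set.indicator_indicator, Set.inter_eq_left.2 shell_C]; rfl
  rw [this]
  refine Measurable.indicator (S.measurable_indicator ?_) hs
  refine ENNReal.continuous_ofReal.comp_continuousOn ?_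
  intro x hx
  refine ContinuousAt.continuousWithinAt ?_
  unfold f1
  refine ContinuousAt.div ?_ (P.gsum_contDiffAt _ hx).continuousAt (P.gsum_one_pos hx).ne'
  exact tendsto_finsetSum _ fun j _ => (P.smooth j x hx).continuousAt

lemma F_zero {x : Fin n → ℝ} (hx : x ∉ S.C) : P.F x = 0 :=
  Set.indicator_of_notMem (fun h => hx (shell_C h)) _

lemma F_tsum {x : Fin n → ℝ} (hx : x ∈ S.C) : ∑' g, P.F (S.act g *ᵥ x) = 1 := by
  have hQ : 0 < S.Q x := hx
  obtain ⟨k, hk1, hk2⟩ := exists_mem_Ico_zpow hQ (by norm_num : (1 : ℝ) < 4)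
  have h4 : ∀ k : ℤ, ((2 : ℝ) ^ k) ^ 2 = 4 ^ k := by
    intro k
    rw [← zpow_natCast, ← _root_.zpow_mul, mul_comm, _root_.zpow_mul]; norm_num
  have hshell : ∀ γ : S.Γ, ∀ l : ℤ, S.act (γ, l) *ᵥ x ∈ shell S ↔ l = -k := by
    intro γ l
    simp only [shell, Set.mem_ofPred_eq, S.Q_act, h4]
    have hl : (0 : ℝ) < 4 ^ l := by positivity
    constructor
    · rintro ⟨h1, h2⟩
      have e1 : (4 : ℝ) ^ (0 : ℤ) < 4 ^ (l + (k + 1)) := by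
        rw [zpow_add₀ (by norm_num)]
        simp only [zpow_zero]
        exact lt_of_le_of_lt h1 (by gcongr)
      have e2 : (4 : ℝ) ^ (l + k) < 4 ^ (1 : ℤ) := by
        rw [zpow_add₀ (by norm_num)]
        simp only [zpow_one]
        exact lt_of_le_of_lt (by gcongr) h2
      rw [zpow_lt_zpow_iff_right₀ (by norm_num)] at e1 e2
      omega
    · rintro rfl
      rw [_root_.zpow_neg]
      have h4k : (0 : ℝ) < 4 ^ k := by positivity
      rw [inv_mul_eq_div, one_le_div h4k, div_lt_iff₀ h4k]
      refine ⟨hk1, ?_⟩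
      rwa [zpow_add₀ (by norm_num), zpow_one, mul_comm] at hk2
  rw [ENNReal.tsum_prod (f := fun γ l => P.F (S.act (γ, l) *ᵥ x))]
  rw [← P.f1_tsum hx]
  refine tsum_congr fun γ => ?_
  rw [tsum_eq_single (-k)]
  · rw [F, Set.indicator_of_mem ((hshell γ _).2 rfl), act_mulVec]
    have h2 : (0 : ℝ) < 2 ^ (-k) := by positivity
    simp only [f1, P.hom _ _ h2, P.gsum_smul _ _ h2]
  · intro l hl
    exact Set.indicator_of_notMem (fun h => hl ((hshell γ l).1 h)) _

lemma F_le_one (x : Fin n → ℝ) : P.F x ≤ 1 := by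
  by_cases hx : x ∈ S.C
  · rw [← P.F_tsum hx]
    have := ENNReal.le_tsum (f := fun g => P.F (S.act g *ᵥ x)) (1, 0)
    simpa [act, S.m_one] using this
  · simp [P.F_zero hx]

/-- compact set supporting `F` -/
def K0 : Set (Fin n → ℝ) := (fun z : ℝ × (Fin n → ℝ) => z.1 • z.2) '' (Set.Icc 1 2 ×ˢ P.L)

lemma K0_compact : IsCompact P.K0 :=
  (isCompact_Icc.prod P.hL).image (by fun_prop)

lemma K0_C : P.K0 ⊆ S.C := by
  rintro _ ⟨⟨c, y⟩, ⟨hc, hy⟩, rfl⟩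
  exact S.smul_mem_C (lt_of_lt_of_le one_pos hc.1) (S.X_subset_C (P.hLX hy))

lemma F_supp {x : Fin n → ℝ} (hx : P.F x ≠ 0) : x ∈ P.K0 := by
  have hs : x ∈ shell S := Set.mem_of_indicator_ne_zero hx
  rw [F, Set.indicator_of_mem hs] at hx
  have hC := shell_C hs
  obtain ⟨j, hj⟩ : ∃ j, P.φ j x ≠ 0 := by
    by_contra! h
    apply hx
    simp [f1, h]
  refine ⟨(Real.sqrt (S.Q x), S.nrm x), ⟨⟨?_, ?_⟩, P.supp j x hC hj⟩, S.smul_nrm hC⟩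
  · exact Real.one_le_sqrt.2 hs.1
  · rw [show (2 : ℝ) = Real.sqrt 4 by rw [show (4:ℝ) = 2^2 by norm_num]; simp]
    exact Real.sqrt_le_sqrt hs.2.le

end Setup.Bumps
end Kulk
end

section
open Matrix Filter Topology MeasureTheory

namespace Kulk

lemma det_pos_of_small (n : ℕ) : ∃ ε > 0, ∀ E : Matrix (Fin n) (Fin n) ℝ,
    (∀ i j, |E i j| ≤ ε) → 0 < (1 + E).det := by
  have hc : Continuous fun E : Fin n → Fin n → ℝ => (1 + Matrix.of E).det := by
    apply Continuous.matrix_det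
    exact continuous_const.add continuous_id
  have h0 : (0 : ℝ) < (fun E : Fin n → Fin n → ℝ => (1 + Matrix.of E).det) 0 := by
    simp
  have := hc.continuousAt.eventually (lt_mem_nhds h0)
  obtain ⟨ε, hε, h⟩ := Metric.eventually_nhds_iff.1 this
  refine ⟨ε / 2, by positivity, fun E hE => ?_⟩
  have h' := h (y := fun i j => E i j)
  refine h' ?_
  rw [dist_zero_right]
  refine lt_of_le_of_lt ?_ (half_lt_self hε)
  rw [pi_norm_le_iff_of_nonneg (by positivity)]
  intro i
  rw [pi_norm_le_iff_of_nonneg (by positivity)]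
  exact fun j => hE i j

namespace Setup
variable {n : ℕ} {S : Setup n}

lemma IsField.act {s : (Fin n → ℝ) → (Fin n → ℝ)} (h : S.IsField s) (g : S.Γ × ℤ)
    {x : Fin n → ℝ} (hx : x ∈ S.C) : s (S.act g *ᵥ x) = S.act g *ᵥ s x := by
  rw [act_mulVec, act_mulVec, h.hom _ (by positivity) _ (S.m_mem_C _ hx), h.equi _ _ hx]

lemma IsField.jac_act {s : (Fin n → ℝ) → (Fin n → ℝ)} (h : S.IsField s) (g : S.Γ × ℤ)
    {x : Fin n → ℝ} (hx : x ∈ S.C) : jac s (S.act g *ᵥ x) * S.act g = S.act g * jac s x := by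
  have h1 : HasFDerivAt (fun y => s (S.act g *ᵥ y))
      ((mclm (jac s (S.act g *ᵥ x))).comp (mclm (S.act g))) x :=
    HasFDerivAt.comp (f := fun y => S.act g *ᵥ y) x
      (hasFDerivAt_jac (h.smooth _ (S.act_mem_C g hx))) (mclm (S.act g)).hasFDerivAt
  have h2 : HasFDerivAt (fun y => S.act g *ᵥ s y) ((mclm (S.act g)).comp (mclm (jac s x))) x :=
    (mclm (S.act g)).hasFDerivAt.comp x (hasFDerivAt_jac (h.smooth _ hx))
  have e : (fun y => s (S.act g *ᵥ y)) =ᶠ[𝓝 x] fun y => S.act g *ᵥ s y := by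
    filter_upwards [S.C_open.mem_nhds hx] with y hy using h.act g hy
  have h3 := h1.unique (h2.congr_of_eventuallyEq e)
  have h4 := fun v => congrArg (fun L : (Fin n → ℝ) →L[ℝ] (Fin n → ℝ) => L v) h3
  simp only [ContinuousLinearMap.comp_apply, mclm_apply, mulVec_mulVec] at h4
  exact Matrix.mulVec_injective (funext h4)

lemma IsField.det_act {s : (Fin n → ℝ) → (Fin n → ℝ)} (h : S.IsField s) (g : S.Γ × ℤ)
    {x : Fin n → ℝ} (hx : x ∈ S.C) : (1 + jac s (S.act g *ᵥ x)).det = (1 + jac s x).det := by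
  have e : 1 + jac s (S.act g *ᵥ x) = S.act g * (1 + jac s x) * S.act (S.ginv g) := by
    rw [mul_add, mul_one, add_mul, ← h.jac_act g hx, mul_assoc, act_inv', mul_one]
  rw [e, det_mul, det_mul, mul_comm, ← mul_assoc, ← det_mul, act_inv, det_one, one_mul]

/-- integrand of the Milnor identity -/
noncomputable def mil (S : Setup n) (s : (Fin n → ℝ) → (Fin n → ℝ)) (x : Fin n → ℝ) : ℝ :=
  Real.sqrt (S.Q x / S.Q (x + s x)) ^ n * |(1 + jac s x).det|

lemma IsField.mil_act {s : (Fin n → ℝ) → (Fin n → ℝ)} (h : S.IsField s) (g : S.Γ × ℤ)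
    {x : Fin n → ℝ} (hx : x ∈ S.C) : S.mil s (S.act g *ᵥ x) = S.mil s x := by
  rw [mil, mil, h.det_act g hx, h.act g hx, ← mulVec_add, Q_act, Q_act,
    mul_div_mul_left _ _ (by positivity)]

lemma IsField.continuousOn_det {s : (Fin n → ℝ) → (Fin n → ℝ)} (h : S.IsField s) :
    ContinuousOn (fun x => (1 + jac s x).det) S.C := by
  intro x hx
  refine ContinuousAt.continuousWithinAt ?_
  have : ContinuousAt (fun x => jac s x) x := by
    refine continuousAt_pi.2 fun i => continuousAt_pi.2 fun j => continuousAt_jac (h.smooth x hx) i j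
  exact (Continuous.matrix_det continuous_id).continuousAt.comp (continuousAt_const.add this)

lemma IsField.continuousOn {s : (Fin n → ℝ) → (Fin n → ℝ)} (h : S.IsField s) :
    ContinuousOn s S.C := fun x hx => (h.smooth x hx).continuousAt.continuousWithinAt

lemma IsField.continuousOn_mil {s : (Fin n → ℝ) → (Fin n → ℝ)} (h : S.IsField s)
    (hC : ∀ x ∈ S.C, x + s x ∈ S.C) : ContinuousOn (S.mil s) S.C := by
  unfold mil
  refine ContinuousOn.mul (ContinuousOn.pow (ContinuousOn.sqrt ?_) _) h.continuousOn_det.abs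
  refine S.Q_continuous.continuousOn.div
    (S.Q_continuous.comp_continuousOn (continuousOn_id.add h.continuousOn)) fun x hx => ?_
  exact (S.C_iff.1 (hC x hx)).ne'

lemma milnor_lintegral (P : Bumps S) {s : (Fin n → ℝ) → (Fin n → ℝ)} (h : S.IsField s)
    (hinj : Set.InjOn (fun x => x + s x) S.C) (himg : (fun x => x + s x) '' S.C = S.C) :
    ∫⁻ x, P.F x * S.C.indicator (fun x => ENNReal.ofReal (S.mil s x)) x * S.W x
      = ∫⁻ x, P.F x * S.W x := by
  set H : (Fin n → ℝ) → (Fin n → ℝ) := fun x => x + s x with hH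
  have hHC : ∀ x ∈ S.C, H x ∈ S.C := fun x hx => by rw [← himg]; exact ⟨x, hx, rfl⟩
  have hF0 : P.F 0 = 0 := P.F_zero (by simp [C_iff, Q])
  have mF2 : Measurable (fun x => P.F (S.C.indicator H x)) :=
    P.F_measurable.comp (S.measurable_indicator (continuousOn_id.add h.continuousOn))
  have mh : Measurable (S.C.indicator fun x => ENNReal.ofReal (S.mil s x)) :=
    S.measurable_indicator (ENNReal.continuous_ofReal.comp_continuousOn (h.continuousOn_mil hHC))
  rw [S.unfold_eq P.F_measurable mF2 mh (fun x hx => P.F_zero hx)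
    (fun x hx => by simp [hx, hF0]) (fun x hx => P.F_tsum hx) ?_ ?_]
  · have h1 : ∫⁻ x, P.F x * S.W x = ∫⁻ x in S.C, P.F x * S.W x := by
      rw [← lintegral_indicator S.C_open.measurableSet]
      refine lintegral_congr fun x => ?_
      by_cases hx : x ∈ S.C
      · simp [hx]
      · simp [hx, P.F_zero hx]
    have h2 := lintegral_image_eq_lintegral_abs_det_fderiv_mul volume S.C_open.measurableSet
      (f := H) (f' := fun x => mclm (1 + jac s x)) (fun x hx => by
        refine HasFDerivAt.hasFDerivWithinAt ?_
        have hid : HasFDerivAt (fun y : Fin n → ℝ => y) (ContinuousLinearMap.id ℝ _) x :=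
          hasFDerivAt_id x
        have := hid.add (hasFDerivAt_jac (h.smooth x hx))
        have e : mclm (1 + jac s x) = ContinuousLinearMap.id ℝ _ + mclm (jac s x) := by
          refine ContinuousLinearMap.ext fun v => ?_
          simp [add_mulVec]
        rw [e]
        exact this) hinj (fun x => P.F x * S.W x)
    rw [himg] at h2
    rw [h1, h2, ← lintegral_indicator S.C_open.measurableSet]
    refine lintegral_congr fun x => ?_
    by_cases hx : x ∈ S.C
    · simp only [Set.indicator_of_mem hx, mclm_det]
      have hQ : 0 < S.Q x := hx
      have hQ' : 0 < S.Q (H x) := hHC x hx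
      have hsq := Real.sqrt_pos.2 hQ
      have e : ENNReal.ofReal (S.mil s x) * S.W x
          = ENNReal.ofReal |(1 + jac s x).det| * S.W (H x) := by
        rw [W, W, ← ENNReal.ofReal_mul (by unfold mil; positivity),
          ← ENNReal.ofReal_mul (abs_nonneg _)]
        congr 1
        rw [mil, Real.sqrt_div hQ.le, mul_right_comm, ← mul_pow, div_mul_eq_mul_div,
          mul_inv_cancel₀ hsq.ne', one_div]
        exact mul_comm _ _
      rw [mul_assoc, e]; ring
    · simp [hx]
  · intro x hx
    have : ∀ g, S.C.indicator H (S.act g *ᵥ x) = S.act g *ᵥ H x := by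
      intro g
      rw [Set.indicator_of_mem (S.act_mem_C g hx)]
      simp only [hH, h.act g hx, mulVec_add]
    simp_rw [this]
    exact P.F_tsum (hHC x hx)
  · intro g x hx
    rw [Set.indicator_of_mem (S.act_mem_C g hx), Set.indicator_of_mem hx, h.mil_act g hx]

lemma W_bound {K : Set (Fin n → ℝ)} (hK : IsCompact K) (hKC : K ⊆ S.C) :
    ∃ c : ENNReal, c ≠ ⊤ ∧ ∀ x ∈ K, S.W x ≤ c := by
  have hc : ContinuousOn (fun x => (Real.sqrt (S.Q x))⁻¹ ^ n) K := by
    refine ContinuousOn.pow (ContinuousOn.inv₀ S.Q_continuous.continuousOn.sqrt fun x hx => ?_) _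
    exact (Real.sqrt_pos.2 (hKC hx)).ne'
  obtain ⟨b, hb⟩ := (hK.image_of_continuousOn hc).bddAbove
  exact ⟨ENNReal.ofReal b, ENNReal.ofReal_ne_top, fun x hx =>
    ENNReal.ofReal_le_ofReal (hb ⟨x, hx, rfl⟩)⟩

theorem milnor (P : Bumps S) : ∃ (ν : Measure (Fin n → ℝ)) (c : ENNReal), c ≠ ⊤ ∧
    IsFiniteMeasure ν ∧ ν Set.univ ≠ 0 ∧ (∀ᵐ x ∂ν, x ∈ P.K0) ∧ ν ≤ c • volume ∧
    ∃ ε > 0, ∃ K1 : Set (Fin n → ℝ), IsCompact K1 ∧ K1 ⊆ S.C ∧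
      ∀ s, S.IsField s → (∀ x ∈ K1, ‖s x‖ ≤ ε ∧ ∀ i j, |jac s x i j| ≤ ε) →
        (∀ x ∈ S.C, 0 < S.Q (x + s x)) ∧
        ∫ x, Real.sqrt (S.Q x / S.Q (x + s x)) ^ n * (1 + jac s x).det ∂ν = ν.real Set.univ := by
  obtain ⟨c, hc, hcW⟩ := W_bound P.K0_compact P.K0_C
  have mFW : Measurable (fun x => P.F x * S.W x) := P.F_measurable.mul S.W_measurable
  have hFW : ∀ x, P.F x * S.W x ≤ P.K0.indicator (fun _ => c) x := by
    intro x
    by_cases h : P.F x = 0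
    · simp [h]
    · rw [Set.indicator_of_mem (P.F_supp h)]
      calc _ ≤ 1 * c := mul_le_mul' (P.F_le_one x) (hcW x (P.F_supp h))
        _ = c := one_mul _
  set ν := (volume : Measure (Fin n → ℝ)).withDensity (fun x => P.F x * S.W x) with hν
  have hfin : IsFiniteMeasure ν := by
    refine isFiniteMeasure_withDensity ?_
    refine ne_top_of_le_ne_top ?_ (lintegral_mono hFW)
    rw [lintegral_indicator P.K0_compact.measurableSet, lintegral_const, Measure.restrict_apply_univ]
    exact ENNReal.mul_ne_top hc P.K0_compact.measure_lt_top.ne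
  have hae : ∀ᵐ x ∂ν, x ∈ P.K0 := by
    rw [hν, ae_withDensity_iff mFW]
    exact Eventually.of_forall fun x hx => P.F_supp (left_ne_zero_of_mul hx)
  obtain ⟨ε1, hε1, K', hK'c, hK'C, hbij⟩ := S.field_small_bij
  obtain ⟨ε2, hε2, hdet⟩ := det_pos_of_small n
  refine ⟨ν, c, hc, hfin, ?_, hae, ?_, min ε1 ε2, by positivity, K' ∪ P.K0,
    hK'c.union P.K0_compact, Set.union_subset hK'C P.K0_C, ?_⟩
  · intro h0
    rw [hν, withDensity_apply _ MeasurableSet.univ, Measure.restrict_univ,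
      lintegral_eq_zero_iff mFW] at h0
    have hall : ∀ g, ∫⁻ x, P.F (S.act g *ᵥ x) * S.W x = 0 := by
      intro g
      rw [S.lintegral_act g P.F_measurable, lintegral_eq_zero_iff mFW]; exact h0
    have : ∫⁻ x in S.C, S.W x = 0 := by
      have : ∫⁻ x in S.C, S.W x = ∫⁻ x, ∑' g, P.F (S.act g *ᵥ x) * S.W x := by
        rw [← lintegral_indicator S.C_open.measurableSet]
        refine lintegral_congr fun x => ?_
        rw [ENNReal.tsum_mul_right]
        by_cases hx : x ∈ S.C
        · rw [Set.indicator_of_mem hx, P.F_tsum hx, one_mul]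
        · have : ∀ g, P.F (S.act g *ᵥ x) = 0 := fun g =>
            P.F_zero (by rwa [S.act_mem_C_iff g])
          simp [hx, this]
      have := S.countableΓ
      rw [‹∫⁻ x in S.C, S.W x = _›, lintegral_tsum]
      · simp [hall]
      · intro g
        exact ((P.F_measurable.comp (by fun_prop : Measurable fun x : Fin n → ℝ =>
          S.act g *ᵥ x)).mul S.W_measurable).aemeasurable
    rw [setLIntegral_eq_zero_iff S.C_open.measurableSet S.W_measurable] at this
    have hx0 : S.x₀ ∈ S.C := by
      show 0 < S.Q S.x₀
      rw [Q, S.hx₀]; exact one_pos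
    have hpos := S.C_open.measure_pos volume ⟨_, hx0⟩
    have h2 : volume S.C = 0 := by
      refine measure_mono_null ?_ this
      intro x hx
      simp only [Set.mem_compl_iff, Set.mem_ofPred_eq]
      intro hh
      have := hh hx
      have hq : 0 < Real.sqrt (S.Q x) := Real.sqrt_pos.2 hx
      rw [W, ENNReal.ofReal_eq_zero] at this
      have : 0 < (Real.sqrt (S.Q x))⁻¹ ^ n := by positivity
      linarith
    exact hpos.ne' h2
  · rw [hν, ← withDensity_const]
    refine withDensity_mono (Eventually.of_forall fun x => (hFW x).trans ?_)
    exact Set.indicator_le_self' (fun _ _ => zero_le) x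
  · intro s hs hsm
    obtain ⟨hinj, himg⟩ := hbij s hs fun x hx =>
      ⟨(hsm x (Or.inl hx)).1.trans (min_le_left _ _), fun i j =>
        ((hsm x (Or.inl hx)).2 i j).trans (min_le_left _ _)⟩
    have hHC : ∀ x ∈ S.C, x + s x ∈ S.C := fun x hx => by
      have : (fun x => x + s x) x ∈ (fun x => x + s x) '' S.C := ⟨x, hx, rfl⟩
      rwa [himg] at this
    refine ⟨hHC, ?_⟩
    have mh : Measurable (S.C.indicator fun x => ENNReal.ofReal (S.mil s x)) :=
      S.measurable_indicator (ENNReal.continuous_ofReal.comp_continuousOn (hs.continuousOn_mil hHC))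
    have e1 : ∫ x, Real.sqrt (S.Q x / S.Q (x + s x)) ^ n * (1 + jac s x).det ∂ν
        = ∫ x, (S.C.indicator (fun x => ENNReal.ofReal (S.mil s x)) x).toReal ∂ν := by
      refine integral_congr_ae ?_
      filter_upwards [hae] with x hx
      have hd := hdet (jac s x) fun i j => ((hsm x (Or.inr hx)).2 i j).trans (min_le_right _ _)
      rw [Set.indicator_of_mem (P.K0_C hx), ENNReal.toReal_ofReal (by unfold mil; positivity), mil,
        abs_of_pos hd]
    rw [e1, integral_toReal mh.aemeasurable]
    · rw [hν, lintegral_withDensity_eq_lintegral_mul _ mFW mh, Measure.real,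
        withDensity_apply _ MeasurableSet.univ, Measure.restrict_univ, ← milnor_lintegral P hs hinj himg]
      congr 1
      refine lintegral_congr fun x => ?_
      simp only [Pi.mul_apply]; ring
    · filter_upwards [hae] with x hx
      rw [Set.indicator_of_mem (P.K0_C hx)]
      exact ENNReal.ofReal_lt_top

end Setup
end Kulk
end

section
open Matrix Filter Topology MeasureTheory

namespace Kulk

lemma holo_integral {Ω : Type*} [MeasurableSpace Ω] {ν : Measure Ω} [IsFiniteMeasure ν]
    {F : ℂ → Ω → ℂ} {U : Set ℂ} (hmeas : ∀ z ∈ U, AEStronglyMeasurable (F z) ν)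
    (hd : ∀ᵐ x ∂ν, DifferentiableOn ℂ (fun z => F z x) U)
    (hb : ∀ z₀ ∈ U, ∃ r > 0, Metric.closedBall z₀ r ⊆ U ∧ ∃ B : ℝ, ∀ᵐ x ∂ν,
      ∀ z ∈ Metric.closedBall z₀ r, ‖F z x‖ ≤ B) :
    DifferentiableOn ℂ (fun z => ∫ x, F z x ∂ν) U := by
  intro z₀ hz₀
  obtain ⟨r, hr, hrU, B, hB⟩ := hb z₀ hz₀
  have hUn : U ∈ 𝓝 z₀ := mem_of_superset (Metric.closedBall_mem_nhds z₀ hr) hrU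
  have hder : ∀ᵐ x ∂ν, ∀ z ∈ Metric.ball z₀ r, HasDerivAt (fun z => F z x) (deriv (fun z => F z x) z) z := by
    filter_upwards [hd] with x hx z hz
    refine (hx.differentiableAt ?_).hasDerivAt
    exact mem_of_superset (Metric.isOpen_ball.mem_nhds hz) (Metric.ball_subset_closedBall.trans hrU)
  have hF' : AEStronglyMeasurable (fun x => deriv (fun z => F z x) z₀) ν := by
    have hseq : Tendsto (fun k : ℕ => ((r / (k + 1) : ℝ) : ℂ)) atTop (𝓝[≠] 0) := by
      rw [tendsto_nhdsWithin_iff]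
      constructor
      · rw [show (0 : ℂ) = ((0 : ℝ) : ℂ) by simp]
        refine (Complex.continuous_ofReal.tendsto 0).comp ?_
        have := (tendsto_one_div_add_atTop_nhds_zero_nat (𝕜 := ℝ)).const_mul r
        simpa [div_eq_mul_inv] using this
      · refine Eventually.of_forall fun k => ?_
        simp only [Set.mem_compl_iff, Set.mem_singleton_iff, Complex.ofReal_eq_zero]
        positivity
    refine aestronglyMeasurable_of_tendsto_ae atTop (f := fun (k : ℕ) x =>
      (((r / (k + 1) : ℝ) : ℂ))⁻¹ • (F (z₀ + ((r / (k + 1) : ℝ) : ℂ)) x - F z₀ x)) ?_ ?_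
    · intro k
      have h1 : z₀ + ((r / (k + 1) : ℝ) : ℂ) ∈ U := by
        apply hrU
        rw [mem_closedBall_iff_norm, add_sub_cancel_left, Complex.norm_real,
          Real.norm_of_nonneg (by positivity)]
        apply div_le_self hr.le
        have : (0 : ℝ) ≤ k := by positivity
        linarith
      exact ((hmeas _ h1).sub (hmeas _ hz₀)).const_smul (((r / (k + 1) : ℝ) : ℂ))⁻¹
    · filter_upwards [hder] with x hx
      have := (hasDerivAt_iff_tendsto_slope_zero.1 (hx z₀ (Metric.mem_ball_self hr)))
      exact this.comp hseq
  have hbound : ∀ᵐ x ∂ν, ∀ z ∈ Metric.ball z₀ (r / 2), ‖deriv (fun z => F z x) z‖ ≤ B / (r / 2) := by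
    filter_upwards [hd, hB] with x hx hBx z hz
    have hsub : Metric.closedBall z (r / 2) ⊆ Metric.closedBall z₀ r := by
      refine Metric.closedBall_subset_closedBall' ?_
      have := Metric.mem_ball.1 hz; linarith
    refine Complex.norm_deriv_le_of_forall_mem_sphere_norm_le (by positivity) ?_ ?_
    · refine DifferentiableOn.diffContOnCl ?_
      refine hx.mono ?_
      exact (Metric.closure_ball_subset_closedBall.trans hsub).trans hrU
    · intro w hw
      exact hBx w (hsub (Metric.sphere_subset_closedBall hw))
  have := hasDerivAt_integral_of_dominated_loc_of_deriv_le (μ := ν) (F := F)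
    (F' := fun z x => deriv (fun z => F z x) z) (x₀ := z₀) (s := Metric.ball z₀ (r / 2))
    (bound := fun _ => B / (r / 2)) (Metric.ball_mem_nhds _ (by positivity))
    (by filter_upwards [hUn] with z hz using hmeas z hz)
    (by
      refine Integrable.of_bound (hmeas z₀ hz₀) B ?_
      filter_upwards [hB] with x hx using hx _ (Metric.mem_closedBall_self hr.le))
    hF' hbound (integrable_const _) (by
      filter_upwards [hder] with x hx z hz
      exact hx z (Metric.ball_subset_ball (by linarith) hz))
  exact this.2.differentiableAt.differentiableWithinAt

lemma sqrt_pow_eq_cpow (n : ℕ) {w : ℝ} (hw : 0 < w) :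
    ((Real.sqrt (1 / w) ^ n : ℝ) : ℂ) = (w : ℂ) ^ (((-(n : ℝ) / 2 : ℝ)) : ℂ) := by
  rw [← Complex.ofReal_cpow hw.le]
  congr 1
  rw [Real.sqrt_eq_rpow, one_div, Real.inv_rpow hw.le, ← Real.rpow_neg hw.le, ← Real.rpow_natCast,
    ← Real.rpow_mul hw.le]
  congr 1
  ring

lemma continuation {Ω : Type*} [MeasurableSpace Ω] {ν : Measure Ω} [IsFiniteMeasure ν] {n : ℕ}
    {a c : Ω → ℝ} {M N : Ω → Matrix (Fin n) (Fin n) ℂ} (ma : AEMeasurable a ν)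
    (mc : AEMeasurable c ν) (mM : ∀ i j, AEMeasurable (fun x => M x i j) ν)
    (mN : ∀ i j, AEMeasurable (fun x => N x i j) ν) {A : ℝ} (hA : 0 < A)
    (ha : ∀ᵐ x ∂ν, 0 ≤ a x ∧ a x ≤ A) (hc : ∀ᵐ x ∂ν, 1 ≤ c x)
    (hM : ∀ᵐ x ∂ν, ∀ i j, ‖M x i j‖ ≤ A) (hN : ∀ᵐ x ∂ν, ∀ i j, ‖N x i j‖ ≤ A)
    {w : ℂ} (hw : w ≠ 0) {C0 : ℂ} {ρ : ℝ} (hρ : 0 < ρ)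
    (h : ∀ t : ℝ, |t| ≤ ρ → ∫ x, ((c x : ℂ) + (w * t) ^ 2 * a x) ^ (((-(n : ℝ) / 2 : ℝ)) : ℂ) *
      (M x + (w * t) • N x).det ∂ν = C0) (T : ℝ) :
    ∫ x, ((c x : ℂ) + (T : ℂ) ^ 2 * a x) ^ (((-(n : ℝ) / 2 : ℝ)) : ℂ) *
      (M x + (T : ℂ) • N x).det ∂ν = C0 := by
  set e : ℂ := (((-(n : ℝ) / 2 : ℝ)) : ℂ) with he
  obtain ⟨r, hr, hrA⟩ : ∃ r : ℝ, 0 < r ∧ r ^ 2 * A ≤ 1 / 2 := by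
    refine ⟨Real.sqrt (1 / (2 * A)), Real.sqrt_pos.2 (by positivity), ?_⟩
    rw [Real.sq_sqrt (by positivity)]
    field_simp
    exact le_refl _
  set U : Set ℂ := {z | |z.im| < r} with hU
  have hUo : IsOpen U := isOpen_lt (by fun_prop) continuous_const
  have hUc : IsPreconnected U := by
    have : U = Complex.imCLM ⁻¹' Set.Ioo (-r) r := by
      ext z; simp [hU, abs_lt]
    rw [this]
    exact ((convex_Ioo (-r) r).is_linear_preimage
      (Complex.imLm.isLinear)).isPreconnected
  set F : ℂ → Ω → ℂ := fun z x => ((c x : ℂ) + z ^ 2 * a x) ^ e * (M x + z • N x).det with hF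
  have hre : ∀ᵐ x ∂ν, ∀ z ∈ U, 1 / 2 ≤ ((c x : ℂ) + z ^ 2 * a x).re := by
    filter_upwards [ha, hc] with x hax hcx z hz
    have hz : |z.im| < r := hz
    have h1 : z.im ^ 2 ≤ r ^ 2 := sq_le_sq' (by have := abs_lt.1 hz; linarith) (abs_lt.1 hz).2.le
    have h2 : z.im ^ 2 * a x ≤ 1 / 2 := (mul_le_mul h1 hax.2 hax.1 (by positivity)).trans hrA
    have h3 : 0 ≤ z.re ^ 2 * a x := mul_nonneg (sq_nonneg _) hax.1
    simp only [Complex.add_re, Complex.ofReal_re, Complex.mul_re, pow_two, Complex.ofReal_im]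
    nlinarith
  have hol : DifferentiableOn ℂ (fun z => ∫ x, F z x ∂ν) U := by
    refine holo_integral ?_ ?_ ?_
    · intro z hz
      refine AEMeasurable.aestronglyMeasurable ?_
      refine AEMeasurable.mul (AEMeasurable.pow_const ?_ _) ?_
      · exact (Complex.measurable_ofReal.comp_aemeasurable mc).add
          ((Complex.measurable_ofReal.comp_aemeasurable ma).const_mul _)
      · simp only [det_apply', Matrix.add_apply, Matrix.smul_apply, smul_eq_mul]
        refine Finset.aemeasurable_fun_sum _ fun σ _ => AEMeasurable.const_mul ?_ _
        exact Finset.aemeasurable_fun_prod _ fun i _ => (mM _ _).add ((mN _ _).const_mul _)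
    · filter_upwards [hre] with x hx
      refine DifferentiableOn.mul ?_ ?_
      · intro z hz
        refine DifferentiableAt.differentiableWithinAt ?_
        refine DifferentiableAt.cpow_const (by fun_prop) ?_
        exact Or.inl (lt_of_lt_of_le (by norm_num) (hx z hz))
      · simp only [det_apply', Matrix.add_apply, Matrix.smul_apply, smul_eq_mul]
        fun_prop
    · intro z₀ hz₀
      obtain ⟨r', hr', hsub⟩ := Metric.nhds_basis_closedBall.mem_iff.1 (hUo.mem_nhds hz₀)
      refine ⟨r', hr', hsub, (1 / 2 : ℝ) ^ (-(n : ℝ) / 2) *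
        ((Fintype.card (Fin n)).factorial • (A + (‖z₀‖ + r') * A) ^ Fintype.card (Fin n)), ?_⟩
      filter_upwards [hre, hM, hN] with x hx hMx hNx z hz
      rw [hF]
      simp only [norm_mul]
      have hzn : ‖z‖ ≤ ‖z₀‖ + r' := by
        have := mem_closedBall_iff_norm.1 hz
        calc ‖z‖ = ‖z₀ + (z - z₀)‖ := by ring_nf
          _ ≤ _ := (norm_add_le _ _).trans (by linarith)
      refine mul_le_mul ?_ ?_ (norm_nonneg _) (by positivity)
      · rw [he, Complex.norm_cpow_real]
        refine Real.rpow_le_rpow_of_nonpos (by norm_num) ((hx z (hsub hz)).trans (Complex.re_le_norm _)) ?_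
        have : (0 : ℝ) ≤ n := by positivity
        linarith
      · refine Matrix.det_le (abv := NormedField.toAbsoluteValue ℂ) fun i j => ?_
        have hh : NormedField.toAbsoluteValue ℂ ((M x + z • N x) i j) = ‖(M x + z • N x) i j‖ := rfl
        rw [hh]
        rw [Matrix.add_apply, Matrix.smul_apply, smul_eq_mul]
        refine (norm_add_le _ _).trans (add_le_add (hMx i j) ?_)
        rw [norm_mul]
        exact mul_le_mul hzn (hNx i j) (norm_nonneg _) (by positivity)
  have han : AnalyticOnNhd ℂ (fun z => ∫ x, F z x ∂ν) U := hol.analyticOnNhd hUo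
  have h0 : (0 : ℂ) ∈ U := by simp [hU, hr]
  have hfreq : ∃ᶠ z in 𝓝[≠] (0 : ℂ), (fun z => ∫ x, F z x ∂ν) z = (fun _ => C0) z := by
    have hseq : Tendsto (fun k : ℕ => w * ((ρ / (k + 1) : ℝ) : ℂ)) atTop (𝓝[≠] 0) := by
      rw [tendsto_nhdsWithin_iff]
      constructor
      · rw [show (0 : ℂ) = w * ((0 : ℝ) : ℂ) by simp]
        refine Tendsto.const_mul _ ?_
        refine (Complex.continuous_ofReal.tendsto 0).comp ?_
        have := (tendsto_one_div_add_atTop_nhds_zero_nat (𝕜 := ℝ)).const_mul ρ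
        simpa [div_eq_mul_inv] using this
      · refine Eventually.of_forall fun k => ?_
        simp only [Set.mem_compl_iff, Set.mem_singleton_iff, mul_eq_zero, Complex.ofReal_eq_zero,
          not_or]
        exact ⟨hw, by positivity⟩
    refine hseq.frequently (Eventually.of_forall fun k => ?_).frequently
    refine h _ ?_
    rw [abs_of_pos (by positivity)]
    apply div_le_self hρ.le
    have : (0 : ℝ) ≤ k := by positivity
    linarith
  have := han.eqOn_of_preconnected_of_frequently_eq (analyticOnNhd_const (v := C0)) hUc h0 hfreq
  exact this (show (T : ℂ) ∈ U by simp [hU, hr])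

end Kulk
end

section
open Matrix Filter Topology MeasureTheory

namespace Kulk
namespace Setup
namespace Bumps
variable {n : ℕ} {S : Setup n} (P : Bumps S)

lemma gm_symm {x : Fin n → ℝ} (hx : x ∈ S.C) : (P.gm x)ᵀ = P.gm x := by
  have := (P.gm_posDef hx).isHermitian
  rwa [IsHermitian, conjTranspose_eq_transpose_of_trivial] at this

lemma gm_sigma {x : Fin n → ℝ} (hx : x ∈ S.C) : (P.σ x)ᵀ * S.η = P.gm x := by
  have := congrArg Matrix.transpose (P.eta_sigma x)
  rwa [transpose_mul, S.hη, P.gm_symm hx] at this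

lemma B_sigma {x : Fin n → ℝ} (v w : Fin n → ℝ) :
    v ⬝ᵥ (S.η *ᵥ (P.σ x *ᵥ w)) = v ⬝ᵥ (P.gm x *ᵥ w) := by
  rw [mulVec_mulVec, P.eta_sigma]

lemma B_sigma_sigma {x : Fin n → ℝ} (hx : x ∈ S.C) (v w : Fin n → ℝ) :
    (P.σ x *ᵥ v) ⬝ᵥ (S.η *ᵥ (P.σ x *ᵥ w)) = v ⬝ᵥ (S.η *ᵥ w) := by
  rw [← vecMul_transpose, ← dotProduct_mulVec, mulVec_mulVec, P.gm_sigma hx, ← P.eta_sigma,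
    mulVec_mulVec, mul_assoc, P.sigma_sq hx, mul_one]

/-- spacelike part -/
noncomputable def sP (u : (Fin n → ℝ) → (Fin n → ℝ)) (x : Fin n → ℝ) : Fin n → ℝ :=
  (1 / 2 : ℝ) • u x + (1 / 2 : ℝ) • (P.σ x *ᵥ u x)

/-- timelike part -/
noncomputable def sW (u : (Fin n → ℝ) → (Fin n → ℝ)) (x : Fin n → ℝ) : Fin n → ℝ :=
  (1 / 2 : ℝ) • u x + (-1 / 2 : ℝ) • (P.σ x *ᵥ u x)

lemma sP_field {u : (Fin n → ℝ) → (Fin n → ℝ)} (hu : S.IsField u) : S.IsField (P.sP u) :=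
  hu.lin (P.sigma_field hu) _ _

lemma sW_field {u : (Fin n → ℝ) → (Fin n → ℝ)} (hu : S.IsField u) : S.IsField (P.sW u) :=
  hu.lin (P.sigma_field hu) _ _

lemma sigma_sP {x : Fin n → ℝ} (hx : x ∈ S.C) (u : (Fin n → ℝ) → (Fin n → ℝ)) :
    P.σ x *ᵥ P.sP u x = P.sP u x := by
  rw [sP, mulVec_add, mulVec_smul, mulVec_smul, mulVec_mulVec, P.sigma_sq hx, one_mulVec, add_comm]

lemma sigma_sW {x : Fin n → ℝ} (hx : x ∈ S.C) (u : (Fin n → ℝ) → (Fin n → ℝ)) :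
    P.σ x *ᵥ P.sW u x = - P.sW u x := by
  rw [sW, mulVec_add, mulVec_smul, mulVec_smul, mulVec_mulVec, P.sigma_sq hx, one_mulVec]
  module

lemma gm_nonneg {x : Fin n → ℝ} (hx : x ∈ S.C) (v : Fin n → ℝ) : 0 ≤ v ⬝ᵥ (P.gm x *ᵥ v) := by
  simpa using (P.gm_posDef hx).posSemidef.dotProduct_mulVec_nonneg v

lemma Q_sP_nonneg {x : Fin n → ℝ} (hx : x ∈ S.C) (u : (Fin n → ℝ) → (Fin n → ℝ)) :
    0 ≤ S.Q (P.sP u x) := by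
  have := P.B_sigma (x := x) (P.sP u x) (P.sP u x)
  rw [P.sigma_sP hx] at this
  rw [Q, this]
  exact P.gm_nonneg hx _

lemma Q_sW_nonpos {x : Fin n → ℝ} (hx : x ∈ S.C) (u : (Fin n → ℝ) → (Fin n → ℝ)) :
    S.Q (P.sW u x) ≤ 0 := by
  have := P.B_sigma (x := x) (P.sW u x) (P.sW u x)
  rw [P.sigma_sW hx, mulVec_neg, dotProduct_neg] at this
  rw [Q]
  have h2 := P.gm_nonneg hx (P.sW u x)
  linarith

lemma B_sP_sW {x : Fin n → ℝ} (hx : x ∈ S.C) (u : (Fin n → ℝ) → (Fin n → ℝ)) :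
    P.sP u x ⬝ᵥ (S.η *ᵥ P.sW u x) = 0 := by
  have := P.B_sigma_sigma hx (P.sP u x) (P.sW u x)
  rw [P.sigma_sW hx, P.sigma_sP hx, mulVec_neg, dotProduct_neg] at this
  linarith

lemma Q_sP_sub {x : Fin n → ℝ} (u : (Fin n → ℝ) → (Fin n → ℝ)) :
    S.Q (P.sP u x) - S.Q (P.sW u x) = u x ⬝ᵥ (P.gm x *ᵥ u x) := by
  have h1 := P.B_sigma (x := x) (u x) (u x)
  have h3 := S.B_symm (P.σ x *ᵥ u x) (u x)
  simp only [Q, sP, sW, mulVec_add, mulVec_smul, dotProduct_add, add_dotProduct, smul_dotProduct,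
    dotProduct_smul, smul_eq_mul, h3, h1]
  ring

/-- squared length of the field -/
noncomputable def aa (u : (Fin n → ℝ) → (Fin n → ℝ)) (x : Fin n → ℝ) : ℝ :=
  (u x ⬝ᵥ (P.gm x *ᵥ u x)) / S.Q x

/-- complexified Jacobian -/
noncomputable def AA (u : (Fin n → ℝ) → (Fin n → ℝ)) (x : Fin n → ℝ) : Matrix (Fin n) (Fin n) ℂ :=
  (jac (P.sP u) x).map Complex.ofReal + Complex.I • (jac (P.sW u) x).map Complex.ofReal

lemma _root_.Kulk.exists_bound_on {n : ℕ} {S : Setup n} {K : Set (Fin n → ℝ)} (hK : IsCompact K)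
    (hKC : K ⊆ S.C) {f : (Fin n → ℝ) → ℝ} (hf : ContinuousOn f S.C) :
    ∃ A : ℝ, 0 < A ∧ ∀ x ∈ K, |f x| ≤ A := by
  obtain ⟨A, hA⟩ := (hK.image_of_continuousOn (hf.mono hKC).abs).bddAbove
  exact ⟨max A 1, by positivity, fun x hx => (hA ⟨x, hx, rfl⟩).trans (le_max_left _ _)⟩

lemma _root_.Kulk.exists_bound_jac {n : ℕ} {S : Setup n} {K : Set (Fin n → ℝ)} (hK : IsCompact K)
    (hKC : K ⊆ S.C) {s : (Fin n → ℝ) → (Fin n → ℝ)} (hs : S.IsField s) :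
    ∃ A : ℝ, 0 < A ∧ ∀ x ∈ K, ‖s x‖ ≤ A ∧ ∀ i j, |jac s x i j| ≤ A := by
  obtain ⟨A0, hA0, h0⟩ := exists_bound_on hK hKC hs.continuousOn.norm
  have hj : ∀ i j, ContinuousOn (fun x => jac s x i j) S.C := fun i j x hx =>
    (continuousAt_jac (hs.smooth x hx) i j).continuousWithinAt
  have h1 := fun i j => exists_bound_on hK hKC (hj i j)
  choose A1 hA1 h1 using h1
  refine ⟨A0 + ∑ i, ∑ j, A1 i j, add_pos_of_pos_of_nonneg hA0
    (Finset.sum_nonneg fun i _ => Finset.sum_nonneg fun j _ => (hA1 i j).le), fun x hx => ⟨?_, ?_⟩⟩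
  · have := h0 x hx
    rw [abs_of_nonneg (norm_nonneg _)] at this
    exact this.trans (le_add_of_nonneg_right (Finset.sum_nonneg fun i _ => Finset.sum_nonneg fun j _ => (hA1 i j).le))
  · intro i j
    have e1 : A1 i j ≤ ∑ j, A1 i j :=
      Finset.single_le_sum (f := fun j => A1 i j) (fun j _ => (hA1 i j).le) (Finset.mem_univ j)
    have e2 : ∑ j, A1 i j ≤ ∑ i, ∑ j, A1 i j :=
      Finset.single_le_sum (f := fun i => ∑ j, A1 i j)
        (fun i _ => Finset.sum_nonneg fun j _ => (hA1 i j).le) (Finset.mem_univ i)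
    have := h1 i j x hx
    linarith

lemma _root_.Kulk.aemeasurable_of_C {n : ℕ} {S : Setup n} {ν : Measure (Fin n → ℝ)}
    (hν : ∀ᵐ x ∂ν, x ∈ S.C) {β : Type*} [TopologicalSpace β] [MeasurableSpace β] [BorelSpace β]
    [Zero β] {f : (Fin n → ℝ) → β} (hf : ContinuousOn f S.C) : AEMeasurable f ν := by
  refine ⟨_, S.measurable_indicator hf, ?_⟩
  filter_upwards [hν] with x hx
  rw [Set.indicator_of_mem hx]

theorem continued {ν : Measure (Fin n → ℝ)} [IsFiniteMeasure ν] (hae : ∀ᵐ x ∂ν, x ∈ P.K0)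
    {ε : ℝ} (hε : 0 < ε) {K1 : Set (Fin n → ℝ)} (hK1 : IsCompact K1) (hK1C : K1 ⊆ S.C)
    (hmil : ∀ s, S.IsField s → (∀ x ∈ K1, ‖s x‖ ≤ ε ∧ ∀ i j, |jac s x i j| ≤ ε) →
        (∀ x ∈ S.C, 0 < S.Q (x + s x)) ∧
        ∫ x, Real.sqrt (S.Q x / S.Q (x + s x)) ^ n * (1 + jac s x).det ∂ν = ν.real Set.univ)
    {u : (Fin n → ℝ) → (Fin n → ℝ)} (hu : S.IsField u) (T : ℝ) :
    ∫ x, ((1 + T ^ 2 * P.aa u x : ℝ) : ℂ) ^ (((-(n : ℝ) / 2 : ℝ)) : ℂ) *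
      (1 + (T : ℂ) • P.AA u x).det ∂ν = (ν.real Set.univ : ℂ) := by
  have hP := P.sP_field hu
  have hW := P.sW_field hu
  have hC : ∀ᵐ x ∂ν, x ∈ S.C := hae.mono fun x hx => P.K0_C hx
  set α : (Fin n → ℝ) → ℝ := fun x => S.Q (P.sP u x) / S.Q x with hα
  set δ : (Fin n → ℝ) → ℝ := fun x => - S.Q (P.sW u x) / S.Q x with hδ
  have cα : ContinuousOn α S.C := (S.Q_continuous.comp_continuousOn hP.continuousOn).div
    S.Q_continuous.continuousOn fun x hx => (S.C_iff.1 hx).ne'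
  have cδ : ContinuousOn δ S.C := (S.Q_continuous.comp_continuousOn hW.continuousOn).neg.div
    S.Q_continuous.continuousOn fun x hx => (S.C_iff.1 hx).ne'
  have hα0 : ∀ x ∈ S.C, 0 ≤ α x := fun x hx =>
    div_nonneg (P.Q_sP_nonneg hx u) (S.C_iff.1 hx).le
  have hδ0 : ∀ x ∈ S.C, 0 ≤ δ x := fun x hx =>
    div_nonneg (neg_nonneg.2 (P.Q_sW_nonpos hx u)) (S.C_iff.1 hx).le
  obtain ⟨Aα, hAα, bα⟩ := exists_bound_on P.K0_compact P.K0_C cα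
  obtain ⟨Aδ, hAδ, bδ⟩ := exists_bound_on P.K0_compact P.K0_C cδ
  obtain ⟨AP, hAP, bP⟩ := exists_bound_jac P.K0_compact P.K0_C hP
  obtain ⟨AW, hAW, bW⟩ := exists_bound_jac P.K0_compact P.K0_C hW
  obtain ⟨BP, hBP, dP⟩ := exists_bound_jac hK1 hK1C hP
  obtain ⟨BW, hBW, dW⟩ := exists_bound_jac hK1 hK1C hW
  set A1 : (Fin n → ℝ) → Matrix (Fin n) (Fin n) ℂ := fun x => (jac (P.sP u) x).map Complex.ofReal
    with hA1
  set A2 : (Fin n → ℝ) → Matrix (Fin n) (Fin n) ℂ := fun x => (jac (P.sW u) x).map Complex.ofReal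
    with hA2
  have mA1 : ∀ i j, AEMeasurable (fun x => A1 x i j) ν := fun i j =>
    Complex.measurable_ofReal.comp_aemeasurable (aemeasurable_of_C hC fun x hx =>
      (continuousAt_jac (hP.smooth x hx) i j).continuousWithinAt)
  have mA2 : ∀ i j, AEMeasurable (fun x => A2 x i j) ν := fun i j =>
    Complex.measurable_ofReal.comp_aemeasurable (aemeasurable_of_C hC fun x hx =>
      (continuousAt_jac (hW.smooth x hx) i j).continuousWithinAt)
  have mα : AEMeasurable α ν := aemeasurable_of_C hC cα
  have mδ : AEMeasurable δ ν := aemeasurable_of_C hC cδ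
  have n1 : ∀ x ∈ P.K0, ∀ i j, ‖A1 x i j‖ ≤ AP := fun x hx i j => by
    simpa [hA1] using (bP x hx).2 i j
  have n2 : ∀ x ∈ P.K0, ∀ i j, ‖A2 x i j‖ ≤ AW := fun x hx i j => by
    simpa [hA2] using (bW x hx).2 i j
  have hone : ∀ i j : Fin n, ‖(1 : Matrix (Fin n) (Fin n) ℂ) i j‖ ≤ 1 := by
    intro i j
    by_cases h : i = j <;> simp [Matrix.one_apply, h]
  set e : ℂ := (((-(n : ℝ) / 2 : ℝ)) : ℂ) with he
  -- the real identity
  set ρ := ε / (BP + BW) with hρ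
  have hρ0 : 0 < ρ := by positivity
  have real_id : ∀ t τ : ℝ, |t| ≤ ρ → |τ| ≤ ρ →
      ∫ x, ((1 + t ^ 2 * α x - τ ^ 2 * δ x : ℝ) : ℂ) ^ e *
        (1 + (t : ℂ) • A1 x + (τ : ℂ) • A2 x).det ∂ν = (ν.real Set.univ : ℂ) := by
    intro t τ ht hτ
    have small : ∀ p q : ℝ, |p| ≤ BP → |q| ≤ BW → |t * p + τ * q| ≤ ε := by
      intro p q hp hq
      calc |t * p + τ * q| ≤ |t| * |p| + |τ| * |q| := by
            rw [← abs_mul, ← abs_mul]; exact abs_add_le _ _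
        _ ≤ ρ * BP + ρ * BW := by gcongr
        _ = ε := by rw [hρ]; field_simp
    obtain ⟨hpos, hIntg⟩ := hmil _ (hP.lin hW t τ) (by
      intro x hx
      constructor
      · rw [pi_norm_le_iff_of_nonneg hε.le]
        intro i
        exact small _ _ ((norm_le_pi_norm _ i).trans (dP x hx).1)
          ((norm_le_pi_norm _ i).trans (dW x hx).1)
      · intro i j
        rw [jac_lin (hP.smooth x (hK1C hx)) (hW.smooth x (hK1C hx))]
        exact small _ _ ((dP x hx).2 i j) ((dW x hx).2 i j))
    rw [← hIntg, ← integral_complex_ofReal]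
    refine integral_congr_ae ?_
    filter_upwards [hC] with x hx
    have hQ : 0 < S.Q x := hx
    have hQ' := hpos x hx
    have eQ : S.Q (x + (t • P.sP u x + τ • P.sW u x)) = S.Q x * (1 + t ^ 2 * α x - τ ^ 2 * δ x) := by
      rw [Q_add, Q_add, Q_smul, Q_smul, mulVec_add, dotProduct_add, mulVec_smul, mulVec_smul,
        dotProduct_smul, dotProduct_smul, dotProduct_smul, smul_dotProduct,
        hP.tan x hx, hW.tan x hx, P.B_sP_sW hx, hα, hδ]
      simp only [smul_zero]
      field_simp
      ring
    rw [eQ] at hQ' ⊢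
    have hw : 0 < 1 + t ^ 2 * α x - τ ^ 2 * δ x := by
      by_contra h
      push Not at h
      nlinarith
    rw [Complex.ofReal_mul, show S.Q x / (S.Q x * (1 + t ^ 2 * α x - τ ^ 2 * δ x))
      = 1 / (1 + t ^ 2 * α x - τ ^ 2 * δ x) by field_simp, sqrt_pow_eq_cpow n hw]
    congr 1
    rw [jac_lin (hP.smooth x hx) (hW.smooth x hx)]
    have := Complex.ofRealHom.map_det (1 + (t • jac (P.sP u) x + τ • jac (P.sW u) x))
    rw [show ((1 + (t • jac (P.sP u) x + τ • jac (P.sW u) x)).det : ℂ)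
      = Complex.ofRealHom ((1 + (t • jac (P.sP u) x + τ • jac (P.sW u) x)).det) from rfl, this]
    congr 1
    ext i j
    simp only [hA1, hA2, Matrix.add_apply, Matrix.smul_apply, map_apply, RingHom.mapMatrix_apply,
      Complex.ofRealHom_eq_coe, Complex.ofReal_add, smul_eq_mul, Complex.ofReal_mul]
    by_cases h : i = j <;> simp [Matrix.one_apply, h, add_assoc]
  -- first continuation
  have step1 : ∀ t : ℝ, |t| ≤ ρ → ∀ y : ℝ,
      ∫ x, (((1 + t ^ 2 * α x : ℝ) : ℂ) + (y : ℂ) ^ 2 * δ x) ^ e *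
        ((1 + (t : ℂ) • A1 x) + (y : ℂ) • (Complex.I • A2 x)).det ∂ν = (ν.real Set.univ : ℂ) := by
    intro t ht y
    refine continuation (A := Aδ + (1 + |t| * AP) + AW) (c := fun x => 1 + t ^ 2 * α x) mδ
      ((mα.const_mul _).const_add _) ?_ ?_ (by positivity) ?_ ?_ ?_ ?_
      (w := -Complex.I) (by simp) hρ0 ?_ y
    · intro i j
      simp only [Matrix.add_apply, Matrix.smul_apply, smul_eq_mul]
      exact ((mA1 i j).const_mul _).const_add _
    · intro i j
      simp only [Matrix.smul_apply, smul_eq_mul]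
      exact (mA2 i j).const_mul _
    · filter_upwards [hae] with x hx
      refine ⟨hδ0 x (P.K0_C hx), ?_⟩
      have h1 := (le_abs_self _).trans (bδ x hx)
      have : 0 ≤ |t| * AP := by positivity
      linarith
    · filter_upwards [hC] with x hx
      have := hα0 x hx
      nlinarith [mul_nonneg (sq_nonneg t) this]
    · filter_upwards [hae] with x hx i j
      rw [Matrix.add_apply, Matrix.smul_apply, smul_eq_mul]
      refine (norm_add_le _ _).trans ?_
      rw [norm_mul, Complex.norm_real, Real.norm_eq_abs]
      have h1 := n1 x hx i j
      have h2 := hone i j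
      have h3 : |t| * ‖A1 x i j‖ ≤ |t| * AP := by gcongr
      linarith
    · filter_upwards [hae] with x hx i j
      rw [Matrix.smul_apply, smul_eq_mul, norm_mul, Complex.norm_I, one_mul]
      have h1 := n2 x hx i j
      have : 0 ≤ |t| * AP := by positivity
      linarith
    · intro τ hτ
      rw [← real_id t τ ht hτ]
      refine integral_congr_ae (Eventually.of_forall fun x => ?_)
      simp only
      congr 2
      · push_cast
        rw [mul_pow, neg_sq, Complex.I_sq]; ring
      · congr 1
        rw [smul_smul]
        congr 1
        have := Complex.I_mul_I
        linear_combination -(τ : ℂ) * this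
  have step2 : ∀ y T : ℝ,
      ∫ x, (((1 + y ^ 2 * δ x : ℝ) : ℂ) + (T : ℂ) ^ 2 * α x) ^ e *
        ((1 + (y : ℂ) • (Complex.I • A2 x)) + (T : ℂ) • A1 x).det ∂ν = (ν.real Set.univ : ℂ) := by
    intro y T
    refine continuation (A := Aα + (1 + |y| * AW) + AP) (c := fun x => 1 + y ^ 2 * δ x) mα
      ((mδ.const_mul _).const_add _) ?_ mA1 (by positivity) ?_ ?_ ?_ ?_
      (w := 1) (by simp) hρ0 ?_ T
    · intro i j
      simp only [Matrix.add_apply, Matrix.smul_apply, smul_eq_mul]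
      exact (((mA2 i j).const_mul _).const_mul _).const_add _
    · filter_upwards [hae] with x hx
      refine ⟨hα0 x (P.K0_C hx), ?_⟩
      have h1 := (le_abs_self _).trans (bα x hx)
      have : 0 ≤ |y| * AW := by positivity
      linarith
    · filter_upwards [hC] with x hx
      have := hδ0 x hx
      nlinarith [mul_nonneg (sq_nonneg y) this]
    · filter_upwards [hae] with x hx i j
      rw [Matrix.add_apply, Matrix.smul_apply, Matrix.smul_apply, smul_eq_mul, smul_eq_mul]
      refine (norm_add_le _ _).trans ?_
      rw [norm_mul, norm_mul, Complex.norm_real, Real.norm_eq_abs, Complex.norm_I, one_mul]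
      have h1 := n2 x hx i j
      have h2 := hone i j
      have h3 : |y| * ‖A2 x i j‖ ≤ |y| * AW := by gcongr
      linarith
    · filter_upwards [hae] with x hx i j
      have h1 := n1 x hx i j
      have : 0 ≤ |y| * AW := by positivity
      linarith
    · intro t ht
      rw [← step1 t ht y]
      refine integral_congr_ae (Eventually.of_forall fun x => ?_)
      simp only
      congr 2
      · push_cast
        ring
      · rw [one_mul]; abel
  rw [← step2 T T]
  refine integral_congr_ae ?_
  filter_upwards [hC] with x hx
  have hQ : 0 < S.Q x := hx
  have ea : P.aa u x = α x + δ x := by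
    rw [aa, ← P.Q_sP_sub, hα, hδ]; field_simp; ring
  rw [ea]
  congr 2
  · push_cast; ring
  · rw [AA, smul_add]; abel

end Bumps
end Setup
end Kulk
end

section
open Matrix Filter Topology MeasureTheory

namespace Kulk

/-- polynomials are Lipschitz on bounded sets -/
lemma mvpoly_lip {τ : Type*} (f : MvPolynomial τ ℂ) (B : ℝ) : ∃ L : ℝ, 0 ≤ L ∧
    ∀ a b : τ → ℂ, ∀ δ : ℝ, (∀ i, ‖a i‖ ≤ B) → (∀ i, ‖b i‖ ≤ B) →
      (∀ i, ‖a i - b i‖ ≤ δ) → 0 ≤ δ →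
      ‖MvPolynomial.eval a f - MvPolynomial.eval b f‖ ≤ L * δ ∧ ‖MvPolynomial.eval a f‖ ≤ L := by
  induction f using MvPolynomial.induction_on with
  | C c => exact ⟨‖c‖, norm_nonneg _, fun a b δ _ _ _ hδ => by simp; positivity⟩
  | add f g hf hg =>
    obtain ⟨L1, h1, hf⟩ := hf
    obtain ⟨L2, h2, hg⟩ := hg
    refine ⟨L1 + L2, by positivity, fun a b δ ha hb hab hδ => ?_⟩
    obtain ⟨e1, e2⟩ := hf a b δ ha hb hab hδ
    obtain ⟨e3, e4⟩ := hg a b δ ha hb hab hδ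
    constructor
    · rw [map_add, map_add, add_sub_add_comm, add_mul]
      exact (norm_add_le _ _).trans (add_le_add e1 e3)
    · rw [map_add]
      exact (norm_add_le _ _).trans (add_le_add e2 e4)
  | mul_X f i hf =>
    obtain ⟨L1, h1, hf⟩ := hf
    refine ⟨L1 * |B| + L1, by positivity, fun a b δ ha hb hab hδ => ?_⟩
    obtain ⟨e1, e2⟩ := hf a b δ ha hb hab hδ
    have hB : ‖b i‖ ≤ |B| := (hb i).trans (le_abs_self B)
    have hB' : ‖a i‖ ≤ |B| := (ha i).trans (le_abs_self B)
    constructor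
    · rw [map_mul, map_mul, MvPolynomial.eval_X, MvPolynomial.eval_X]
      have : MvPolynomial.eval a f * a i - MvPolynomial.eval b f * b i =
        (MvPolynomial.eval a f - MvPolynomial.eval b f) * b i +
          MvPolynomial.eval a f * (a i - b i) := by ring
      rw [this]
      refine (norm_add_le _ _).trans ?_
      rw [norm_mul, norm_mul, add_mul]
      refine add_le_add ?_ (mul_le_mul e2 (hab i) (norm_nonneg _) h1)
      calc _ ≤ (L1 * δ) * |B| := mul_le_mul e1 hB (norm_nonneg _) (by positivity)
        _ = _ := by ring
    · rw [map_mul, norm_mul, MvPolynomial.eval_X]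
      have := mul_le_mul e2 hB' (norm_nonneg _) h1
      linarith

lemma coeff_lip (n : ℕ) (B : ℝ) (j : ℕ) : ∃ L : ℝ, 0 ≤ L ∧
    ∀ M N : Matrix (Fin n) (Fin n) ℂ, ∀ δ : ℝ, (∀ i j, ‖M i j‖ ≤ B) → (∀ i j, ‖N i j‖ ≤ B) →
      (∀ i j, ‖M i j - N i j‖ ≤ δ) → 0 ≤ δ →
      ‖M.charpoly.coeff j - N.charpoly.coeff j‖ ≤ L * δ ∧ ‖M.charpoly.coeff j‖ ≤ L := by
  obtain ⟨L, hL, h⟩ := mvpoly_lip ((Matrix.charpoly.univ ℂ (Fin n)).coeff j) B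
  refine ⟨L, hL, fun M N δ hM hN hMN hδ => ?_⟩
  have := h (fun ij => M ij.1 ij.2) (fun ij => N ij.1 ij.2) δ (fun ij => hM _ _) (fun ij => hN _ _)
    (fun ij => hMN _ _) hδ
  have key : ∀ M : Matrix (Fin n) (Fin n) ℂ,
      MvPolynomial.eval (fun ij : Fin n × Fin n => M ij.1 ij.2) ((Matrix.charpoly.univ ℂ (Fin n)).coeff j)
      = M.charpoly.coeff j := fun M =>
    Matrix.charpoly.univ_coeff_eval₂Hom (Fin n) (RingHom.id ℂ) (fun ij : Fin n × Fin n => M ij.1 ij.2) j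
  rwa [key, key] at this

lemma charpoly_coeff_one {n : ℕ} {x l : Fin n → ℂ} (hl : l ⬝ᵥ x = 1)
    {M : Matrix (Fin n) (Fin n) ℂ} (h1 : vecMulVec x l * M = 0) :
    M.charpoly.coeff 1 = (vecMulVec x l - M).det := by
  set p := vecMulVec x l with hp
  have hpp : p * p = p := by
    rw [hp, vecMulVec_mul_vecMulVec, hl, one_smul]
  let q : Polynomial ℂ := (Matrix.of fun i j => Polynomial.C (p i j) +
    Polynomial.X * Polynomial.C ((1 - p) i j) - Polynomial.C (M i j)).det
  have hq : ∀ t, q.eval t = (p + t • (1 - p) - M).det := by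
    intro t
    rw [← Polynomial.coe_evalRingHom, RingHom.map_det]
    congr 1
    ext i j
    simp
  have hdet : ∀ t : ℂ, (t • p + (1 - p)).det = t := by
    intro t
    have : t • p + (1 - p) = 1 + replicateCol Unit ((t - 1) • x) * replicateRow Unit l := by
      rw [← vecMulVec_eq, smul_vecMulVec, ← hp, sub_smul, one_smul]; abel
    rw [this, det_one_add_replicateCol_mul_replicateRow, dotProduct_smul, hl]
    simp
  have hX : M.charpoly = Polynomial.X * q := by
    refine Polynomial.funext fun t => ?_
    rw [eval_charpoly, Polynomial.eval_mul, Polynomial.eval_X, hq]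
    conv_rhs => rw [← hdet t, hdet t]
    nth_rw 2 [← hdet t]
    rw [← det_mul]
    congr 1
    simp only [mul_sub, add_mul, mul_add, sub_mul, hpp, h1, smul_mul_assoc, mul_smul_comm, one_mul, mul_one, sub_self, smul_zero]
    rw [scalar_apply, ← smul_one_eq_diagonal]
    module
  rw [hX, Polynomial.coeff_X_mul, Polynomial.coeff_zero_eq_eval_zero, hq]
  simp

lemma det_one_add_smul {n : ℕ} (A : Matrix (Fin n) (Fin n) ℂ) {T : ℂ} (hT : T ≠ 0) :
    (1 + T • A).det = ∑ j ∈ Finset.range (n + 1), A.charpoly.coeff j * (-T) ^ (n - j) := by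
  have e : (1 + T • A) = (-T) • (scalar (Fin n) (-T)⁻¹ - A) := by
    rw [scalar_apply, ← smul_one_eq_diagonal, smul_sub, smul_smul, mul_inv_cancel₀ (neg_ne_zero.2 hT)]
    simp
  rw [e, det_smul, ← eval_charpoly, Polynomial.eval_eq_sum_range' (n := n + 1)
    (by rw [charpoly_natDegree_eq_dim]; simp), Finset.mul_sum]
  refine Finset.sum_congr rfl fun j hj => ?_
  have hj : j ≤ n := by simpa [Nat.lt_succ_iff] using hj
  rw [Fintype.card_fin, pow_sub₀ _ (neg_ne_zero.2 hT) hj, inv_pow]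
  ring

lemma even_bound {n : ℕ} (hn : Odd n) (hn3 : 3 ≤ n) (A : Matrix (Fin n) (Fin n) ℂ) {T C : ℝ}
    (hT : 1 ≤ T) (hC : ∀ j, ‖A.charpoly.coeff j‖ ≤ C) :
    |(((1 + (T : ℂ) • A).det + (1 + ((-T : ℝ) : ℂ) • A).det) / 2).re| ≤
      T ^ (n - 1) * |(A.charpoly.coeff 1).re| + (n + 1) * C * T ^ (n - 2) := by
  have hT0 : (T : ℂ) ≠ 0 := by exact_mod_cast (by linarith : T ≠ 0)
  have hT0' : ((-T : ℝ) : ℂ) ≠ 0 := by exact_mod_cast (by linarith : -T ≠ 0)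
  have hC0 : 0 ≤ C := (norm_nonneg _).trans (hC 0)
  rw [det_one_add_smul A hT0, det_one_add_smul A hT0', ← Finset.sum_add_distrib, Finset.sum_div,
    Complex.re_sum]
  refine (Finset.abs_sum_le_sum_abs _ _).trans ?_
  have key : ∀ j ∈ Finset.range (n + 1),
    |((A.charpoly.coeff j * (-(T : ℂ)) ^ (n - j) + A.charpoly.coeff j * (-((-T : ℝ) : ℂ)) ^ (n - j)) / 2).re|
     ≤ (if j = 1 then T ^ (n - 1) * |(A.charpoly.coeff 1).re| else 0) + C * T ^ (n - 2) := by
    intro j hj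
    have hj : j ≤ n := by simpa [Nat.lt_succ_iff] using hj
    have e : (-((-T : ℝ) : ℂ)) = T := by simp
    rw [e, ← mul_add]
    by_cases h0 : j = 0
    · subst h0
      rw [Nat.sub_zero, hn.neg_pow, neg_add_cancel]
      simp; positivity
    by_cases h1 : j = 1
    · subst h1
      have : Even (n - 1) := Nat.Odd.sub_odd hn odd_one
      rw [this.neg_pow, ← two_mul, if_pos rfl]
      have e2 : A.charpoly.coeff 1 * (2 * (T : ℂ) ^ (n - 1)) / 2 = ((T ^ (n-1) : ℝ) : ℂ) * A.charpoly.coeff 1 := by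
        push_cast; ring
      rw [e2, Complex.re_ofReal_mul, abs_mul, abs_of_nonneg (by positivity)]
      have : 0 ≤ C * T ^ (n - 2) := by positivity
      linarith
    · rw [if_neg h1, zero_add]
      refine (Complex.abs_re_le_norm _).trans ?_
      rw [norm_div, norm_mul]
      have : ‖(-(T:ℂ)) ^ (n - j) + (T : ℂ) ^ (n - j)‖ ≤ 2 * T ^ (n - 2) := by
        refine (norm_add_le _ _).trans ?_
        rw [norm_pow, norm_pow, norm_neg, Complex.norm_real, Real.norm_of_nonneg (by linarith), ← two_mul]
        exact mul_le_mul_of_nonneg_left (pow_le_pow_right₀ hT (by omega)) (by norm_num)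
      calc _ ≤ C * (2 * T ^ (n - 2)) / ‖(2 : ℂ)‖ := by
            gcongr
            exact hC j
        _ = _ := by simp; ring
  refine (Finset.sum_le_sum key).trans ?_
  rw [Finset.sum_add_distrib, Finset.sum_ite_eq', if_pos (by simp; omega), Finset.sum_const]
  simp [mul_assoc]

end Kulk
end

section
open Matrix Filter Topology MeasureTheory

namespace Kulk

lemma cm_mul {n : ℕ} (M N : Matrix (Fin n) (Fin n) ℝ) :
    (M * N).map Complex.ofReal = M.map Complex.ofReal * N.map Complex.ofReal :=
  Matrix.map_mul (f := Complex.ofRealHom)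

lemma cm_det {n : ℕ} (M : Matrix (Fin n) (Fin n) ℝ) :
    (M.map Complex.ofReal).det = (M.det : ℂ) :=
  (RingHom.map_det Complex.ofRealHom M).symm

namespace Setup
namespace Bumps
variable {n : ℕ} {S : Setup n} (P : Bumps S)

/-- the twisting matrix -/
noncomputable def J (x : Fin n → ℝ) : Matrix (Fin n) (Fin n) ℂ :=
  ((1 + Complex.I) / 2) • (1 : Matrix (Fin n) (Fin n) ℂ) + ((1 - Complex.I) / 2) • (P.σ x).map Complex.ofReal

lemma J_sq {x : Fin n → ℝ} (hx : x ∈ S.C) : P.J x * P.J x = (P.σ x).map Complex.ofReal := by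
  have h : (P.σ x).map Complex.ofReal * (P.σ x).map Complex.ofReal = 1 := by
    rw [← cm_mul, P.sigma_sq hx];
    exact Matrix.map_one _ (by simp) (by simp)
  simp only [J, mul_add, add_mul, smul_mul_assoc, mul_smul_comm, one_mul, mul_one, h, smul_smul, smul_add]
  have e1 : (1 + Complex.I) / 2 * ((1 + Complex.I) / 2) = Complex.I / 2 := by
    have := Complex.I_sq
    linear_combination (1 / 4) * this
  have e2 : (1 - Complex.I) / 2 * ((1 - Complex.I) / 2) = - (Complex.I / 2) := by
    have := Complex.I_sq
    linear_combination (1 / 4) * this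
  have e3 : (1 + Complex.I) / 2 * ((1 - Complex.I) / 2) = 1 / 2 := by
    have := Complex.I_sq
    linear_combination (-1 / 4) * this
  have e4 : (1 - Complex.I) / 2 * ((1 + Complex.I) / 2) = 1 / 2 := by
    rw [mul_comm, e3]
  rw [e1, e2, e3, e4]
  module

lemma J_det_re {x : Fin n → ℝ} (hx : x ∈ S.C) (hdet : S.η.det < 0) : (P.J x).det.re = 0 := by
  have h := congrArg det (P.J_sq hx)
  rw [det_mul, cm_det, σ, det_mul] at h
  have hneg : S.η.det * (P.gm x).det < 0 := mul_neg_of_neg_of_pos hdet (P.gm_posDef hx).det_pos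
  set z := (P.J x).det
  set d := S.η.det * (P.gm x).det
  have h1 := congrArg Complex.re h
  have h2 := congrArg Complex.im h
  rw [Complex.mul_re, Complex.ofReal_re] at h1
  rw [Complex.mul_im, Complex.ofReal_im] at h2
  by_contra hne
  have : z.im = 0 := by
    have : z.re * z.im = 0 := by linarith
    exact (mul_eq_zero.1 this).resolve_left hne
  rw [this] at h1
  nlinarith [mul_self_nonneg z.re]

/-- the principal part of the complexified Jacobian -/
noncomputable def NN (u : (Fin n → ℝ) → (Fin n → ℝ)) (x : Fin n → ℝ) : Matrix (Fin n) (Fin n) ℂ :=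
  P.J x * (S.Pr x * jac u x).map Complex.ofReal

lemma ell_sigma {x : Fin n → ℝ} (hx : x ∈ S.C) : S.ell x ᵥ* P.σ x = S.ell x := by
  have h : (S.η *ᵥ x) ᵥ* P.σ x = S.η *ᵥ x := by
    conv_rhs => rw [← P.sigma_self hx, mulVec_mulVec, P.eta_sigma, ← P.gm_symm hx, mulVec_transpose,
      ← P.eta_sigma, ← vecMul_vecMul]
    rw [← vecMul_transpose, S.hη]
  rw [ell, smul_vecMul, h]

lemma NN_coeff {x : Fin n → ℝ} (hx : x ∈ S.C) (hdet : S.η.det < 0)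
    (u : (Fin n → ℝ) → (Fin n → ℝ)) : ((P.NN u x).charpoly.coeff 1).re = 0 := by
  have hp : (vecMulVec x (S.ell x)).map Complex.ofReal =
    vecMulVec (fun i => (x i : ℂ)) (fun i => (S.ell x i : ℂ)) := by
    ext i j; simp [vecMulVec_apply]
  have hl : (fun i => (S.ell x i : ℂ)) ⬝ᵥ (fun i => (x i : ℂ)) = 1 := by
    have := congrArg Complex.ofReal (S.ell_dot hx)
    simpa [dotProduct] using this
  have hpS : vecMulVec x (S.ell x) * P.σ x = vecMulVec x (S.ell x) := by
    rw [vecMulVec_mul, P.ell_sigma hx]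
  have hSp : P.σ x * vecMulVec x (S.ell x) = vecMulVec x (S.ell x) := by
    rw [mul_vecMulVec, P.sigma_self hx]
  have hpJ : (vecMulVec x (S.ell x)).map Complex.ofReal * P.J x = (vecMulVec x (S.ell x)).map Complex.ofReal := by
    rw [J, mul_add, mul_smul_comm, mul_smul_comm, ← cm_mul, hpS, mul_one]
    module
  have hJp : P.J x * (vecMulVec x (S.ell x)).map Complex.ofReal = (vecMulVec x (S.ell x)).map Complex.ofReal := by
    rw [J, add_mul, smul_mul_assoc, smul_mul_assoc, ← cm_mul, hSp, one_mul]
    module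
  have hpP : vecMulVec x (S.ell x) * (S.Pr x * jac u x) = 0 := by
    rw [← mul_assoc, Pr, mul_sub, mul_one, vecMulVec_mul_vecMulVec, S.ell_dot hx, one_smul, sub_self, zero_mul]
  rw [charpoly_coeff_one hl, ← hp, NN]
  · have : (vecMulVec x (S.ell x)).map Complex.ofReal - P.J x * (S.Pr x * jac u x).map Complex.ofReal
       = P.J x * (vecMulVec x (S.ell x) - S.Pr x * jac u x).map Complex.ofReal := by
      rw [Matrix.map_sub _ (fun a b => Complex.ofReal_sub a b), mul_sub, hJp]
    rw [this, det_mul, cm_det, Complex.mul_re, P.J_det_re hx hdet]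
    simp
  · rw [← hp, NN, ← mul_assoc, hpJ, ← cm_mul, hpP]
    ext i j; simp

/-- derivative of the involution applied to the field -/
noncomputable def RR (u : (Fin n → ℝ) → (Fin n → ℝ)) (x : Fin n → ℝ) : Matrix (Fin n) (Fin n) ℝ :=
  Matrix.of fun i l => ∑ k, fderiv ℝ (fun y => P.σ y i k) x (Pi.single l 1) * u x k

lemma AA_sub_NN {x : Fin n → ℝ} (hx : x ∈ S.C) {u : (Fin n → ℝ) → (Fin n → ℝ)} (hu : S.IsField u)
   (i l : Fin n) :
    P.AA u x i l - P.NN u x i l = ((1 - Complex.I) / 2) * (P.RR u x i l : ℂ)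
      - ((x i * ((S.Q x)⁻¹ * (S.η *ᵥ u x) l) : ℝ) : ℂ) := by
  have hσ : jac (fun x => P.σ x *ᵥ u x) x = P.σ x * jac u x + P.RR u x := by
    ext i l
    rw [P.jac_sigma hx (hu.smooth x hx) i l]; rfl
  have h1 : jac (P.sP u) x = (1 / 2 : ℝ) • jac u x + (1 / 2 : ℝ) • (P.σ x * jac u x + P.RR u x) := by
    rw [← hσ]
    exact jac_lin (hu.smooth x hx) ((P.sigma_field hu).smooth x hx) _ _
  have h2 : jac (P.sW u) x = (1 / 2 : ℝ) • jac u x + (-1 / 2 : ℝ) • (P.σ x * jac u x + P.RR u x) := by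
    rw [← hσ]
    exact jac_lin (hu.smooth x hx) ((P.sigma_field hu).smooth x hx) _ _
  have h3 : S.Pr x * jac u x = jac u x - vecMulVec x (-(S.Q x)⁻¹ • (S.η *ᵥ u x)) := by
    rw [← hu.tan_deriv hx, Pr, sub_mul, one_mul, vecMulVec_mul]
  have h4 : P.σ x * (S.Pr x * jac u x) = P.σ x * jac u x - vecMulVec x (-(S.Q x)⁻¹ • (S.η *ᵥ u x)) := by
    rw [h3, mul_sub, mul_vecMulVec, P.sigma_self hx]
  have h5 : P.NN u x = ((1 + Complex.I) / 2) • (jac u x - vecMulVec x (-(S.Q x)⁻¹ • (S.η *ᵥ u x))).map Complex.ofReal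
     + ((1 - Complex.I) / 2) • (P.σ x * jac u x - vecMulVec x (-(S.Q x)⁻¹ • (S.η *ᵥ u x))).map Complex.ofReal := by
    rw [NN, J, add_mul, smul_mul_assoc, smul_mul_assoc, one_mul, ← cm_mul, h4, h3]
  rw [h5, AA, h1, h2]
  simp only [Matrix.add_apply, Matrix.sub_apply, Matrix.smul_apply, Matrix.map_apply, vecMulVec_apply,
    Pi.smul_apply, smul_eq_mul]
  push_cast
  ring

end Bumps
end Setup
end Kulk
end

section
open Matrix Filter Topology MeasureTheory

namespace Kulk
namespace Setup
namespace Bumps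
variable {n : ℕ} {S : Setup n} (P : Bumps S)

lemma aa_lower (u : (Fin n → ℝ) → (Fin n → ℝ)) : ∃ κ : ℝ, 0 < κ ∧ ∀ x ∈ P.K0, ∀ T : ℝ, 0 ≤ T →
    κ * (1 + T * ‖u x‖) ≤ Real.sqrt (1 + T ^ 2 * P.aa u x) := by
  have hc : ∃ c : ℝ, 0 < c ∧ ∀ b ∈ P.K0 ×ˢ Metric.sphere (0 : Fin n → ℝ) 1,
      c ≤ (b.2 ⬝ᵥ (P.gm b.1 *ᵥ b.2)) / S.Q b.1 := by
    refine (P.K0_compact.prod (isCompact_sphere _ _)).exists_forall_le' ?_ ?_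
    · rintro ⟨x, v⟩ ⟨hx, hv⟩
      have hxC := P.K0_C hx
      have hg : ∀ i j, ContinuousAt (fun b : (Fin n → ℝ) × (Fin n → ℝ) => P.gm b.1 i j) (x, v) :=
        fun i j => ContinuousAt.comp (f := Prod.fst) (x := (x, v)) (P.contDiffAt_gm hxC i j).continuousAt continuousAt_fst
      have hQ : ContinuousAt (fun b : (Fin n → ℝ) × (Fin n → ℝ) => S.Q b.1) (x, v) :=
        (S.Q_continuous.comp continuous_fst).continuousAt
      refine ContinuousAt.continuousWithinAt (ContinuousAt.div ?_ hQ (S.C_iff.1 hxC).ne')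
      simp only [dotProduct, mulVec]
      fun_prop
    · rintro ⟨x, v⟩ ⟨hx, hv⟩
      have hxC := P.K0_C hx
      refine div_pos ?_ (S.C_iff.1 hxC)
      have hv0 : v ≠ 0 := by rintro rfl; simp at hv
      simpa using (P.gm_posDef hxC).dotProduct_mulVec_pos hv0
  obtain ⟨c, hc, h⟩ := hc
  refine ⟨Real.sqrt (min c 1 / 2), by positivity, fun x hx T hT => ?_⟩
  have ha : c * ‖u x‖ ^ 2 ≤ P.aa u x := by
    by_cases h0 : u x = 0
    · simp [aa, h0]
    have hn : ‖u x‖ ≠ 0 := norm_ne_zero_iff.2 h0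
    have := h (x, ‖u x‖⁻¹ • u x) ⟨hx, by simp [norm_smul, hn]⟩
    simp only [mulVec_smul, dotProduct_smul, smul_dotProduct, smul_eq_mul] at this
    have e : ‖u x‖⁻¹ * (‖u x‖⁻¹ * (u x ⬝ᵥ (P.gm x *ᵥ u x))) / S.Q x = P.aa u x / ‖u x‖ ^ 2 := by
      rw [aa]; field_simp
    rw [e, le_div_iff₀ (by positivity)] at this
    exact this
  refine Real.le_sqrt_of_sq_le ?_
  rw [mul_pow, Real.sq_sqrt (by positivity)]
  have h1 : min c 1 ≤ 1 := min_le_right _ _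
  have h2 : min c 1 ≤ c := min_le_left _ _
  have h3 : T ^ 2 * (c * ‖u x‖ ^ 2) ≤ T ^ 2 * P.aa u x := mul_le_mul_of_nonneg_left ha (sq_nonneg _)
  have h4 : (1 + T * ‖u x‖) ^ 2 / 2 ≤ 1 + (T * ‖u x‖) ^ 2 := by nlinarith [sq_nonneg (1 - T * ‖u x‖)]
  have h5 : 0 < min c 1 := by positivity
  calc _ = min c 1 * ((1 + T * ‖u x‖) ^ 2 / 2) := by ring
    _ ≤ min c 1 * (1 + (T * ‖u x‖) ^ 2) := mul_le_mul_of_nonneg_left h4 h5.le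
    _ = min c 1 + min c 1 * (T * ‖u x‖) ^ 2 := by ring
    _ ≤ 1 + c * (T * ‖u x‖) ^ 2 := add_le_add h1 (mul_le_mul_of_nonneg_right h2 (sq_nonneg _))
    _ = 1 + T ^ 2 * (c * ‖u x‖ ^ 2) := by ring
    _ ≤ _ := by linarith

lemma AA_bound {u : (Fin n → ℝ) → (Fin n → ℝ)} (hu : S.IsField u) : ∃ A : ℝ, 0 ≤ A ∧ ∀ x ∈ P.K0,
    ∀ i l, ‖P.AA u x i l‖ ≤ A := by
  obtain ⟨A1, h1, hA1⟩ := exists_bound_jac P.K0_compact P.K0_C (P.sP_field hu)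
  obtain ⟨A2, h2, hA2⟩ := exists_bound_jac P.K0_compact P.K0_C (P.sW_field hu)
  refine ⟨A1 + A2, by positivity, fun x hx i l => ?_⟩
  rw [AA]
  simp only [Matrix.add_apply, Matrix.smul_apply, Matrix.map_apply, smul_eq_mul]
  refine (norm_add_le _ _).trans (add_le_add ?_ ?_)
  · rw [Complex.norm_real]; exact (hA1 x hx).2 i l
  · rw [norm_mul, Complex.norm_I, one_mul, Complex.norm_real]; exact (hA2 x hx).2 i l

lemma diff_bound {u : (Fin n → ℝ) → (Fin n → ℝ)} (hu : S.IsField u) : ∃ D : ℝ, 0 ≤ D ∧ ∀ x ∈ P.K0,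
    ∀ i l, ‖P.AA u x i l - P.NN u x i l‖ ≤ D * ‖u x‖ := by
  let g : Fin n → Fin n → (Fin n → ℝ) → ℝ := fun i l x =>
    (∑ k, |fderiv ℝ (fun y => P.σ y i k) x (Pi.single l 1)|) + |x i| * |(S.Q x)⁻¹| * ∑ k, |S.η l k|
  have hg : ∀ i l, ContinuousOn (g i l) S.C := by
    intro i l x hx
    have h1 : ∀ k, ContinuousAt (fun x => fderiv ℝ (fun y => P.σ y i k) x (Pi.single l 1)) x := by
      intro k
      have := (P.contDiffAt_sigma hx i k).continuousAt_fderiv one_ne_zero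
      fun_prop
    have h2 : ContinuousAt (fun x => (S.Q x)⁻¹) x := S.Q_continuous.continuousAt.inv₀ (S.C_iff.1 hx).ne'
    refine ContinuousAt.continuousWithinAt ?_
    simp only [g]
    refine ContinuousAt.add (tendsto_finsetSum _ fun k _ => (h1 k).abs) ?_
    exact ((continuous_apply i).continuousAt.abs.mul h2.abs).mul continuousAt_const
  have h1 := fun i l => exists_bound_on P.K0_compact P.K0_C (hg i l)
  choose A1 hA1 h1 using h1
  refine ⟨∑ i, ∑ l, A1 i l, Finset.sum_nonneg fun i _ => Finset.sum_nonneg fun l _ => (hA1 i l).le,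
    fun x hx i l => ?_⟩
  have e1 : A1 i l ≤ ∑ j, A1 i j :=
    Finset.single_le_sum (f := fun j => A1 i j) (fun j _ => (hA1 i j).le) (Finset.mem_univ l)
  have e2 : ∑ j, A1 i j ≤ ∑ i, ∑ j, A1 i j :=
    Finset.single_le_sum (f := fun i => ∑ j, A1 i j)
      (fun i _ => Finset.sum_nonneg fun j _ => (hA1 i j).le) (Finset.mem_univ i)
  have e3 : g i l x ≤ A1 i l := (le_abs_self _).trans (h1 i l x hx)
  refine le_trans ?_ (mul_le_mul_of_nonneg_right (e3.trans (e1.trans e2)) (norm_nonneg _))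
  rw [P.AA_sub_NN (P.K0_C hx) hu]
  have hk : ∀ k, |u x k| ≤ ‖u x‖ := fun k => norm_le_pi_norm (u x) k
  refine (norm_sub_le _ _).trans ?_
  rw [norm_mul, Complex.norm_real, Complex.norm_real]
  simp only [g]
  rw [add_mul]
  refine add_le_add ?_ ?_
  · have hc : ‖(1 - Complex.I) / 2‖ ≤ 1 := by
      rw [norm_div]
      have := norm_sub_le (1 : ℂ) Complex.I
      rw [norm_one, Complex.norm_I] at this
      have e : ‖(2 : ℂ)‖ = 2 := by simp
      rw [e]; linarith
    refine (mul_le_of_le_one_left (norm_nonneg _) hc).trans ?_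
    rw [RR, of_apply, Finset.sum_mul]
    refine (norm_sum_le _ _).trans (Finset.sum_le_sum fun k _ => ?_)
    rw [norm_mul]
    exact mul_le_mul_of_nonneg_left (hk k) (norm_nonneg _)
  · rw [norm_mul, norm_mul, ← mul_assoc, mul_assoc (|x i| * _)]
    refine mul_le_mul_of_nonneg_left ?_ (by positivity)
    rw [mulVec, dotProduct, Finset.sum_mul]
    refine (norm_sum_le _ _).trans (Finset.sum_le_sum fun k _ => ?_)
    rw [norm_mul]
    exact mul_le_mul_of_nonneg_left (hk k) (norm_nonneg _)

lemma coeff_bounds {u : (Fin n → ℝ) → (Fin n → ℝ)} (hu : S.IsField u) (hdet : S.η.det < 0) :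
    ∃ C : ℝ, 0 ≤ C ∧ ∀ x ∈ P.K0, (∀ j, ‖(P.AA u x).charpoly.coeff j‖ ≤ C) ∧
      |((P.AA u x).charpoly.coeff 1).re| ≤ C * ‖u x‖ := by
  obtain ⟨A, hA0, hA⟩ := P.AA_bound hu
  obtain ⟨D, hD0, hD⟩ := P.diff_bound hu
  obtain ⟨V, hV0, hV⟩ := exists_bound_jac P.K0_compact P.K0_C hu
  have hN : ∀ x ∈ P.K0, ∀ i l, ‖P.NN u x i l‖ ≤ A + D * V := by
    intro x hx i l
    have : P.NN u x i l = P.AA u x i l - (P.AA u x i l - P.NN u x i l) := by ring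
    rw [this]
    refine (norm_sub_le _ _).trans (add_le_add (hA x hx i l) ((hD x hx i l).trans ?_))
    exact mul_le_mul_of_nonneg_left (hV x hx).1 hD0
  have hA' : ∀ x ∈ P.K0, ∀ i l, ‖P.AA u x i l‖ ≤ A + D * V := fun x hx i l =>
    (hA x hx i l).trans (by nlinarith)
  have hl := fun j => coeff_lip n (A + D * V) j
  choose L hL0 hL using hl
  refine ⟨(∑ j ∈ Finset.range (n + 1), L j) + L 1 * D, add_nonneg (Finset.sum_nonneg fun j _ => hL0 j) (mul_nonneg (hL0 1) hD0), fun x hx => ⟨fun j => ?_, ?_⟩⟩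
  · have hLD := mul_nonneg (hL0 1) hD0
    have hs : 0 ≤ ∑ j ∈ Finset.range (n + 1), L j := Finset.sum_nonneg fun j _ => hL0 j
    by_cases hj : j < n + 1
    · have := (hL j (P.AA u x) (P.NN u x) (D * ‖u x‖) (hA' x hx) (hN x hx) (hD x hx) (by positivity)).2
      have h2 := Finset.single_le_sum (f := L) (fun j _ => hL0 j) (Finset.mem_range.2 hj)
      linarith
    · rw [Polynomial.coeff_eq_zero_of_natDegree_lt (by rw [charpoly_natDegree_eq_dim, Fintype.card_fin]; omega), norm_zero]
      linarith
  · have := (hL 1 (P.AA u x) (P.NN u x) (D * ‖u x‖) (hA' x hx) (hN x hx) (hD x hx) (by positivity)).1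
    have h2 := Complex.abs_re_le_norm ((P.AA u x).charpoly.coeff 1 - (P.NN u x).charpoly.coeff 1)
    rw [Complex.sub_re, P.NN_coeff (P.K0_C hx) hdet, sub_zero] at h2
    have hs : 0 ≤ ∑ j ∈ Finset.range (n + 1), L j := Finset.sum_nonneg fun j _ => hL0 j
    have h3 := mul_nonneg hs (norm_nonneg (u x))
    nlinarith

theorem limit {ν : Measure (Fin n → ℝ)} [IsFiniteMeasure ν] (hν : ν Set.univ ≠ 0)
    (hae : ∀ᵐ x ∂ν, x ∈ P.K0)
    {ε : ℝ} (hε : 0 < ε) {K1 : Set (Fin n → ℝ)} (hK1 : IsCompact K1) (hK1C : K1 ⊆ S.C)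
    (hmil : ∀ s, S.IsField s → (∀ x ∈ K1, ‖s x‖ ≤ ε ∧ ∀ i j, |jac s x i j| ≤ ε) →
        (∀ x ∈ S.C, 0 < S.Q (x + s x)) ∧
        ∫ x, Real.sqrt (S.Q x / S.Q (x + s x)) ^ n * (1 + jac s x).det ∂ν = ν.real Set.univ)
    {u : (Fin n → ℝ) → (Fin n → ℝ)} (hu : S.IsField u) (hdet : S.η.det < 0)
    (hn : Odd n) (hn3 : 3 ≤ n) (hu0 : ∀ᵐ x ∂ν, u x ≠ 0)
    (hIntg : Integrable (fun x => ‖u x‖⁻¹ ^ (n - 2)) ν) : False := by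
  have hpos : 0 < ν.real Set.univ := by
    rw [Measure.real]; exact ENNReal.toReal_pos hν (measure_ne_top _ _)
  obtain ⟨κ, hκ, hκb⟩ := P.aa_lower u
  obtain ⟨C, hC0, hC⟩ := P.coeff_bounds hu hdet
  have hcont := P.continued hae hε hK1 hK1C hmil hu
  let f : ℝ → (Fin n → ℝ) → ℂ := fun T x => ((1 + T ^ 2 * P.aa u x : ℝ) : ℂ) ^ (((-(n : ℝ) / 2 : ℝ)) : ℂ) *
      (1 + (T : ℂ) • P.AA u x).det
  have hfint : ∀ T, Integrable (f T) ν := by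
    intro T
    by_contra h
    have := hcont T
    rw [integral_undef h] at this
    have : ν.real Set.univ = 0 := by exact_mod_cast this.symm
    exact hpos.ne' this
  let G : ℕ → (Fin n → ℝ) → ℝ := fun k x => ((f ((k:ℝ) + 1) x + f (-((k:ℝ) + 1)) x) / 2).re
  have hGc : ∀ k, Integrable (fun x => (f ((k:ℝ) + 1) x + f (-((k:ℝ) + 1)) x) / 2) ν := fun k =>
    ((hfint _).add (hfint _)).div_const 2
  have hGint : ∀ k, ∫ x, G k x ∂ν = ν.real Set.univ := by
    intro k
    have h1 := integral_re (hGc k)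
    have h2 : ∫ x, (f ((k:ℝ) + 1) x + f (-((k:ℝ) + 1)) x) / 2 ∂ν = (ν.real Set.univ : ℂ) := by
      rw [integral_div, integral_add (hfint _) (hfint _), hcont, hcont]
      ring
    rw [h2] at h1
    exact h1.trans (Complex.ofReal_re _)
  let Dn : ℝ := (n + 2) * C * (κ⁻¹) ^ n
  have hb : ∀ k, ∀ x ∈ P.K0, u x ≠ 0 → |G k x| ≤ Dn * ‖u x‖⁻¹ ^ (n - 2) * (1 + ((k:ℝ) + 1) * ‖u x‖)⁻¹ := by
    intro k x hx hux
    set T : ℝ := (k : ℝ) + 1 with hT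
    have hT1 : 1 ≤ T := by simp [hT]
    have hT0 : 0 ≤ T := by linarith
    have hr : 0 < ‖u x‖ := norm_pos_iff.2 hux
    have hxC := P.K0_C hx
    have haa : 0 ≤ P.aa u x := div_nonneg (P.gm_nonneg hxC _) (S.C_iff.1 hxC).le
    have hw : 0 < 1 + T ^ 2 * P.aa u x := by positivity
    have hG : G k x = Real.sqrt (1 / (1 + T ^ 2 * P.aa u x)) ^ n *
       (((1 + (T : ℂ) • P.AA u x).det + (1 + ((-T : ℝ) : ℂ) • P.AA u x).det) / 2).re := by
      simp only [G, f, ← hT]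
      rw [neg_sq, ← sqrt_pow_eq_cpow n hw, ← Complex.re_ofReal_mul]
      congr 1
      ring
    rw [hG, abs_mul]
    have h1 := even_bound hn hn3 (P.AA u x) hT1 (hC x hx).1
    have h2 : T ^ (n - 1) * |((P.AA u x).charpoly.coeff 1).re| + (n + 1) * C * T ^ (n - 2)
       ≤ (n + 2) * C * T ^ (n - 2) * (1 + T * ‖u x‖) := by
      have e : T ^ (n - 1) = T ^ (n - 2) * T := by
        rw [← pow_succ]; congr 1; omega
      have := mul_le_mul_of_nonneg_left (hC x hx).2 (pow_nonneg hT0 (n - 1))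
      refine (add_le_add_left this _).trans ?_
      rw [e]
      have h5 : 0 ≤ C * T ^ (n - 2) := by positivity
      have h6 : 0 ≤ C * T ^ (n - 2) * (T * ‖u x‖) := by positivity
      have h7 : (0 : ℝ) ≤ n := Nat.cast_nonneg n
      nlinarith [mul_nonneg h7 h6]
    have h3 : |Real.sqrt (1 / (1 + T ^ 2 * P.aa u x)) ^ n| ≤ (κ⁻¹) ^ n * ((1 + T * ‖u x‖)⁻¹) ^ n := by
      rw [abs_of_nonneg (by positivity), ← mul_pow, ← mul_inv]
      refine pow_le_pow_left₀ (Real.sqrt_nonneg _) ?_ n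
      rw [one_div, Real.sqrt_inv]
      exact inv_anti₀ (by positivity) (hκb x hx T hT0)
    have hs : 0 < 1 + T * ‖u x‖ := by positivity
    have h4 : T ^ (n - 2) ≤ (1 + T * ‖u x‖) ^ (n - 2) * ‖u x‖⁻¹ ^ (n - 2) := by
      rw [← mul_pow]
      refine pow_le_pow_left₀ hT0 ?_ _
      rw [add_mul, mul_assoc, mul_inv_cancel₀ hr.ne']
      have : 0 ≤ ‖u x‖⁻¹ := by positivity
      linarith
    set s := 1 + T * ‖u x‖ with hsd
    have e5 : (s⁻¹) ^ n = (s⁻¹) ^ (n - 2) * s⁻¹ * s⁻¹ := by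
      rw [mul_assoc, ← sq, ← pow_add]; congr 1; omega
    calc _ ≤ ((κ⁻¹) ^ n * (s⁻¹) ^ n) * ((n + 2) * C * T ^ (n - 2) * s) :=
          mul_le_mul h3 (h1.trans h2) (abs_nonneg _) (by positivity)
      _ ≤ ((κ⁻¹) ^ n * (s⁻¹) ^ n) * ((n + 2) * C * (s ^ (n - 2) * ‖u x‖⁻¹ ^ (n - 2)) * s) := by gcongr
      _ = Dn * ‖u x‖⁻¹ ^ (n - 2) * s⁻¹ * ((s⁻¹ * s) ^ (n - 2) * (s⁻¹ * s)) := by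
          rw [e5, mul_pow]; simp only [Dn]; ring
      _ = _ := by rw [inv_mul_cancel₀ hs.ne']; simp
  have hDn : 0 ≤ Dn := by positivity
  have hlim : Tendsto (fun k => ∫ x, G k x ∂ν) atTop (𝓝 (∫ x, (0 : ℝ) ∂ν)) := by
    refine tendsto_integral_of_dominated_convergence (fun x => Dn * ‖u x‖⁻¹ ^ (n - 2))
      (fun k => (hGc k).re.aestronglyMeasurable) (hIntg.const_mul _) ?_ ?_
    · intro k
      filter_upwards [hae, hu0] with x hx h0
      refine (hb k x hx h0).trans (mul_le_of_le_one_right (by positivity) ?_)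
      refine inv_le_one_of_one_le₀ ?_
      have : 0 ≤ ((k:ℝ) + 1) * ‖u x‖ := by positivity
      linarith
    · filter_upwards [hae, hu0] with x hx h0
      refine squeeze_zero_norm (fun k => hb k x hx h0) ?_
      rw [← mul_zero (Dn * ‖u x‖⁻¹ ^ (n - 2))]
      refine Tendsto.const_mul _ (tendsto_inv_atTop_zero.comp ?_)
      refine tendsto_atTop_add_const_left _ _ ?_
      exact (tendsto_atTop_add_const_right _ _ tendsto_natCast_atTop_atTop).atTop_mul_const (norm_pos_iff.2 h0)
  simp only [hGint, integral_zero] at hlim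
  exact hpos.ne' (tendsto_nhds_unique tendsto_const_nhds hlim)

end Bumps
end Setup
end Kulk
end

section
open Matrix Filter Topology MeasureTheory

namespace Kulk

lemma lintegral_fin_prod (n : ℕ) (f : Fin n → ℝ → ENNReal) (hf : ∀ i, Measurable (f i)) :
    ∫⁻ x : Fin n → ℝ, ∏ i, f i (x i) = ∏ i, ∫⁻ t, f i t := by
  induction n with
  | zero => simp [lintegral_unique, volume_pi]
  | succ n ih =>
    rw [← (volume_preserving_piFinSuccAbove (fun _ => ℝ) (0 : Fin (n + 1))).symm.lintegral_comp_emb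
      (MeasurableEquiv.measurableEmbedding _)]
    simp only [Fin.prod_univ_succ]
    rw [← ih (fun i => f i.succ) (fun i => hf _), Measure.volume_eq_prod, ← lintegral_prod_mul (hf 0).aemeasurable
      (Finset.aemeasurable_fun_prod _ fun i _ => ((hf i.succ).comp (measurable_pi_apply i)).aemeasurable)]
    rfl

/-- one-dimensional singular integral -/
lemma one_dim {θ : ℝ} (h0 : 0 ≤ θ) (h1 : θ < 1) (R : ℝ) : ∃ C : ENNReal, C ≠ ⊤ ∧ ∀ b : ℝ,
    ∫⁻ t in Set.Icc (b - R) (b + R), (‖t‖ₑ⁻¹) ^ θ ≤ C := by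
  have hfin : ∫⁻ t in Set.Ioc (0 : ℝ) 1, (‖t‖ₑ⁻¹) ^ θ ≠ ⊤ := by
    have h := (intervalIntegral.intervalIntegrable_rpow' (a := 0) (b := 1) (r := -θ) (by linarith)).1
    have h2 := h.2
    rw [HasFiniteIntegral] at h2
    refine ne_of_lt (lt_of_eq_of_lt ?_ h2)
    refine setLIntegral_congr_fun measurableSet_Ioc fun t ht => ?_
    have ht0 : 0 < t := ht.1
    have e : t ^ (-θ) = (t⁻¹) ^ θ := by rw [Real.rpow_neg ht0.le, Real.inv_rpow ht0.le]
    rw [e, Real.enorm_rpow_of_nonneg (inv_nonneg.2 ht0.le) h0, enorm_inv ht0.ne']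
  have hm : Measurable fun t : ℝ => (‖t‖ₑ⁻¹) ^ θ := by fun_prop
  have hfin2 : ∫⁻ t in Set.Ico (-1 : ℝ) 0, (‖t‖ₑ⁻¹) ^ θ ≠ ⊤ := by
    have h := (Measure.measurePreserving_neg (volume : Measure ℝ)).setLIntegral_comp_preimage
      (measurableSet_Ioc (a := (0 : ℝ)) (b := 1)) hm
    simp only [enorm_neg] at h
    rw [← h] at hfin
    convert hfin using 3
    ext t
    simp only [Set.mem_Ico, Set.mem_preimage, Set.mem_Ioc]
    constructor <;> intro h <;> constructor <;> linarith [h.1, h.2]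
  refine ⟨(∫⁻ t in Set.Ico (-1 : ℝ) 0, (‖t‖ₑ⁻¹) ^ θ) + (∫⁻ t in Set.Ioc (0 : ℝ) 1, (‖t‖ₑ⁻¹) ^ θ) +
    ENNReal.ofReal (2 * R), ?_, fun b => ?_⟩
  · finiteness
  let s1 := Set.Ico (-1 : ℝ) 0
  let s2 := Set.Ioc (0 : ℝ) 1
  let s3 := Set.Icc (b - R) (b + R) ∩ {t : ℝ | 1 ≤ |t|}
  have hsub : Set.Icc (b - R) (b + R) ⊆ ((s1 ∪ s2) ∪ s3) ∪ {0} := by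
    intro t ht
    simp only [s1, s2, s3, Set.mem_union, Set.mem_Ico, Set.mem_Ioc, Set.mem_inter_iff, Set.mem_ofPred_eq,
      Set.mem_singleton_iff]
    by_cases h : 1 ≤ |t|
    · exact Or.inl (Or.inr ⟨ht, h⟩)
    · have := abs_lt.1 (not_le.1 h)
      rcases lt_trichotomy t 0 with h2 | h2 | h2
      · exact Or.inl (Or.inl (Or.inl ⟨this.1.le, h2⟩))
      · exact Or.inr h2
      · exact Or.inl (Or.inl (Or.inr ⟨h2, this.2.le⟩))
  refine (lintegral_mono_set hsub).trans ((lintegral_union_le _ _ _).trans ?_)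
  rw [Measure.restrict_singleton, Real.volume_singleton, zero_smul, lintegral_zero_measure, add_zero]
  refine (lintegral_union_le _ _ _).trans (add_le_add (lintegral_union_le _ _ _) ?_)
  have hs3 : MeasurableSet s3 := measurableSet_Icc.inter (measurableSet_le measurable_const (by fun_prop))
  calc ∫⁻ t in s3, (‖t‖ₑ⁻¹) ^ θ ≤ ∫⁻ t in s3, 1 := by
        refine setLIntegral_mono' hs3 fun t ht => ?_
        refine ENNReal.rpow_le_one ?_ h0
        rw [ENNReal.inv_le_one, ← ofReal_norm, Real.norm_eq_abs, ENNReal.one_le_ofReal]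
        exact ht.2
    _ = volume s3 := by simp
    _ ≤ volume (Set.Icc (b - R) (b + R)) := measure_mono Set.inter_subset_left
    _ = _ := by rw [Real.volume_Icc]; congr 1; ring

/-- singular integrals over affine images of the cube -/
lemma affine_dim (n : ℕ) {θ : ℝ} (h0 : 0 ≤ θ) (h1 : θ < 1) (R : ℝ) : ∃ C : ENNReal, C ≠ ⊤ ∧
    ∀ (D : Matrix (Fin n) (Fin n) ℝ) (b : Fin n → ℝ) (i : Fin n), |D.det| = 1 →
      (∀ v ∈ Set.Icc (0 : Fin n → ℝ) 1, ‖D *ᵥ v‖ ≤ R) →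
      ∫⁻ v in Set.Icc (0 : Fin n → ℝ) 1, ∏ k ∈ Finset.univ.erase i, (‖(D *ᵥ v + b) k‖ₑ⁻¹) ^ θ ≤ C := by
  obtain ⟨C, hC, hCb⟩ := one_dim h0 h1 R
  refine ⟨(C + ENNReal.ofReal (2 * R)) ^ n, by finiteness, fun D b i hD hv => ?_⟩
  let f : Fin n → ℝ → ENNReal := fun k => (Set.Icc (b k - R) (b k + R)).indicator
    (fun t => if k = i then 1 else (‖t‖ₑ⁻¹) ^ θ)
  have hf : ∀ k, Measurable (f k) := by
    intro k
    refine Measurable.indicator ?_ measurableSet_Icc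
    split_ifs <;> fun_prop
  have hmp : MeasurePreserving (fun v : Fin n → ℝ => D *ᵥ v + b) volume volume := by
    have hD0 : D.det ≠ 0 := by intro h; rw [h] at hD; simp at hD
    have hD1 : MeasurePreserving (fun v : Fin n → ℝ => D *ᵥ v) volume volume := by
      refine ⟨by fun_prop, ?_⟩
      have := Real.map_matrix_volume_pi_eq_smul_volume_pi hD0
      rw [abs_inv, hD, inv_one, ENNReal.ofReal_one, one_smul] at this
      exact this
    exact (measurePreserving_add_right volume b).comp hD1
  have hFm : Measurable fun y : Fin n → ℝ => ∏ k, f k (y k) :=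
    Finset.measurable_fun_prod _ fun k _ => (hf k).comp (measurable_pi_apply k)
  calc _ ≤ ∫⁻ v in Set.Icc (0 : Fin n → ℝ) 1, ∏ k, f k ((D *ᵥ v + b) k) := by
        refine setLIntegral_mono' measurableSet_Icc fun v hvc => ?_
        rw [← Finset.mul_prod_erase Finset.univ _ (Finset.mem_univ i)]
        have hmem : ∀ k, (D *ᵥ v + b) k ∈ Set.Icc (b k - R) (b k + R) := by
          intro k
          have := abs_le.1 ((norm_le_pi_norm (D *ᵥ v) k).trans (hv v hvc))
          simp only [Pi.add_apply, Set.mem_Icc]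
          constructor <;> linarith [this.1, this.2]
        have hi : f i ((D *ᵥ v + b) i) = 1 := by
          simp only [f]; rw [Set.indicator_of_mem (hmem i)]; simp
        rw [hi, one_mul]
        refine le_of_eq (Finset.prod_congr rfl fun k hk => ?_)
        simp only [f]; rw [Set.indicator_of_mem (hmem k), if_neg (Finset.ne_of_mem_erase hk)]
    _ ≤ ∫⁻ v, ∏ k, f k ((D *ᵥ v + b) k) := setLIntegral_le_lintegral _ _
    _ = ∫⁻ y : Fin n → ℝ, ∏ k, f k (y k) := hmp.lintegral_comp hFm
    _ = ∏ k, ∫⁻ t, f k t := lintegral_fin_prod n f hf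
    _ ≤ ∏ k : Fin n, (C + ENNReal.ofReal (2 * R)) := by
        refine Finset.prod_le_prod' fun k _ => ?_
        simp only [f]
        rw [lintegral_indicator measurableSet_Icc]
        split_ifs
        · rw [setLIntegral_const, one_mul, Real.volume_Icc]
          refine le_add_left (le_of_eq ?_)
          congr 1; ring
        · exact (hCb (b k)).trans le_self_add
    _ = _ := by simp

end Kulk
end

section
open Matrix Filter Topology MeasureTheory

namespace Kulk

lemma pi_bound {ι X : Type*} [Fintype ι] [DecidableEq ι] [MeasurableSpace X] [Nonempty X]
    (μ0 : Measure X) [IsProbabilityMeasure μ0] {f : (ι → X) → ENNReal} (hf : Measurable f) (j : ι)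
    {C : ENNReal} (h : ∀ a, ∫⁻ v, f (Function.update a j v) ∂μ0 ≤ C) :
    ∫⁻ a, f a ∂(Measure.pi fun _ => μ0) ≤ C := by
  obtain ⟨x⟩ := ‹Nonempty X›
  rw [lintegral_eq_lmarginal_univ (fun _ => x), lmarginal_erase' _ hf (Finset.mem_univ j)]
  calc _ ≤ (lmarginal (fun _ : ι => μ0) (Finset.univ.erase j) (fun _ => C)) (fun _ => x) :=
        lmarginal_mono (fun a => h a) _
    _ = C := by simp [lmarginal]

/-- a shear killing the other coordinates of `x` -/
noncomputable def sh {n : ℕ} (x : Fin n → ℝ) (i : Fin n) : Matrix (Fin n) (Fin n) ℝ :=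
  1 + vecMulVec (Pi.single i 1 - (x i)⁻¹ • x) (Pi.single i 1)

lemma sh_det {n : ℕ} {x : Fin n → ℝ} {i : Fin n} (hi : x i ≠ 0) : (sh x i).det = 1 := by
  rw [sh, vecMulVec_eq Unit, det_one_add_replicateCol_mul_replicateRow]
  simp [hi]

lemma sh_apply {n : ℕ} (x : Fin n → ℝ) (i : Fin n) (z : Fin n → ℝ) :
    sh x i *ᵥ z = z + z i • (Pi.single i 1 - (x i)⁻¹ • x) := by
  rw [sh, add_mulVec, one_mulVec, vecMulVec_mulVec]
  simp

lemma sh_apply_ne {n : ℕ} (x : Fin n → ℝ) {i k : Fin n} (hk : k ≠ i) (z : Fin n → ℝ) :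
    (sh x i *ᵥ z) k = z k - (x i)⁻¹ * x k * z i := by
  rw [sh_apply]
  simp [hk]
  ring

lemma sh_norm {n : ℕ} {x : Fin n → ℝ} {i : Fin n} (hi : x i ≠ 0) (hmax : ∀ k, |x k| ≤ |x i|)
    (z : Fin n → ℝ) : ‖sh x i *ᵥ z‖ ≤ 2 * ‖z‖ := by
  rw [pi_norm_le_iff_of_nonneg (by positivity)]
  intro k
  have hk := norm_le_pi_norm z k
  have hi' := norm_le_pi_norm z i
  by_cases h : k = i
  · subst h
    rw [sh_apply]
    simp [hi]
    simp at hk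
    linarith [norm_nonneg z]
  · rw [sh_apply_ne x h]
    refine (norm_sub_le _ _).trans ?_
    have : ‖(x i)⁻¹ * x k * z i‖ ≤ ‖z i‖ := by
      rw [norm_mul]
      refine mul_le_of_le_one_left (norm_nonneg _) ?_
      rw [norm_mul, norm_inv, inv_mul_le_one₀ (norm_pos_iff.2 hi)]
      exact hmax k
    linarith

namespace Setup
variable {n : ℕ} {S : Setup n}

lemma sh_Pr {x : Fin n → ℝ} {i k : Fin n} (hi : x i ≠ 0) (hmax : ∀ k, |x k| ≤ |x i|) (hk : k ≠ i)
    (z : Fin n → ℝ) : ‖(sh x i *ᵥ z) k‖ ≤ 2 * ‖S.Pr x *ᵥ z‖ := by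
  have : (sh x i *ᵥ z) k = (sh x i *ᵥ (S.Pr x *ᵥ z)) k := by
    rw [S.Pr_mulVec, sh_apply_ne x hk, sh_apply_ne x hk]
    simp only [Pi.sub_apply, Pi.smul_apply, smul_eq_mul]
    field_simp
    ring
  rw [this]
  exact (norm_le_pi_norm _ k).trans (sh_norm hi hmax _)

namespace Bumps
variable (P : Bumps S)

/-- the dimension bound -/
lemma inner_bound (hn3 : 3 ≤ n) : ∃ C : ENNReal, C ≠ ⊤ ∧ ∀ x ∈ P.K0, ∃ j : P.ι, ∀ a : P.ι → Fin n → ℝ,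
    ∀ (up : (Fin n → ℝ) → (P.ι → Fin n → ℝ)), (∀ v, up v j = v) → (∀ v k, k ≠ j → up v k = a k) →
    ∫⁻ v in Set.Icc (0 : Fin n → ℝ) 1, (‖P.u (up v) x‖ₑ⁻¹) ^ (n - 2) ≤ C := by
  classical
  have hfin := P.locfin P.K0_compact P.K0_C
  -- lower bound for the radius
  obtain ⟨q0, hq0, hq⟩ : ∃ q0 : ℝ, 0 < q0 ∧ ∀ x ∈ P.K0, q0 ≤ Real.sqrt (S.Q x) :=
    P.K0_compact.exists_forall_le' (Real.continuous_sqrt.comp S.Q_continuous).continuousOn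
      fun x hx => Real.sqrt_pos.2 (S.C_iff.1 (P.K0_C hx))
  -- upper bound for the images of the cube
  obtain ⟨R, hR⟩ : ∃ R : ℝ, ∀ γ ∈ {γ : S.Γ | ∃ j, ∃ x ∈ P.K0, P.φ j (S.m γ *ᵥ x) ≠ 0},
      ∀ v ∈ Set.Icc (0 : Fin n → ℝ) 1, ‖S.m γ⁻¹ *ᵥ v‖ ≤ R := by
    have hγ : ∀ γ : S.Γ, ∃ R : ℝ, ∀ v ∈ Set.Icc (0 : Fin n → ℝ) 1, ‖S.m γ⁻¹ *ᵥ v‖ ≤ R := by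
      intro γ
      have hcont : Continuous fun v : Fin n → ℝ => S.m γ⁻¹ *ᵥ v := by fun_prop
      exact (isCompact_Icc (a := (0 : Fin n → ℝ)) (b := 1)).exists_bound_of_continuousOn hcont.continuousOn
    choose R hR using hγ
    obtain ⟨R0, hR0⟩ := (hfin.image R).bddAbove
    exact ⟨R0, fun γ hγ v hv => (hR γ v hv).trans (hR0 ⟨γ, hγ, rfl⟩)⟩
  have hn1 : (0 : ℝ) < (n : ℝ) - 1 := by
    have : (3 : ℝ) ≤ n := by exact_mod_cast hn3
    linarith
  set θ : ℝ := ((n : ℝ) - 2) / ((n : ℝ) - 1) with hθ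
  have hn3' : (3 : ℝ) ≤ n := by exact_mod_cast hn3
  have hθ0 : 0 ≤ θ := div_nonneg (by linarith) hn1.le
  have hθ1 : θ < 1 := by rw [hθ, div_lt_one hn1]; linarith
  obtain ⟨C, hC, hCb⟩ := affine_dim n hθ0 hθ1 (2 * R)
  set E : ENNReal := ENNReal.ofReal (2 / q0) with hE
  have hE0 : E ≠ 0 := by rw [hE, ENNReal.ofReal_ne_zero_iff]; positivity
  have hEt : E ≠ ⊤ := ENNReal.ofReal_ne_top
  refine ⟨(E ^ θ) ^ (n - 1) * C, ENNReal.mul_ne_top (ENNReal.pow_ne_top (ENNReal.rpow_ne_top_of_nonneg hθ0 hEt)) hC, fun x hx => ?_⟩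
  have hxC := P.K0_C hx
  have hQ : 0 < S.Q x := S.C_iff.1 hxC
  obtain ⟨j, γ, hγ⟩ := P.cov x hxC
  refine ⟨j, fun a up hj hk => ?_⟩
  have hM := P.M_eq hxC hγ
  have : Nonempty (Fin n) := ⟨⟨0, by omega⟩⟩
  obtain ⟨i, -, hmax⟩ := Finset.exists_max_image Finset.univ (fun k => |x k|) Finset.univ_nonempty
  replace hmax := fun k => hmax k (Finset.mem_univ k)
  have hi : x i ≠ 0 := by
    intro h0
    have : x = 0 := by
      funext k
      have := hmax k
      rw [h0, abs_zero] at this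
      exact abs_eq_zero.1 (le_antisymm this (abs_nonneg _))
    rw [this] at hQ
    simp [Q] at hQ
  set b : Fin n → ℝ := ∑ k ∈ Finset.univ.erase j, P.M k x *ᵥ a k with hb
  have hz : ∀ v, ∑ k, P.M k x *ᵥ up v k = S.m γ⁻¹ *ᵥ v + b := by
    intro v
    rw [← Finset.add_sum_erase Finset.univ _ (Finset.mem_univ j), hj, hM, hb]
    congr 1
    exact Finset.sum_congr rfl fun k hk' => by rw [hk v k (Finset.ne_of_mem_erase hk')]
  have hkey : ∀ v, ∀ k ∈ Finset.univ.erase i,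
      ‖P.u (up v) x‖ₑ⁻¹ ≤ E * ‖((sh x i * S.m γ⁻¹) *ᵥ v + sh x i *ᵥ b) k‖ₑ⁻¹ := by
    intro v k hk'
    have e : (sh x i * S.m γ⁻¹) *ᵥ v + sh x i *ᵥ b = sh x i *ᵥ (∑ k, P.M k x *ᵥ up v k) := by
      rw [hz, mulVec_add, mulVec_mulVec]
    rw [e]
    have h1 := sh_Pr (S := S) hi hmax (Finset.ne_of_mem_erase hk') (∑ k, P.M k x *ᵥ up v k)
    have h2 : ‖(sh x i *ᵥ (∑ k, P.M k x *ᵥ up v k)) k‖ ≤ 2 / q0 * ‖P.u (up v) x‖ := by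
      rw [u, norm_smul, Real.norm_of_nonneg (Real.sqrt_nonneg _)]
      refine h1.trans ?_
      rw [← mul_assoc]
      refine mul_le_mul_of_nonneg_right ?_ (norm_nonneg _)
      rw [div_mul_eq_mul_div, le_div_iff₀ hq0]
      linarith [hq x hx]
    have h3 : ‖(sh x i *ᵥ (∑ k, P.M k x *ᵥ up v k)) k‖ₑ ≤ E * ‖P.u (up v) x‖ₑ := by
      rw [← ofReal_norm, ← ofReal_norm, hE, ← ENNReal.ofReal_mul (by positivity)]
      exact ENNReal.ofReal_le_ofReal h2
    have h4 := mul_le_mul_right (ENNReal.inv_le_inv.2 h3) E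
    refine le_trans (le_of_eq ?_) h4
    rw [ENNReal.mul_inv (Or.inl hE0) (Or.inl hEt), ← mul_assoc, ENNReal.mul_inv_cancel hE0 hEt, one_mul]
  have hpt : ∀ v, (‖P.u (up v) x‖ₑ⁻¹) ^ (n - 2) ≤ (E ^ θ) ^ (n - 1) *
      ∏ k ∈ Finset.univ.erase i, (‖((sh x i * S.m γ⁻¹) *ᵥ v + sh x i *ᵥ b) k‖ₑ⁻¹) ^ θ := by
    intro v
    have hcard : (Finset.univ.erase i).card = n - 1 := by
      rw [Finset.card_erase_of_mem (Finset.mem_univ i), Finset.card_univ, Fintype.card_fin]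
    have e1 : (‖P.u (up v) x‖ₑ⁻¹) ^ (n - 2) = ∏ k ∈ Finset.univ.erase i, (‖P.u (up v) x‖ₑ⁻¹) ^ θ := by
      rw [Finset.prod_const, hcard, ← ENNReal.rpow_natCast, ← ENNReal.rpow_natCast, ← ENNReal.rpow_mul]
      congr 1
      rw [Nat.cast_sub (by omega), Nat.cast_sub (by omega), hθ]
      push_cast
      field_simp
    rw [e1, ← hcard, ← Finset.prod_const, ← Finset.prod_mul_distrib]
    refine Finset.prod_le_prod' fun k hk' => ?_
    rw [← ENNReal.mul_rpow_of_nonneg _ _ hθ0]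
    exact ENNReal.rpow_le_rpow (hkey v k hk') hθ0
  refine (lintegral_mono hpt).trans ?_
  rw [lintegral_const_mul' _ _ (ENNReal.pow_ne_top (ENNReal.rpow_ne_top_of_nonneg hθ0 hEt))]
  refine mul_le_mul_right (hCb _ _ i ?_ ?_) _
  · rw [det_mul, sh_det hi, one_mul, S.abs_det_m]
  · intro v hv
    rw [← mulVec_mulVec]
    refine (sh_norm hi hmax _).trans ?_
    have := hR γ ⟨j, x, hx, by rw [hγ]; exact one_ne_zero⟩ v hv
    linarith

lemma u_meas : Measurable (fun p : (P.ι → Fin n → ℝ) × (Fin n → ℝ) =>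
    S.C.indicator (P.u p.1) p.2) := by
  let N : P.ι → Fin n → Fin n → (Fin n → ℝ) → ℝ := fun k i l =>
    S.C.indicator (fun x => Real.sqrt (S.Q x) * (S.Pr x * P.M k x) i l)
  have hN : ∀ k i l, Measurable (N k i l) := by
    intro k i l
    refine S.measurable_indicator ?_
    intro x hx
    refine ContinuousAt.continuousWithinAt ?_
    refine ContinuousAt.mul (Real.continuous_sqrt.comp S.Q_continuous).continuousAt ?_
    exact (contDiffAt_matrix_mul (S.contDiffAt_Pr hx) (fun i l => P.msum_contDiffAt _ hx i l) i l).continuousAt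
  have e : (fun p : (P.ι → Fin n → ℝ) × (Fin n → ℝ) => S.C.indicator (P.u p.1) p.2) =
      fun p i => ∑ k, ∑ l, N k i l p.2 * p.1 k l := by
    funext p i
    by_cases hx : p.2 ∈ S.C
    · simp only [N]
      rw [Set.indicator_of_mem hx, u]
      simp only [Set.indicator_of_mem hx, mulVec_sum, mulVec_mulVec, Pi.smul_apply, Finset.sum_apply,
        smul_eq_mul, Finset.mul_sum]
      simp only [mulVec, dotProduct, Finset.mul_sum, mul_assoc]
    · simp only [N]
      rw [Set.indicator_of_notMem hx]
      simp only [Set.indicator_of_notMem hx]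
      simp
  rw [e, measurable_pi_iff]
  intro i
  refine Finset.measurable_fun_sum _ fun k _ => Finset.measurable_fun_sum _ fun l _ => ?_
  exact ((hN k i l).comp measurable_snd).mul (by fun_prop)

theorem generic (hn3 : 3 ≤ n) : ∃ a : P.ι → Fin n → ℝ,
    ∫⁻ x in P.K0, (‖P.u a x‖ₑ⁻¹) ^ (n - 2) ≠ ⊤ := by
  classical
  obtain ⟨C, hC, hCb⟩ := P.inner_bound hn3
  let μ0 : Measure (Fin n → ℝ) := volume.restrict (Set.Icc 0 1)
  have hμ0 : IsProbabilityMeasure μ0 := ⟨by simp [μ0, Real.volume_Icc_pi]⟩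
  let μ : Measure (P.ι → Fin n → ℝ) := Measure.pi fun _ => μ0
  let F : (P.ι → Fin n → ℝ) → (Fin n → ℝ) → ENNReal := fun a x => (‖S.C.indicator (P.u a) x‖ₑ⁻¹) ^ (n - 2)
  have hF : Measurable (Function.uncurry F) := by
    have := P.u_meas
    exact (this.enorm.inv).pow_const _
  have hFu : ∀ a, ∀ x ∈ P.K0, F a x = (‖P.u a x‖ₑ⁻¹) ^ (n - 2) := by
    intro a x hx
    simp only [F]; rw [Set.indicator_of_mem (P.K0_C hx)]
  have h1 : ∀ x ∈ P.K0, ∫⁻ a, F a x ∂μ ≤ C := by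
    intro x hx
    obtain ⟨j, hj⟩ := hCb x hx
    have hFx : Measurable fun a => F a x := hF.of_uncurry_right
    refine pi_bound μ0 hFx j fun a => ?_
    simp only [hFu _ x hx]
    exact hj a (fun v => Function.update a j v) (fun v => by simp) (fun v k hk => by simp [hk])
  have hK0m : MeasurableSet P.K0 := P.K0_compact.isClosed.measurableSet
  have h2 : ∫⁻ a, (∫⁻ x in P.K0, F a x) ∂μ ≤ C * volume P.K0 := by
    rw [lintegral_lintegral_swap hF.aemeasurable]
    refine (setLIntegral_mono' hK0m h1).trans ?_
    rw [setLIntegral_const]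
  obtain ⟨a, ha⟩ := exists_le_lintegral (μ := μ) (f := fun a => ∫⁻ x in P.K0, F a x)
    (Measurable.lintegral_prod_right hF).aemeasurable
  refine ⟨a, ?_⟩
  rw [← setLIntegral_congr_fun hK0m (hFu a)]
  exact ne_top_of_le_ne_top (ENNReal.mul_ne_top hC P.K0_compact.measure_lt_top.ne) (ha.trans h2)

end Bumps

theorem no_setup (S : Setup n) (hdet : S.η.det < 0) (hn : Odd n) (hn3 : 3 ≤ n) : False := by
  obtain ⟨P⟩ := S.exists_bumps
  obtain ⟨ν, c, hc, hfin, hν, hae, hle, ε, hε, K1, hK1, hK1C, hmil⟩ := S.milnor P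
  obtain ⟨a, ha⟩ := P.generic hn3
  have hu := P.u_field a
  have hK0m : MeasurableSet P.K0 := P.K0_compact.isClosed.measurableSet
  have hC : ∀ᵐ x ∂ν, x ∈ S.C := hae.mono fun x hx => P.K0_C hx
  have hmeas : AEMeasurable (P.u a) ν := aemeasurable_of_C hC hu.continuousOn
  have hle' : ν ≤ c • volume.restrict P.K0 := by
    rw [← Measure.restrict_eq_self_of_ae_mem hae, ← Measure.restrict_smul]
    exact Measure.restrict_mono le_rfl hle
  have hlt : ∫⁻ x, (‖P.u a x‖ₑ⁻¹) ^ (n - 2) ∂ν < ⊤ := by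
    refine (lintegral_mono' hle' le_rfl).trans_lt ?_
    rw [lintegral_smul_measure]
    exact ENNReal.mul_lt_top hc.lt_top ha.lt_top
  have hu0 : ∀ᵐ x ∂ν, P.u a x ≠ 0 := by
    filter_upwards [ae_lt_top' (hmeas.enorm.inv.pow_const _) hlt.ne] with x hx h0
    simp only [Pi.inv_apply] at hx
    rw [h0, enorm_zero, ENNReal.inv_zero, ENNReal.top_pow (by omega)] at hx
    exact lt_irrefl _ hx
  refine P.limit hν hae hε hK1 hK1C hmil hu hdet hn hn3 hu0 ⟨?_, ?_⟩
  · exact (hmeas.norm.inv.pow_const _).aestronglyMeasurable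
  · rw [HasFiniteIntegral]
    refine lt_of_le_of_lt (lintegral_mono_ae ?_) hlt
    filter_upwards [hu0] with x hx
    rw [enorm_pow, enorm_inv (norm_ne_zero_iff.2 hx), enorm_norm]

end Setup
end Kulk
end

lemma mem_pseudoSphere_iff (a b : ℕ) (x : Fin (a + b) → ℝ) :
    x ∈ pseudoSphere a b ↔ x ⬝ᵥ (pseudoForm a b *ᵥ x) = 1 := by
  have : x ⬝ᵥ (pseudoForm a b *ᵥ x)
      = ∑ i : Fin (a + b), (if (i : ℕ) < a then (1 : ℝ) else -1) * x i ^ 2 := by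
    simp only [pseudoForm, dotProduct, Matrix.mulVec_diagonal]
    refine Finset.sum_congr rfl fun i _ => ?_
    ring
  rw [this]
  rfl

lemma pseudoForm_det (a b : ℕ) : (pseudoForm a b).det = (-1) ^ b := by
  rw [pseudoForm, Matrix.det_diagonal, Fin.prod_univ_add]
  simp

lemma pseudoForm_sq (a b : ℕ) : pseudoForm a b * pseudoForm a b = 1 := by
  rw [pseudoForm, Matrix.diagonal_mul_diagonal, ← Matrix.diagonal_one]
  congr 1
  funext i
  split_ifs <;> norm_num

/-- **Kulkarni.**  For `p, q` odd, no discrete subgroup `Γ` of `O(p+1, q)` acts freely,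
properly discontinuously and cocompactly on the quadric
`X = {x : x₁² + ⋯ + x_{p+1}² − x_{p+2}² − ⋯ − x_{p+1+q}² = 1}`; equivalently, the space form
`O(p,q)\O(p+1,q)` has no compact Clifford–Klein form. -/
theorem kulkarni_odd_no_compact_form (p q : ℕ) (hp : Odd p) (hq : Odd q)
    (hp0 : 0 < p) (hq0 : 0 < q)
    (Γ : Subgroup (Matrix.GeneralLinearGroup (Fin (p + 1 + q)) ℝ))
    (hΓ : ∀ γ ∈ Γ, (γ : Matrix (Fin (p + 1 + q)) (Fin (p + 1 + q)) ℝ)ᵀ *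
      pseudoForm (p + 1) q * γ = pseudoForm (p + 1) q)
    (hdisc : DiscreteTopology Γ) :
    ¬ ((∀ γ : Γ, (∃ x ∈ pseudoSphere (p + 1) q,
          ((γ : Matrix.GeneralLinearGroup (Fin (p + 1 + q)) ℝ) :
              Matrix (Fin (p + 1 + q)) (Fin (p + 1 + q)) ℝ).mulVec x = x) → γ = 1) ∧
        (∀ K L : Set (Fin (p + 1 + q) → ℝ),
          K ⊆ pseudoSphere (p + 1) q → L ⊆ pseudoSphere (p + 1) q →
          IsCompact K → IsCompact L →
          {γ : Γ | ∃ x ∈ K,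
            ((γ : Matrix.GeneralLinearGroup (Fin (p + 1 + q)) ℝ) :
                Matrix (Fin (p + 1 + q)) (Fin (p + 1 + q)) ℝ).mulVec x ∈ L}.Finite) ∧
        (∃ K : Set (Fin (p + 1 + q) → ℝ), K ⊆ pseudoSphere (p + 1) q ∧ IsCompact K ∧
          ∀ x ∈ pseudoSphere (p + 1) q, ∃ γ ∈ Γ, ∃ y ∈ K,
            ((γ : Matrix.GeneralLinearGroup (Fin (p + 1 + q)) ℝ) :
                Matrix (Fin (p + 1 + q)) (Fin (p + 1 + q)) ℝ).mulVec y = x)) := by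
  rintro ⟨hfree, hproper, K, hKs, hKc, hcov⟩
  have hm := mem_pseudoSphere_iff (p + 1) q
  let S : Kulk.Setup (p + 1 + q) :=
    { η := pseudoForm (p + 1) q
      Γ := Γ
      hη := by rw [pseudoForm, Matrix.diagonal_transpose]
      hηη := pseudoForm_sq _ _
      hΓ := hΓ
      free := fun γ x hx h => hfree γ ⟨x, (hm x).2 hx, h⟩
      proper := fun K L hK hL => hproper K L (fun x hx => (hm x).2 (hK x hx))
        (fun x hx => (hm x).2 (hL x hx))
      K := K
      hK1 := fun x hx => (hm x).1 (hKs hx)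
      hKc := hKc
      hKcov := fun x hx => by
        obtain ⟨γ, hγ, y, hy, h⟩ := hcov x ((hm x).2 hx)
        exact ⟨⟨γ, hγ⟩, y, hy, h⟩
      x₀ := Pi.single ⟨0, by omega⟩ 1
      hx₀ := by simp [pseudoForm, Matrix.mulVec_diagonal] }
  refine S.no_setup ?_ ?_ ?_
  · change (pseudoForm (p + 1) q).det < 0
    rw [pseudoForm_det, hq.neg_one_pow]
    norm_num
  · obtain ⟨k, rfl⟩ := hp
    obtain ⟨l, rfl⟩ := hq
    exact ⟨k + l + 1, by ring⟩
  · omega
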